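/- Existence and uniqueness for linear strongly parabolic systems on the torus (Theorem 2.4 for M = 𝕋^n with the trivial bundle): Let T > 0 and let A^{aI}_b : ℝ^n × [0,T] → ℝ (|I| ≤ r, 1 ≤ a,b ≤ l) be ℤ^n-periodic in x with A^{aI}_b ∈ C^{α,α/r}(ℝ^n×[0,T],ℝ), and assume the associated operators (L_t) are strongly elliptic with constant λ > 0. Let f ∈ C^{α,α/r}(ℝ^n×[0,T],ℝ^l) be ℤ^n-periodic in x and let u₀ ∈ C^{r+α}(ℝ^n,ℝ^l) be ℤ^n-periodic. Then there exists one and only one u ∈ C^{r+α,1+α/r}(ℝ^n×[0,T],ℝ^l), ℤ^n-periodic in x, satisfying ∂u/∂t = L_t u + f on ℝ^n×[0,T] and u(·,0) = u₀. -/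

import Mathlib

open scoped BigOperators
noncomputable section

/-- Euclidean space `ℝ^n`. -/
abbrev Vec (n : ℕ) := EuclideanSpace ℝ (Fin n)

/-- Iterated spatial partial derivative (within `D`) in the directions `I = (i_1, …, i_k)`. -/
def pderivW {n l : ℕ} (D : Set (Vec n)) (k : ℕ) (I : Fin k → Fin n)
    (w : Vec n → Vec l) : Vec n → Vec l :=
  fun x => iteratedFDerivWithin ℝ k w D x (fun j => EuclideanSpace.single (I j) 1)

/-- Spatial partial derivative `∂_I u(⋅,t)` of a space-time function (within `D`). -/
def spDerivW {n l : ℕ} (D : Set (Vec n)) (k : ℕ) (I : Fin k → Fin n)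
    (u : Vec n → ℝ → Vec l) : Vec n → ℝ → Vec l :=
  fun x t => pderivW D k I (fun y => u y t) x

/-- Time derivative `∂_t u` within the time interval `J`. -/
def tDerivW {n l : ℕ} (J : Set ℝ) (u : Vec n → ℝ → Vec l) : Vec n → ℝ → Vec l :=
  fun x t => derivWithin (fun s => u x s) J t

/-- Supremum norm `|w|_{0;Q}`. -/
def supQ {n l : ℕ} (Q : Set (Vec n × ℝ)) (w : Vec n → ℝ → Vec l) : ℝ :=
  sSup {c | ∃ p ∈ Q, c = ‖w p.1 p.2‖}

/-- The set of parabolic Hölder difference quotients of exponent `α` (parabolic order `r`). -/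
def holQuot {n l : ℕ} (r : ℕ) (α : ℝ) (Q : Set (Vec n × ℝ))
    (w : Vec n → ℝ → Vec l) : Set ℝ :=
  {c | ∃ p ∈ Q, ∃ q ∈ Q, p ≠ q ∧
    c = ‖w p.1 p.2 - w q.1 q.2‖ / (‖p.1 - q.1‖ ^ α + |p.2 - q.2| ^ (α / r))}

/-- Parabolic Hölder seminorm `[w]_{α;Q}`. -/
def parSemi {n l : ℕ} (r : ℕ) (α : ℝ) (Q : Set (Vec n × ℝ))
    (w : Vec n → ℝ → Vec l) : ℝ :=
  sSup (holQuot r α Q w)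

/-- Parabolic Hölder norm `‖u‖_{C^{r+α,1+α/r}(D × J)}`. -/
def parNorm {n l : ℕ} (r : ℕ) (α : ℝ) (D : Set (Vec n)) (J : Set ℝ)
    (u : Vec n → ℝ → Vec l) : ℝ :=
  (∑ k ∈ Finset.range (r + 1), ∑ I : Fin k → Fin n, supQ (D ×ˢ J) (spDerivW D k I u))
    + supQ (D ×ˢ J) (tDerivW J u)
    + (∑ I : Fin r → Fin n, parSemi r α (D ×ˢ J) (spDerivW D r I u))
    + parSemi r α (D ×ˢ J) (tDerivW J u)

/-- Membership in the parabolic Hölder space `C^{r+α,1+α/r}(D × J, ℝ^l)`. -/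
def MemPar {n l : ℕ} (r : ℕ) (α : ℝ) (D : Set (Vec n)) (J : Set ℝ)
    (u : Vec n → ℝ → Vec l) : Prop :=
  ContinuousOn (fun p : Vec n × ℝ => u p.1 p.2) (D ×ˢ J) ∧
  (∀ t ∈ J, ContDiffOn ℝ r (fun x => u x t) D) ∧
  (∀ x ∈ D, DifferentiableOn ℝ (fun s => u x s) J) ∧
  (∀ k, k ≤ r → ∀ I : Fin k → Fin n,
    ContinuousOn (fun p : Vec n × ℝ => spDerivW D k I u p.1 p.2) (D ×ˢ J)) ∧
  ContinuousOn (fun p : Vec n × ℝ => tDerivW J u p.1 p.2) (D ×ˢ J) ∧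
  (∀ I : Fin r → Fin n, BddAbove (holQuot r α (D ×ˢ J) (spDerivW D r I u))) ∧
  BddAbove (holQuot r α (D ×ˢ J) (tDerivW J u))

/-- The norm of `C^{α,α/r}(Q)`. -/
def lowNorm {n l : ℕ} (r : ℕ) (α : ℝ) (Q : Set (Vec n × ℝ))
    (f : Vec n → ℝ → Vec l) : ℝ :=
  supQ Q f + parSemi r α Q f

/-- Membership in `C^{α,α/r}(Q, ℝ^l)`. -/
def MemLow {n l : ℕ} (r : ℕ) (α : ℝ) (Q : Set (Vec n × ℝ))
    (f : Vec n → ℝ → Vec l) : Prop :=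
  ContinuousOn (fun p : Vec n × ℝ => f p.1 p.2) Q ∧ BddAbove (holQuot r α Q f)

/-- Spatial Hölder quotient set. -/
def spHolQuot {n l : ℕ} (D : Set (Vec n)) (α : ℝ) (w : Vec n → Vec l) : Set ℝ :=
  {c | ∃ x ∈ D, ∃ y ∈ D, x ≠ y ∧ c = ‖w x - w y‖ / ‖x - y‖ ^ α}

/-- The elliptic Hölder norm `‖u₀‖_{C^{r+α}(D)}`. -/
def spNorm {n l : ℕ} (r : ℕ) (α : ℝ) (D : Set (Vec n)) (u₀ : Vec n → Vec l) : ℝ :=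
  (∑ k ∈ Finset.range (r + 1), ∑ I : Fin k → Fin n,
    sSup {c | ∃ x ∈ D, c = ‖pderivW D k I u₀ x‖})
    + ∑ I : Fin r → Fin n, sSup (spHolQuot D α (pderivW D r I u₀))

/-- Membership in `C^{r+α}(D, ℝ^l)`. -/
def MemSp {n l : ℕ} (r : ℕ) (α : ℝ) (D : Set (Vec n)) (u₀ : Vec n → Vec l) : Prop :=
  ContDiffOn ℝ r u₀ D ∧ ∀ I : Fin r → Fin n, BddAbove (spHolQuot D α (pderivW D r I u₀))

/-- Action `(L_t u)(x)` of the time-dependent linear differential operator of order `r` with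
coefficients `A k I a b` (`k = |I| ≤ r`). -/
def applyL {n l : ℕ} (r : ℕ) (D : Set (Vec n))
    (A : (k : ℕ) → (Fin k → Fin n) → Fin l → Fin l → Vec n → ℝ → ℝ)
    (u : Vec n → ℝ → Vec l) : Vec n → ℝ → Vec l :=
  fun x t => (EuclideanSpace.equiv (Fin l) ℝ).symm fun a =>
    ∑ k ∈ Finset.range (r + 1), ∑ I : Fin k → Fin n, ∑ b : Fin l,
      A k I a b x t * spDerivW D k I u x t b

/-- Legendre–Hadamard strong ellipticity with constant `lam` on `Q`. -/
def StrongEllip {n l : ℕ} (r : ℕ)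
    (A : (k : ℕ) → (Fin k → Fin n) → Fin l → Fin l → Vec n → ℝ → ℝ)
    (Q : Set (Vec n × ℝ)) (lam : ℝ) : Prop :=
  ∀ p ∈ Q, ∀ ξ : Vec n, ∀ v : Vec l,
    lam * ‖ξ‖ ^ r * ‖v‖ ^ 2 ≤
      (-1 : ℝ) ^ (r / 2 - 1) *
        ∑ I : Fin r → Fin n, ∑ a : Fin l, ∑ b : Fin l,
          A r I a b p.1 p.2 * (∏ j, ξ (I j)) * v a * v b

/-- `ℤ^n`-periodicity. -/
def PerZ {n : ℕ} {β : Type*} (g : Vec n → β) : Prop :=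
  ∀ x : Vec n, ∀ m : Fin n → ℤ,
    g (x + (EuclideanSpace.equiv (Fin n) ℝ).symm fun i => (m i : ℝ)) = g x

/-- Real-valued functions viewed as `ℝ^1`-valued. -/
def toV1 {n : ℕ} (g : Vec n → ℝ → ℝ) : Vec n → ℝ → Vec 1 :=
  fun x t => (EuclideanSpace.equiv (Fin 1) ℝ).symm fun _ => g x t

namespace ParaTorus
set_option linter.unusedSectionVars false
set_option maxSynthPendingDepth 3
open Filter Topology Set MeasureTheory
open scoped ContDiff BigOperators SchwartzMap LineDeriv FourierTransform

section Exp
variable {V : Type} [NormedAddCommGroup V] [InnerProductSpace ℝ V] [FiniteDimensional ℝ V]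
  [CompleteSpace V]
variable {U : Type} [NormedAddCommGroup U] [InnerProductSpace ℝ U] [FiniteDimensional ℝ U]
  [CompleteSpace U]

theorem exp_intertwine (M : V →L[ℝ] V) (B : U →L[ℝ] U) (J : U →L[ℝ] V)
    (h : M.comp J = J.comp B) :
    (NormedSpace.exp M).comp J = J.comp (NormedSpace.exp B) := by
  have hp : ∀ k : ℕ, (M ^ k).comp J = J.comp (B ^ k) := by
    intro k
    induction k with
    | zero => ext; simp
    | succ k ih =>
      rw [pow_succ, pow_succ']
      change (M ^ k).comp (M.comp J) = (J.comp B).comp (B ^ k)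
      rw [h]
      change ((M ^ k).comp J).comp B = _
      rw [ih]
      change J.comp (B ^ k * B) = J.comp (B * B ^ k)
      rw [← pow_succ, ← pow_succ']
  have h1 := (NormedSpace.exp_series_hasSum_exp' (𝕂 := ℝ) M).mapL
    ((ContinuousLinearMap.compL ℝ U V V).flip J)
  have h2 := (NormedSpace.exp_series_hasSum_exp' (𝕂 := ℝ) B).mapL
    ((ContinuousLinearMap.compL ℝ U U V) J)
  have hE : (fun k : ℕ => ((ContinuousLinearMap.compL ℝ U V V).flip J)
      (((k.factorial : ℝ))⁻¹ • M ^ k)) =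
      fun k : ℕ => ((ContinuousLinearMap.compL ℝ U U V) J) (((k.factorial : ℝ))⁻¹ • B ^ k) := by
    funext k
    simp [hp]
  rw [hE] at h1
  exact h1.unique h2

theorem norm_exp_le_of_inner_le (B : V →L[ℝ] V) (κ : ℝ)
    (h : ∀ v, inner ℝ (B v) v ≤ - κ * ‖v‖ ^ 2) :
    ‖NormedSpace.exp B‖ ≤ Real.exp (-κ) := by
  refine ContinuousLinearMap.opNorm_le_bound _ (Real.exp_pos _).le fun v => ?_
  let w : ℝ → V := fun t => NormedSpace.exp (t • B) v
  have hw : ∀ t, HasDerivAt w (B (w t)) t := by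
    intro t
    have := (hasDerivAt_exp_smul_const' (𝕂 := ℝ) B t).clm_apply (hasDerivAt_const t v)
    simpa [w] using this
  let φ : ℝ → ℝ := fun t => Real.exp (2 * κ * t) * ‖w t‖ ^ 2
  have hφ : ∀ t, HasDerivAt φ (Real.exp (2 * κ * t) * (2 * κ) * ‖w t‖ ^ 2
      + Real.exp (2 * κ * t) * (2 * inner ℝ (w t) (B (w t)))) t := by
    intro t
    have h1 : HasDerivAt (fun t => Real.exp (2 * κ * t)) (Real.exp (2 * κ * t) * (2 * κ)) t := by
      simpa using ((hasDerivAt_id t).const_mul (2 * κ)).exp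
    exact h1.mul (hw t).norm_sq
  have hanti : Antitone φ := by
    refine antitone_of_deriv_nonpos (fun t => (hφ t).differentiableAt) fun t => ?_
    rw [(hφ t).deriv]
    have h3 := h (w t)
    rw [real_inner_comm] at h3
    have h4 := Real.exp_pos (2 * κ * t)
    nlinarith
  have h5 : φ 1 ≤ φ 0 := hanti zero_le_one
  have h6 : φ 1 = (Real.exp κ * ‖NormedSpace.exp B v‖) ^ 2 := by
    simp only [φ, w, mul_pow, one_smul, ← Real.exp_nat_mul]
    norm_num
  have h7 : φ 0 = ‖v‖ ^ 2 := by simp [φ, w]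
  rw [h6, h7] at h5
  have h8 : Real.exp κ * ‖NormedSpace.exp B v‖ ≤ ‖v‖ := by
    refine le_of_sq_le_sq ?_ (norm_nonneg _)
    exact h5
  rw [Real.exp_neg, inv_mul_eq_div, le_div_iff₀ (Real.exp_pos _)]
  linarith

/-- The Hilbert sum of two copies of `V`, carrying only its normed structure. -/
def Dbl (V : Type) : Type := WithLp 2 (V × V)

instance (V : Type) [NormedAddCommGroup V] : NormedAddCommGroup (Dbl V) :=
  inferInstanceAs (NormedAddCommGroup (WithLp 2 (V × V)))

instance (V : Type) [NormedAddCommGroup V] [InnerProductSpace ℝ V] :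
    InnerProductSpace ℝ (Dbl V) :=
  inferInstanceAs (InnerProductSpace ℝ (WithLp 2 (V × V)))

instance (V : Type) [NormedAddCommGroup V] [InnerProductSpace ℝ V] [FiniteDimensional ℝ V] :
    FiniteDimensional ℝ (Dbl V) :=
  inferInstanceAs (FiniteDimensional ℝ (WithLp 2 (V × V)))

instance (V : Type) [NormedAddCommGroup V] [InnerProductSpace ℝ V] [CompleteSpace V] :
    CompleteSpace (Dbl V) :=
  inferInstanceAs (CompleteSpace (WithLp 2 (V × V)))

/-- The identification of `Dbl V` with the product. -/
def dblEquiv (V : Type) [NormedAddCommGroup V] [InnerProductSpace ℝ V] :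
    Dbl V ≃L[ℝ] V × V := WithLp.prodContinuousLinearEquiv 2 ℝ V V

theorem dbl_norm_sq (w : Dbl V) :
    ‖w‖ ^ 2 = ‖(dblEquiv V w).1‖ ^ 2 + ‖(dblEquiv V w).2‖ ^ 2 :=
  WithLp.prod_norm_sq_eq_of_L2 _

theorem dbl_inner (w z : Dbl V) :
    inner ℝ w z = inner ℝ (dblEquiv V w).1 (dblEquiv V z).1
      + inner ℝ (dblEquiv V w).2 (dblEquiv V z).2 :=
  WithLp.prod_inner_apply w z

/-- The block operator `[[B, C], [0, D]]` on `V × V`. -/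
def augL (V : Type) [NormedAddCommGroup V] [InnerProductSpace ℝ V] [FiniteDimensional ℝ V] :
    ((V →L[ℝ] V) × (V →L[ℝ] V) × (V →L[ℝ] V)) →L[ℝ] (Dbl V →L[ℝ] Dbl V) :=
  LinearMap.toContinuousLinearMap
  { toFun := fun p =>
      ((dblEquiv V).symm : (V × V) →L[ℝ] Dbl V).comp
      (((p.1.comp (ContinuousLinearMap.fst ℝ V V) + p.2.1.comp (ContinuousLinearMap.snd ℝ V V)).prod
        (p.2.2.comp (ContinuousLinearMap.snd ℝ V V))).comp
        (dblEquiv V : Dbl V →L[ℝ] V × V))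
    map_add' := by
      intro p q
      ext v
      apply (dblEquiv V).injective
      simp [add_add_add_comm]
    map_smul' := by
      intro c p
      ext v
      apply (dblEquiv V).injective
      simp }

/-- The corner `v ↦ M (0, v)`, first component. -/
def cornerL (V : Type) [NormedAddCommGroup V] [InnerProductSpace ℝ V] [FiniteDimensional ℝ V] :
    (Dbl V →L[ℝ] Dbl V) →L[ℝ] (V →L[ℝ] V) :=
  LinearMap.toContinuousLinearMap
  { toFun := fun M =>
      ((ContinuousLinearMap.fst ℝ V V).comp (dblEquiv V : Dbl V →L[ℝ] V × V)).comp
      (M.comp (((dblEquiv V).symm : (V × V) →L[ℝ] Dbl V).comp (ContinuousLinearMap.inr ℝ V V)))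
    map_add' := by
      intro p q
      ext v; simp
    map_smul' := by
      intro c p
      ext v; simp }

theorem augL_apply (p : (V →L[ℝ] V) × (V →L[ℝ] V) × (V →L[ℝ] V)) (w : Dbl V) :
    dblEquiv V (augL V p w) = (p.1 (dblEquiv V w).1 + p.2.1 (dblEquiv V w).2,
      p.2.2 (dblEquiv V w).2) := by
  change dblEquiv V ((dblEquiv V).symm _) = _
  rw [ContinuousLinearEquiv.apply_symm_apply]
  rfl

theorem cornerL_apply (M : Dbl V →L[ℝ] Dbl V) (v : V) :
    cornerL V M v = (dblEquiv V (M ((dblEquiv V).symm (0, v)))).1 := rfl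

theorem corner_exp_eq (B D : V →L[ℝ] V) (ε : ℝ) :
    cornerL V (NormedSpace.exp (augL V (B, ε⁻¹ • (D - B), D))) =
      ε⁻¹ • (NormedSpace.exp D - NormedSpace.exp B) := by
  set M := augL V (B, ε⁻¹ • (D - B), D)
  let e := ((dblEquiv V).symm : (V × V) →L[ℝ] Dbl V)
  let J1 : V →L[ℝ] Dbl V := e.comp (ContinuousLinearMap.inl ℝ V V)
  let J2 : V →L[ℝ] Dbl V :=
    e.comp ((ε⁻¹ • ContinuousLinearMap.id ℝ V).prod (ContinuousLinearMap.id ℝ V))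
  have hJ1 : ∀ v, J1 v = (dblEquiv V).symm (v, 0) := fun v => rfl
  have hJ2 : ∀ v, J2 v = (dblEquiv V).symm (ε⁻¹ • v, v) := fun v => rfl
  have h1 := exp_intertwine M B J1 (by
    ext v
    apply (dblEquiv V).injective
    simp [M, augL_apply, hJ1])
  have h2 := exp_intertwine M D J2 (by
    ext v
    apply (dblEquiv V).injective
    simp [M, augL_apply, hJ2, smul_sub])
  ext v
  have h1' := congrArg (fun L : V →L[ℝ] Dbl V => (dblEquiv V (L (ε⁻¹ • v))).1) h1
  have h2' := congrArg (fun L : V →L[ℝ] Dbl V => (dblEquiv V (L v)).1) h2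
  simp only [ContinuousLinearMap.comp_apply, hJ1, hJ2,
    ContinuousLinearEquiv.apply_symm_apply] at h1' h2'
  have h3 : (dblEquiv V).symm ((0 : V), v) =
      (dblEquiv V).symm (ε⁻¹ • v, v) - (dblEquiv V).symm (ε⁻¹ • v, 0) := by
    rw [← map_sub]; simp
  rw [cornerL_apply, h3, map_sub, map_sub, Prod.fst_sub, h1', h2']
  simp [smul_sub]


theorem contDiff_exp : ContDiff ℝ ∞ (NormedSpace.exp : (V →L[ℝ] V) → (V →L[ℝ] V)) :=
  contDiff_iff_contDiffAt.2 fun x => (NormedSpace.exp_analytic (𝕂 := ℝ) x).contDiffAt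

variable {X : Type} [NormedAddCommGroup X] [NormedSpace ℝ X]

theorem norm_iteratedFDeriv_clm_le {E F : Type*} [NormedAddCommGroup E] [NormedSpace ℝ E]
    [NormedAddCommGroup F] [NormedSpace ℝ F] (Λ : E →L[ℝ] F) {f : X → E} (hf : ContDiff ℝ ∞ f)
    (m : ℕ) (x : X) :
    ‖iteratedFDeriv ℝ m (fun x => Λ (f x)) x‖ ≤ ‖Λ‖ * ‖iteratedFDeriv ℝ m f x‖ := by
  have := Λ.iteratedFDeriv_comp_left hf.contDiffAt (x := x) (i := m) (by exact_mod_cast le_top)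
  change ‖iteratedFDeriv ℝ m (Λ ∘ f) x‖ ≤ _
  rw [this]
  exact ContinuousLinearMap.norm_compContinuousMultilinearMap_le _ _

/-- The directional derivative of an exponential is a corner of an exponential. -/
theorem fderiv_exp_comp (B : X → V →L[ℝ] V) (hB : ContDiff ℝ ∞ B) (x e : X) :
    fderiv ℝ (fun x => NormedSpace.exp (B x)) x e =
      cornerL V (NormedSpace.exp (augL V (B x, fderiv ℝ B x e, B x))) := by
  have hd : Differentiable ℝ (fun x => NormedSpace.exp (B x)) :=
    (contDiff_exp.comp hB).differentiable (by simp)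
  have hl := (hd x).hasFDerivAt.hasLineDerivAt e
  have hBd : Differentiable ℝ B := hB.differentiable (by simp)
  have hlB := (hBd x).hasFDerivAt.hasLineDerivAt e
  have h1 := hl.tendsto_slope_zero
  have h2 := hlB.tendsto_slope_zero
  have hc : Tendsto (fun t : ℝ => B (x + t • e)) (𝓝[≠] 0) (𝓝 (B x)) := by
    have : Continuous fun t : ℝ => B (x + t • e) := hB.continuous.comp (by fun_prop)
    simpa using (this.tendsto 0).mono_left nhdsWithin_le_nhds
  have h3 : Tendsto (fun t : ℝ => cornerL V (NormedSpace.exp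
      (augL V (B x, t⁻¹ • (B (x + t • e) - B x), B (x + t • e))))) (𝓝[≠] 0)
      (𝓝 (cornerL V (NormedSpace.exp (augL V (B x, fderiv ℝ B x e, B x))))) := by
    have hcont : Continuous fun p => cornerL V (NormedSpace.exp (augL V p)) :=
      (cornerL V).continuous.comp ((contDiff_exp (V := Dbl V)).continuous.comp (augL V).continuous)
    exact (hcont.tendsto _).comp (tendsto_const_nhds.prodMk_nhds (h2.prodMk_nhds hc))
  simp only [corner_exp_eq] at h3
  exact tendsto_nhds_unique h1 h3

/-- Smooth families of operators whose exponentials are Schwartz functions. -/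
structure Adm (r : ℕ) (B : X → V →L[ℝ] V) : Prop where
  smooth : ContDiff ℝ ∞ B
  diss : ∃ c > 0, ∃ C, ∀ x v, inner ℝ (B x v) v ≤ (C - c * ‖x‖ ^ r) * ‖v‖ ^ 2
  growth : ∀ m : ℕ, ∃ C, ∀ x, ‖iteratedFDeriv ℝ (m + 1) B x‖ ≤ C * (1 + ‖x‖ ^ (r - 1))

theorem exists_pow_absorb (r : ℕ) (hr : 1 ≤ r) (c C : ℝ) (hc : 0 < c) (hC : 0 ≤ C) :
    ∃ K, ∀ s : ℝ, 0 ≤ s → C * (1 + s ^ (r - 1)) ≤ K + c * s ^ r := by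
  refine ⟨C + C * (C / c) ^ (r - 1), fun s hs => ?_⟩
  have hcs : 0 ≤ c * s ^ r := by positivity
  have hq : 0 ≤ C / c := by positivity
  rcases le_total s (C / c) with h | h
  · have : s ^ (r - 1) ≤ (C / c) ^ (r - 1) := pow_le_pow_left₀ hs h _
    nlinarith
  · have h1 : C ≤ c * s := by rw [div_le_iff₀ hc] at h; linarith
    have h2 : s ^ r = s * s ^ (r - 1) := by
      rw [← pow_succ']; congr 1; omega
    have h3 : 0 ≤ s ^ (r - 1) := by positivity
    have h4 : 0 ≤ C * (C / c) ^ (r - 1) := by positivity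
    rw [h2]
    nlinarith

theorem Adm.aug {r : ℕ} (hr : 1 ≤ r) {B : X → V →L[ℝ] V} (h : Adm r B) (e : X) :
    Adm r (fun x => augL V (B x, fderiv ℝ B x e, B x)) := by
  have hs := h.smooth
  have hs' : ContDiff ℝ ∞ (fun x => fderiv ℝ B x e) :=
    (hs.fderiv_right (m := ∞) (by simp)).clm_apply contDiff_const
  have hgr : ∀ m : ℕ, ∃ C, ∀ x, ‖iteratedFDeriv ℝ m (fun x => fderiv ℝ B x e) x‖
      ≤ C * (1 + ‖x‖ ^ (r - 1)) := by
    intro m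
    obtain ⟨C, hC⟩ := h.growth m
    refine ⟨‖e‖ * C, fun x => ?_⟩
    let Λ : (X →L[ℝ] (V →L[ℝ] V)) →L[ℝ] (V →L[ℝ] V) := ContinuousLinearMap.apply ℝ _ e
    have h1 : ‖iteratedFDeriv ℝ m (fun x => fderiv ℝ B x e) x‖ ≤
        ‖Λ‖ * ‖iteratedFDeriv ℝ m (fderiv ℝ B) x‖ :=
      norm_iteratedFDeriv_clm_le Λ (f := fderiv ℝ B) (hs.fderiv_right (m := ∞) (by simp)) m x
    have h2 : ‖Λ‖ ≤ ‖e‖ :=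
      ContinuousLinearMap.opNorm_le_bound _ (norm_nonneg _) fun f => by
        rw [mul_comm]; exact f.le_opNorm e
    rw [norm_iteratedFDeriv_fderiv] at h1
    calc _ ≤ _ := h1
      _ ≤ ‖e‖ * (C * (1 + ‖x‖ ^ (r - 1))) := by
        gcongr
        exact hC x
      _ = _ := by ring
  refine ⟨(augL V).contDiff.comp (hs.prodMk (hs'.prodMk hs)), ?_, ?_⟩
  · obtain ⟨c, hc, C, hd⟩ := h.diss
    obtain ⟨C1, hC1⟩ := hgr 0
    obtain ⟨K, hK⟩ := exists_pow_absorb r hr (c / 2) |C1| (by positivity) (abs_nonneg _)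
    refine ⟨c / 2, by positivity, C + K, fun x v => ?_⟩
    rw [dbl_inner, dbl_norm_sq, augL_apply]
    set a := (dblEquiv V v).1
    set b := (dblEquiv V v).2
    have h1 := hd x a
    have h2 := hd x b
    have h3 : ‖fderiv ℝ B x e‖ ≤ K + c / 2 * ‖x‖ ^ r := by
      have := hC1 x
      rw [norm_iteratedFDeriv_zero] at this
      have h4 : C1 * (1 + ‖x‖ ^ (r - 1)) ≤ |C1| * (1 + ‖x‖ ^ (r - 1)) := by
        gcongr
        exact le_abs_self _
      linarith [hK ‖x‖ (norm_nonneg _)]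
    have h5 : inner ℝ (fderiv ℝ B x e b) a ≤ (K + c / 2 * ‖x‖ ^ r) * ‖b‖ * ‖a‖ := by
      calc _ ≤ ‖fderiv ℝ B x e b‖ * ‖a‖ := real_inner_le_norm _ _
        _ ≤ ‖fderiv ℝ B x e‖ * ‖b‖ * ‖a‖ := by
          gcongr
          exact ContinuousLinearMap.le_opNorm _ _
        _ ≤ _ := by gcongr
    have h6 : 0 ≤ K + c / 2 * ‖x‖ ^ r := (norm_nonneg _).trans h3
    have h7 : (K + c / 2 * ‖x‖ ^ r) * ‖b‖ * ‖a‖ ≤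
        (K + c / 2 * ‖x‖ ^ r) * (‖a‖ ^ 2 + ‖b‖ ^ 2) := by
      rw [mul_assoc]
      apply mul_le_mul_of_nonneg_left _ h6
      nlinarith [sq_nonneg (‖a‖ - ‖b‖), sq_nonneg (‖a‖ + ‖b‖)]
    rw [inner_add_left]
    nlinarith
  · intro m
    obtain ⟨C, hC⟩ := h.growth m
    obtain ⟨C', hC'⟩ := hgr (m + 1)
    refine ⟨‖augL V‖ * (|C| + |C'|), fun x => ?_⟩
    have h1 : ‖iteratedFDeriv ℝ (m + 1) (fun x => augL V (B x, fderiv ℝ B x e, B x)) x‖ ≤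
        ‖augL V‖ * ‖iteratedFDeriv ℝ (m + 1) (fun x => (B x, fderiv ℝ B x e, B x)) x‖ :=
      norm_iteratedFDeriv_clm_le (augL V) (hs.prodMk (hs'.prodMk hs)) (m + 1) x
    refine h1.trans ?_
    rw [mul_assoc]
    gcongr
    rw [iteratedFDeriv_prodMk hs.contDiffAt (hs'.prodMk hs).contDiffAt
      (by exact_mod_cast le_top), ContinuousMultilinearMap.opNorm_prod,
      iteratedFDeriv_prodMk hs'.contDiffAt hs.contDiffAt
      (by exact_mod_cast le_top), ContinuousMultilinearMap.opNorm_prod]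
    have hp : 0 ≤ 1 + ‖x‖ ^ (r - 1) := by positivity
    have e1 : C * (1 + ‖x‖ ^ (r - 1)) ≤ (|C| + |C'|) * (1 + ‖x‖ ^ (r - 1)) := by
      gcongr; linarith [le_abs_self C, abs_nonneg C']
    have e2 : C' * (1 + ‖x‖ ^ (r - 1)) ≤ (|C| + |C'|) * (1 + ‖x‖ ^ (r - 1)) := by
      gcongr; linarith [le_abs_self C', abs_nonneg C]
    exact max_le ((hC x).trans e1) (max_le ((hC' x).trans e2) ((hC x).trans e1))


theorem exists_decay_zero {r : ℕ} (hr : 1 ≤ r) {B : X → V →L[ℝ] V} (h : Adm r B) (k : ℕ) :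
    ∃ C, ∀ x, ‖x‖ ^ k * ‖NormedSpace.exp (B x)‖ ≤ C := by
  obtain ⟨c, hc, C, hd⟩ := h.diss
  refine ⟨Real.exp C * (1 + k.factorial / c ^ k), fun x => ?_⟩
  have h1 : ‖NormedSpace.exp (B x)‖ ≤ Real.exp (-(c * ‖x‖ ^ r - C)) :=
    norm_exp_le_of_inner_le _ _ fun v => by
      have := hd x v
      linarith
  set s := ‖x‖ ^ r
  have hs : 0 ≤ s := by positivity
  have h2 : ‖x‖ ^ k ≤ 1 + s ^ k := by
    rcases le_total ‖x‖ 1 with hx | hx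
    · have := pow_le_one₀ (n := k) (norm_nonneg x) hx
      have : 0 ≤ s ^ k := by positivity
      linarith
    · have : ‖x‖ ^ k ≤ s ^ k := by
        rw [← pow_mul]
        exact pow_le_pow_right₀ hx (Nat.le_mul_of_pos_left k hr)
      linarith
  have h3 : s ^ k ≤ k.factorial / c ^ k * Real.exp (c * s) := by
    have := Real.pow_div_factorial_le_exp (c * s) (by positivity) k
    rw [div_le_iff₀ (by positivity), mul_pow] at this
    rw [div_mul_eq_mul_div, le_div_iff₀ (by positivity)]
    linarith
  have h4 : (1 : ℝ) ≤ Real.exp (c * s) := Real.one_le_exp (by positivity)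
  calc ‖x‖ ^ k * ‖NormedSpace.exp (B x)‖
      ≤ (Real.exp (c * s) + k.factorial / c ^ k * Real.exp (c * s)) *
        Real.exp (-(c * s - C)) := by
        gcongr
        linarith
    _ = Real.exp C * (1 + k.factorial / c ^ k) * (Real.exp (c * s) * Real.exp (-(c * s))) := by
        rw [neg_sub, sub_eq_add_neg, Real.exp_add]; ring
    _ = _ := by rw [← Real.exp_add]; simp

end Exp

theorem exists_decay {n r : ℕ} (hr : 1 ≤ r) (m : ℕ) :
    ∀ (V : Type) [NormedAddCommGroup V] [InnerProductSpace ℝ V] [FiniteDimensional ℝ V]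
      [CompleteSpace V] (B : Vec n → V →L[ℝ] V) (_ : Adm r B) (k : ℕ),
    ∃ C, ∀ x, ‖x‖ ^ k * ‖iteratedFDeriv ℝ m (fun x => NormedSpace.exp (B x)) x‖ ≤ C := by
  induction m with
  | zero =>
    intro V _ _ _ _ B hB k
    simpa using exists_decay_zero hr hB k
  | succ m ih =>
    intro V _ _ _ _ B hB k
    let e : Fin n → Vec n := fun i => EuclideanSpace.single i 1
    let Bt : Fin n → Vec n → Dbl V →L[ℝ] Dbl V :=
      fun i x => augL V (B x, fderiv ℝ B x (e i), B x)
    have hBt : ∀ i, Adm r (Bt i) := fun i => hB.aug hr (e i)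
    choose C hC using fun i => ih (Dbl V) (Bt i) (hBt i) k
    let Λ : Fin n → (Dbl V →L[ℝ] Dbl V) →L[ℝ] (Vec n →L[ℝ] (V →L[ℝ] V)) := fun i =>
      (ContinuousLinearMap.smulRightL ℝ (Vec n) (V →L[ℝ] V)
        (EuclideanSpace.proj i : Vec n →L[ℝ] ℝ)).comp (cornerL V)
    have hG : ∀ i, ContDiff ℝ ∞ (fun x => NormedSpace.exp (Bt i x)) :=
      fun i => contDiff_exp.comp (hBt i).smooth
    have hfd : fderiv ℝ (fun x => NormedSpace.exp (B x)) =
        fun x => ∑ i, Λ i (NormedSpace.exp (Bt i x)) := by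
      funext x
      ext1 v
      have hv : v = ∑ i, v i • e i := by
        simpa using ((EuclideanSpace.basisFun (Fin n) ℝ).sum_repr v).symm
      conv_lhs => rw [hv]
      rw [map_sum, sum_apply]
      refine Finset.sum_congr rfl fun i _ => ?_
      rw [map_smul, fderiv_exp_comp B hB.smooth]
      rfl
    refine ⟨∑ i, ‖Λ i‖ * C i, fun x => ?_⟩
    rw [← norm_iteratedFDeriv_fderiv, hfd]
    have hsum := iteratedFDeriv_sum (𝕜 := ℝ) (i := m) (u := Finset.univ)
      (f := fun i x => Λ i (NormedSpace.exp (Bt i x)))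
      (fun i _ => ((Λ i).contDiff.comp (hG i)).of_le (by exact_mod_cast le_top))
    rw [hsum, Finset.sum_apply]
    calc _ ≤ ‖x‖ ^ k * ∑ i, ‖Λ i‖ * ‖iteratedFDeriv ℝ m (fun x => NormedSpace.exp (Bt i x)) x‖ := by
          gcongr
          refine (norm_sum_le _ _).trans (Finset.sum_le_sum fun i _ => ?_)
          exact norm_iteratedFDeriv_clm_le (Λ i) (hG i) m x
      _ = ∑ i, ‖Λ i‖ * (‖x‖ ^ k * ‖iteratedFDeriv ℝ m (fun x => NormedSpace.exp (Bt i x)) x‖) := by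
          rw [Finset.mul_sum]
          exact Finset.sum_congr rfl fun i _ => by ring
      _ ≤ _ := by
          gcongr with i
          exact hC i x

/-- The exponential of an admissible family as a Schwartz function. -/
def expSchwartz {n r : ℕ} (hr : 1 ≤ r) {V : Type} [NormedAddCommGroup V] [InnerProductSpace ℝ V]
    [FiniteDimensional ℝ V] [CompleteSpace V] (B : Vec n → V →L[ℝ] V) (hB : Adm r B) :
    SchwartzMap (Vec n) (V →L[ℝ] V) where
  toFun := fun x => NormedSpace.exp (B x)
  smooth' := contDiff_exp.comp hB.smooth
  decay' := fun k m => exists_decay hr m V B hB k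

/-- Smooth homogeneous functions satisfy the growth bounds of the class `Adm`. -/
theorem growth_of_homogeneous {n r : ℕ} (hr : 1 ≤ r) {E : Type*} [NormedAddCommGroup E]
    [NormedSpace ℝ E] (B : Vec n → E) (hs : ContDiff ℝ ∞ B)
    (hh : ∀ (t : ℝ) x, B (t • x) = t ^ r • B x) (m : ℕ) :
    ∃ C, ∀ x, ‖iteratedFDeriv ℝ (m + 1) B x‖ ≤ C * (1 + ‖x‖ ^ (r - 1)) := by
  have hcont : Continuous fun x => ‖iteratedFDeriv ℝ (m + 1) B x‖ :=
    (hs.continuous_iteratedFDeriv (by exact_mod_cast le_top)).norm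
  obtain ⟨C, hC⟩ := (isCompact_closedBall (0 : Vec n) 1).exists_bound_of_continuousOn
    hcont.continuousOn
  simp only [Real.norm_eq_abs, abs_norm, mem_closedBall_zero_iff] at hC
  have hC0 : 0 ≤ C := (norm_nonneg _).trans (hC 0 (by simp))
  refine ⟨C, fun x => ?_⟩
  rcases le_total ‖x‖ 1 with hx | hx
  · refine (hC x hx).trans ?_
    have : 0 ≤ C * ‖x‖ ^ (r - 1) := by positivity
    linarith
  · set t := ‖x‖
    have ht : 0 < t := by linarith
    have hscale : ∀ y, t ^ (m + 1) • iteratedFDeriv ℝ (m + 1) B (t • y) =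
        t ^ r • iteratedFDeriv ℝ (m + 1) B y := by
      intro y
      have h1 : iteratedFDeriv ℝ (m + 1) (B ∘ (t • ContinuousLinearMap.id ℝ (Vec n))) y =
          t ^ (m + 1) • iteratedFDeriv ℝ (m + 1) B (t • y) := by
        rw [ContinuousLinearMap.iteratedFDeriv_comp_right _ (hs.of_le le_rfl) _
          (by exact_mod_cast le_top)]
        ext v
        simp only [ContinuousMultilinearMap.compContinuousLinearMap_apply,
          smul_apply,
          ContinuousLinearMap.id_apply]
        rw [ContinuousMultilinearMap.map_smul_univ]
        simp
      rw [← h1]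
      have h2 : (B ∘ (t • ContinuousLinearMap.id ℝ (Vec n))) = t ^ r • B := by
        funext z; simp [hh]
      rw [h2, iteratedFDeriv_const_smul_apply]
      exact hs.contDiffAt.of_le (by exact_mod_cast le_top)
    have h3 := hscale (t⁻¹ • x)
    rw [smul_inv_smul₀ ht.ne'] at h3
    have h4 := congrArg norm h3
    rw [norm_smul, norm_smul, Real.norm_of_nonneg (by positivity),
      Real.norm_of_nonneg (by positivity)] at h4
    have h5 : ‖iteratedFDeriv ℝ (m + 1) B (t⁻¹ • x)‖ ≤ C := hC _ (by
      rw [norm_smul, norm_inv, norm_norm, inv_mul_cancel₀ ht.ne'])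
    have h6 : t ^ r = t ^ (r - 1) * t := by
      rw [← pow_succ]; congr 1; omega
    have h7 : t ≤ t ^ (m + 1) := le_self_pow₀ hx (by omega)
    have h8 : t * ‖iteratedFDeriv ℝ (m + 1) B x‖ ≤ t * (C * t ^ (r - 1)) := by
      calc _ ≤ t ^ (m + 1) * ‖iteratedFDeriv ℝ (m + 1) B x‖ := by gcongr
        _ = t ^ r * ‖iteratedFDeriv ℝ (m + 1) B (t⁻¹ • x)‖ := h4
        _ ≤ t ^ r * C := by gcongr
        _ = _ := by rw [h6]; ring
    have h9 := le_of_mul_le_mul_left h8 ht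
    linarith

section Fourier
variable {n : ℕ}

/-- The standard basis vectors. -/
abbrev ee (i : Fin n) : Vec n := EuclideanSpace.single i 1

variable {W : Type} [NormedAddCommGroup W] [NormedSpace ℝ W]
variable {W' : Type} [NormedAddCommGroup W'] [NormedSpace ℝ W']

theorem lineDerivOp_postcomp (L : W →L[ℝ] W') (f : 𝓢(Vec n, W)) (m : Vec n) :
    ∂_{m} (f.postcompCLM L) = (∂_{m} f).postcompCLM L := by
  ext x
  rw [SchwartzMap.postcompCLM_apply, SchwartzMap.lineDerivOp_apply_eq_fderiv,
    SchwartzMap.lineDerivOp_apply_eq_fderiv]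
  have := (L.hasFDerivAt.comp x (f.hasFDerivAt x)).fderiv
  change fderiv ℝ (L ∘ f) x m = _
  rw [this]; rfl

theorem iteratedLineDerivOp_postcomp (L : W →L[ℝ] W') (f : 𝓢(Vec n, W)) {k : ℕ}
    (m : Fin k → Vec n) :
    ∂^{m} (f.postcompCLM L) = (∂^{m} f).postcompCLM L := by
  induction k with
  | zero => rfl
  | succ k ih =>
    rw [LineDeriv.iteratedLineDerivOp_succ_left, LineDeriv.iteratedLineDerivOp_succ_left, ih,
      lineDerivOp_postcomp]

theorem hasTemperateGrowth_coord (i : Fin n) : (fun x : Vec n => x i).HasTemperateGrowth :=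
  (EuclideanSpace.proj i : Vec n →L[ℝ] ℝ).hasTemperateGrowth

/-- Multiplication by a coordinate. -/
def mulC (W : Type) [NormedAddCommGroup W] [NormedSpace ℝ W] (i : Fin n) :
    𝓢(Vec n, W) →L[ℝ] 𝓢(Vec n, W) := SchwartzMap.smulLeftCLM W (fun x : Vec n => x i)

theorem mulC_apply (i : Fin n) (f : 𝓢(Vec n, W)) (x : Vec n) : mulC W i f x = x i • f x :=
  SchwartzMap.smulLeftCLM_apply_apply (hasTemperateGrowth_coord i) f x

/-- Multiplication by a monomial. -/
def mulM (W : Type) [NormedAddCommGroup W] [NormedSpace ℝ W] :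
    (k : ℕ) → (Fin k → Fin n) → 𝓢(Vec n, W) → 𝓢(Vec n, W)
  | 0, _, f => f
  | k + 1, I, f => mulC W (I 0) (mulM W k (Fin.tail I) f)

theorem mulM_apply {k : ℕ} (I : Fin k → Fin n) (f : 𝓢(Vec n, W)) (x : Vec n) :
    mulM W k I f x = (∏ j, x (I j)) • f x := by
  induction k with
  | zero => simp [mulM]
  | succ k ih =>
    rw [mulM, mulC_apply, ih, Fin.prod_univ_succ, smul_smul]
    rfl

theorem lineDerivOp_fourierInv (f : 𝓢(Vec n, ℂ)) (i : Fin n) :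
    ∂_{ee i} (𝓕⁻ f) = 𝓕⁻ ((2 * Real.pi * Complex.I) • mulC ℂ i f) := by
  rw [SchwartzMap.lineDerivOp_fourierInv_eq]
  have : (fun x : Vec n => inner ℝ x (ee i)) = fun x => x i := by
    funext x
    simp [EuclideanSpace.inner_single_right]
  rw [this]
  rfl

theorem fourierInv_lineDerivOp (f : 𝓢(Vec n, ℂ)) (i : Fin n) :
    𝓕⁻ (∂_{ee i} f) = -(2 * Real.pi * Complex.I) • mulC ℂ i (𝓕⁻ f) := by
  rw [SchwartzMap.fourierInv_lineDerivOp_eq]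
  have : (fun x : Vec n => inner ℝ x (ee i)) = fun x => x i := by
    funext x
    simp [EuclideanSpace.inner_single_right]
  rw [this]
  rfl

theorem iteratedLineDerivOp_fourierInv {k : ℕ} (I : Fin k → Fin n) (f : 𝓢(Vec n, ℂ)) :
    ∂^{fun j => ee (I j)} (𝓕⁻ f) = 𝓕⁻ ((2 * Real.pi * Complex.I) ^ k • mulM ℂ k I f) := by
  induction k with
  | zero => simp [mulM, LineDeriv.iteratedLineDerivOp_fin_zero]
  | succ k ih =>
    rw [LineDeriv.iteratedLineDerivOp_succ_left]
    have := ih (Fin.tail I)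
    change ∂_{ee (I 0)} (∂^{fun j => ee (Fin.tail I j)} (𝓕⁻ f)) = _
    rw [this, lineDerivOp_fourierInv]
    congr 1
    ext x
    simp only [smul_apply, mulC_apply, mulM, pow_succ]
    simp
    ring

theorem coord_mul_lineDerivOp_fourierInv (f : 𝓢(Vec n, ℂ)) (i : Fin n) :
    mulC ℂ i (∂_{ee i} (𝓕⁻ f)) = - 𝓕⁻ (mulC ℂ i (∂_{ee i} f)) - 𝓕⁻ f := by
  have h1 := fourierInv_lineDerivOp f i
  have hc : (2 * Real.pi * Complex.I : ℂ) ≠ 0 := by simp [Real.pi_ne_zero]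
  have h2 := lineDerivOp_fourierInv (∂_{ee i} f) i
  rw [h1] at h2
  ext x
  have h3 : (∂_{ee i} (mulC ℂ i (𝓕⁻ f))) x = 𝓕⁻ f x + x i • (∂_{ee i} (𝓕⁻ f)) x := by
    rw [SchwartzMap.lineDerivOp_apply_eq_fderiv, SchwartzMap.lineDerivOp_apply_eq_fderiv]
    have e1 : (mulC ℂ i (𝓕⁻ f) : Vec n → ℂ) = fun x => x i • (𝓕⁻ f : 𝓢(Vec n, ℂ)) x := by
      funext x; exact mulC_apply i _ x
    have e2 : HasFDerivAt (fun x : Vec n => x i) (EuclideanSpace.proj i : Vec n →L[ℝ] ℝ) x :=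
      (EuclideanSpace.proj i : Vec n →L[ℝ] ℝ).hasFDerivAt
    rw [e1, (e2.fun_smul ((𝓕⁻ f : 𝓢(Vec n, ℂ)).hasFDerivAt x)).fderiv]
    simp
    ring
  have h4 : (∂_{ee i} (mulC ℂ i (𝓕⁻ f))) x = - 𝓕⁻ (mulC ℂ i (∂_{ee i} f)) x := by
    have h5 : ∂_{ee i} (-(2 * Real.pi * Complex.I : ℂ) • mulC ℂ i (𝓕⁻ f)) =
        -(2 * Real.pi * Complex.I : ℂ) • ∂_{ee i} (mulC ℂ i (𝓕⁻ f)) :=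
      LineDeriv.lineDerivOp_smul _ _ _
    have h6 : 𝓕⁻ ((2 * Real.pi * Complex.I : ℂ) • mulC ℂ i (∂_{ee i} f)) =
        (2 * Real.pi * Complex.I : ℂ) • 𝓕⁻ (mulC ℂ i (∂_{ee i} f)) :=
      FourierTransform.fourierInv_smul _ _
    rw [h5, h6] at h2
    have h7 := congrArg (fun g : 𝓢(Vec n, ℂ) => g x) h2
    simp only [smul_apply, smul_eq_mul] at h7
    have : (2 * Real.pi * Complex.I : ℂ) * ((∂_{ee i} (mulC ℂ i (𝓕⁻ f))) x +
      𝓕⁻ (mulC ℂ i (∂_{ee i} f)) x) = 0 := by linear_combination -h7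
    rcases mul_eq_zero.1 this with h | h
    · exact absurd h hc
    · exact eq_neg_of_add_eq_zero_left h
  simp only [sub_apply, neg_apply, mulC_apply]
  rw [← h4, h3]
  ring


variable [FiniteDimensional ℝ W] [FiniteDimensional ℝ W']

/-- A coordinate of a vector, as a complex number. -/
def coordC (W : Type) [NormedAddCommGroup W] [NormedSpace ℝ W] [FiniteDimensional ℝ W]
    (i : Fin (Module.finrank ℝ W)) : W →L[ℝ] ℂ :=
  Complex.ofRealCLM.comp ((Module.finBasis ℝ W).coord i).toContinuousLinearMap

/-- The real part of a complex number times a basis vector. -/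
def reSmul (W : Type) [NormedAddCommGroup W] [NormedSpace ℝ W] [FiniteDimensional ℝ W]
    (i : Fin (Module.finrank ℝ W)) : ℂ →L[ℝ] W :=
  Complex.reCLM.smulRight (Module.finBasis ℝ W i)

theorem sum_reSmul_coordC (w : W) : ∑ i, reSmul W i (coordC W i w) = w := by
  simp [reSmul, coordC]

/-- The real inverse Fourier transform of a vector-valued Schwartz function. -/
def reFI (f : 𝓢(Vec n, W)) : 𝓢(Vec n, W) :=
  ∑ i, SchwartzMap.postcompCLM (reSmul W i) (𝓕⁻ (SchwartzMap.postcompCLM (coordC W i) f))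

theorem reFI_apply (f : 𝓢(Vec n, W)) (x : Vec n) :
    reFI f x = ∑ i, reSmul W i (𝓕⁻ (SchwartzMap.postcompCLM (coordC W i) f) x) := by
  simp [reFI, SchwartzMap.postcompCLM_apply, sum_apply]

theorem reFI_add (f g : 𝓢(Vec n, W)) : reFI (f + g) = reFI f + reFI g := by
  simp only [reFI, map_add, FourierTransform.fourierInv_add, Finset.sum_add_distrib]

theorem fourierInv_smul_real (c : ℝ) (f : 𝓢(Vec n, ℂ)) : 𝓕⁻ (c • f) = c • 𝓕⁻ f :=
  FourierTransform.fourierInv_smul c f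

theorem reFI_smul (c : ℝ) (f : 𝓢(Vec n, W)) : reFI (c • f) = c • reFI f := by
  simp only [reFI, map_smul, fourierInv_smul_real, Finset.smul_sum]

/-- `reFI` as a linear map. -/
def reFIL : 𝓢(Vec n, W) →ₗ[ℝ] 𝓢(Vec n, W) where
  toFun := reFI
  map_add' := reFI_add
  map_smul' := reFI_smul

theorem reFI_postcomp (Λ : W →L[ℝ] W) (f : 𝓢(Vec n, W)) :
    reFI (f.postcompCLM Λ) = (reFI f).postcompCLM Λ := by
  set b := Module.finBasis ℝ W
  have h1 : ∀ j, (f.postcompCLM Λ).postcompCLM (coordC W j) =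
      ∑ i, (b.coord j (Λ (b i))) • f.postcompCLM (coordC W i) := by
    intro j
    ext x
    simp only [SchwartzMap.postcompCLM_apply, sum_apply, smul_apply]
    conv_lhs => rw [← b.sum_repr (f x)]
    simp only [map_sum, map_smul, coordC, ContinuousLinearMap.comp_apply,
      LinearMap.coe_toContinuousLinearMap', Complex.ofRealCLM_apply, Complex.real_smul]
    refine Finset.sum_congr rfl fun i _ => ?_
    simp [b, mul_comm]
  ext x
  rw [SchwartzMap.postcompCLM_apply, reFI_apply, reFI_apply, map_sum]
  have h2 : ∀ j, 𝓕⁻ ((f.postcompCLM Λ).postcompCLM (coordC W j)) x =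
      ∑ i, (b.coord j (Λ (b i))) • 𝓕⁻ (f.postcompCLM (coordC W i)) x := by
    intro j
    rw [h1]
    have := map_sum (FourierTransform.fourierInvCLM ℝ 𝓢(Vec n, ℂ))
      (fun i => (b.coord j (Λ (b i))) • f.postcompCLM (coordC W i)) Finset.univ
    simp only [FourierTransform.fourierInvCLM_apply, fourierInv_smul_real] at this
    rw [this, sum_apply]
    rfl
  simp only [h2, map_sum]
  rw [Finset.sum_comm]
  refine Finset.sum_congr rfl fun i _ => ?_
  simp only [reSmul, ContinuousLinearMap.smulRight_apply, map_smul, Complex.reCLM_apply]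
  conv_rhs => rw [← b.sum_repr (Λ (b i)), Finset.smul_sum]
  refine Finset.sum_congr rfl fun j _ => ?_
  rw [smul_smul, smul_smul, mul_comm]
  rfl

theorem integral_reFI (f : 𝓢(Vec n, W)) : ∫ x, reFI f x = f 0 := by
  have h1 : ∀ g : 𝓢(Vec n, ℂ), ∫ x, 𝓕⁻ g x = g 0 := by
    intro g
    have h2 : 𝓕 (𝓕⁻ g) = g := FourierTransform.fourier_fourierInv_eq g
    have h3 := congrArg (fun h : 𝓢(Vec n, ℂ) => h 0) h2
    simp only [SchwartzMap.fourier_coe] at h3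
    rw [← h3, Real.fourier_eq]
    simp
  simp only [reFI_apply]
  rw [integral_finsetSum _ fun i _ => ?_]
  · rw [← sum_reSmul_coordC (f 0)]
    refine Finset.sum_congr rfl fun i _ => ?_
    rw [ContinuousLinearMap.integral_comp_comm _ (SchwartzMap.integrable _), h1,
      SchwartzMap.postcompCLM_apply]
  · exact (reSmul W i).integrable_comp (SchwartzMap.integrable _)

theorem mulC_postcomp (L : W →L[ℝ] W') (f : 𝓢(Vec n, W)) (i : Fin n) :
    mulC W' i (f.postcompCLM L) = (mulC W i f).postcompCLM L := by
  ext x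
  simp [mulC_apply, SchwartzMap.postcompCLM_apply]

theorem mulM_postcomp (L : W →L[ℝ] W') (f : 𝓢(Vec n, W)) {k : ℕ} (I : Fin k → Fin n) :
    mulM W' k I (f.postcompCLM L) = (mulM W k I f).postcompCLM L := by
  ext x
  simp [mulM_apply, SchwartzMap.postcompCLM_apply]

theorem iteratedLineDerivOp_reFI {r : ℕ} (hr : Even r) (I : Fin r → Fin n) (f : 𝓢(Vec n, W)) :
    ∂^{fun j => ee (I j)} (reFI f) =
      reFI (((2 * Real.pi) ^ r * (-1) ^ (r / 2)) • mulM W r I f) := by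
  have hc : (2 * Real.pi * Complex.I : ℂ) ^ r = (((2 * Real.pi) ^ r * (-1) ^ (r / 2) : ℝ) : ℂ) := by
    obtain ⟨p, rfl⟩ := hr
    rw [mul_pow, ← two_mul, pow_mul Complex.I, Complex.I_sq, Nat.mul_div_cancel_left _ two_pos]
    push_cast
    ring
  simp only [reFI]
  rw [LineDeriv.iteratedLineDerivOp_sum]
  refine Finset.sum_congr rfl fun i _ => ?_
  rw [iteratedLineDerivOp_postcomp, iteratedLineDerivOp_fourierInv, mulM_postcomp, hc, map_smul]
  rfl

theorem sum_coord_lineDerivOp_reFI (f : 𝓢(Vec n, W)) :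
    ∑ j, mulC W j (∂_{ee j} (reFI f)) =
      - reFI (∑ j, mulC W j (∂_{ee j} f)) - (n : ℝ) • reFI f := by
  have h : ∀ j, mulC W j (∂_{ee j} (reFI f)) = - reFI (mulC W j (∂_{ee j} f)) - reFI f := by
    intro j
    simp only [reFI]
    rw [LineDeriv.lineDerivOp_sum, map_sum, ← Finset.sum_neg_distrib, ← Finset.sum_sub_distrib]
    refine Finset.sum_congr rfl fun i _ => ?_
    rw [lineDerivOp_postcomp, mulC_postcomp, coord_mul_lineDerivOp_fourierInv,
      lineDerivOp_postcomp, mulC_postcomp, map_sub, map_neg]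
  simp only [h]
  rw [Finset.sum_sub_distrib, Finset.sum_neg_distrib]
  have := map_sum (reFIL (W := W)) (fun j : Fin n => mulC W j (∂_{ee j} f)) Finset.univ
  change reFI _ = ∑ j, reFI _ at this
  rw [this]
  congr 1
  simp [← Nat.cast_smul_eq_nsmul ℝ]

end Fourier

section Kernel
variable {n l r : ℕ}

/-- The Legendre–Hadamard condition for constant leading coefficients. -/
def EllC (r : ℕ) (A : (Fin r → Fin n) → Vec l →L[ℝ] Vec l) : Prop :=
  ∃ c > 0, ∀ (ξ : Vec n) (v : Vec l), c * ‖ξ‖ ^ r * ‖v‖ ^ 2 ≤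
    (-1 : ℝ) ^ (r / 2 - 1) * ∑ I, (∏ j, ξ (I j)) * inner ℝ (A I v) v

/-- The symbol of a constant-coefficient homogeneous operator. -/
def symb (r : ℕ) (A : (Fin r → Fin n) → Vec l →L[ℝ] Vec l) (ξ : Vec n) : Vec l →L[ℝ] Vec l :=
  ∑ I, ((2 * Real.pi) ^ r * (-1) ^ (r / 2) * ∏ j, ξ (I j)) • A I

theorem symb_smul (A : (Fin r → Fin n) → Vec l →L[ℝ] Vec l) (t : ℝ) (ξ : Vec n) :
    symb r A (t • ξ) = t ^ r • symb r A ξ := by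
  simp only [symb, Finset.smul_sum, smul_smul]
  refine Finset.sum_congr rfl fun I _ => ?_
  congr 1
  simp [Finset.prod_mul_distrib]
  ring

theorem contDiff_symb (A : (Fin r → Fin n) → Vec l →L[ℝ] Vec l) : ContDiff ℝ ∞ (symb r A) := by
  unfold symb
  refine ContDiff.sum fun I _ => ContDiff.fun_smul (contDiff_const.mul ?_) contDiff_const
  exact contDiff_prod fun j _ => (EuclideanSpace.proj (I j) : Vec n →L[ℝ] ℝ).contDiff

theorem adm_symb (hr : 2 ≤ r) (A : (Fin r → Fin n) → Vec l →L[ℝ] Vec l) (hA : EllC r A) :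
    Adm r (symb r A) := by
  refine ⟨contDiff_symb A, ?_, growth_of_homogeneous (by omega) _ (contDiff_symb A) (symb_smul A)⟩
  obtain ⟨c, hc, h⟩ := hA
  refine ⟨(2 * Real.pi) ^ r * c, by positivity, 0, fun ξ v => ?_⟩
  have h1 := h ξ v
  have h2 : (-1 : ℝ) ^ (r / 2) = - (-1) ^ (r / 2 - 1) := by
    obtain ⟨p, hp⟩ : ∃ p, r / 2 = p + 1 := ⟨r / 2 - 1, by omega⟩
    rw [hp, pow_succ]; simp
  have h3 : inner ℝ (symb r A ξ v) v = -(2 * Real.pi) ^ r *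
      ((-1 : ℝ) ^ (r / 2 - 1) * ∑ I, (∏ j, ξ (I j)) * inner ℝ (A I v) v) := by
    simp only [symb, sum_apply, smul_apply, sum_inner, real_inner_smul_left, h2, Finset.mul_sum]
    exact Finset.sum_congr rfl fun I _ => by ring
  rw [h3]
  have h4 : 0 < (2 * Real.pi) ^ r := by positivity
  nlinarith

theorem euler_exp_symb (A : (Fin r → Fin n) → Vec l →L[ℝ] Vec l) (ξ : Vec n) :
    fderiv ℝ (fun ξ => NormedSpace.exp (symb r A ξ)) ξ ξ =
      (r : ℝ) • (symb r A ξ * NormedSpace.exp (symb r A ξ)) ∧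
    fderiv ℝ (fun ξ => NormedSpace.exp (symb r A ξ)) ξ ξ =
      (r : ℝ) • (NormedSpace.exp (symb r A ξ) * symb r A ξ) := by
  have hd : Differentiable ℝ (fun ξ => NormedSpace.exp (symb r A ξ)) :=
    (contDiff_exp.comp (contDiff_symb A)).differentiable (by simp)
  have h0 : HasDerivAt (fun t : ℝ => t • ξ) ξ 1 := by
    simpa using (hasDerivAt_id (1 : ℝ)).smul_const ξ
  have h1 : HasDerivAt (fun t : ℝ => NormedSpace.exp (symb r A (t • ξ)))
      (fderiv ℝ (fun ξ => NormedSpace.exp (symb r A ξ)) ξ ξ) 1 := by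
    have := (hd ((1 : ℝ) • ξ)).hasFDerivAt.comp_hasDerivAt 1 h0
    rw [one_smul] at this
    exact this
  have hp : HasDerivAt (fun t : ℝ => t ^ r) (r : ℝ) 1 := by
    simpa using hasDerivAt_pow r (1 : ℝ)
  simp only [symb_smul] at h1
  constructor
  · have := HasDerivAt.scomp (h := fun t : ℝ => t ^ r) (1 : ℝ)
      (hasDerivAt_exp_smul_const' (𝕂 := ℝ) (symb r A ξ) (1 ^ r)) hp
    rw [h1.unique this, one_pow, one_smul]
  · have := HasDerivAt.scomp (h := fun t : ℝ => t ^ r) (1 : ℝ)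
      (hasDerivAt_exp_smul_const (𝕂 := ℝ) (symb r A ξ) (1 ^ r)) hp
    rw [h1.unique this, one_pow, one_smul]

/-- The self-similar profile of the fundamental solution. -/
structure IsKer (r : ℕ) (A : (Fin r → Fin n) → Vec l →L[ℝ] Vec l)
    (K : 𝓢(Vec n, Vec l →L[ℝ] Vec l)) : Prop where
  integral_eq : ∫ y, K y = 1
  left : ∀ y, ∑ I, (A I).comp ((∂^{fun j => ee (I j)} K) y) =
    -(r : ℝ)⁻¹ • ((n : ℝ) • K y + ∑ j, y j • (∂_{ee j} K) y)
  right : ∀ y, ∑ I, ((∂^{fun j => ee (I j)} K) y).comp (A I) =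
    -(r : ℝ)⁻¹ • ((n : ℝ) • K y + ∑ j, y j • (∂_{ee j} K) y)

theorem exists_isKer (hr : 2 ≤ r) (hrev : Even r) (A : (Fin r → Fin n) → Vec l →L[ℝ] Vec l)
    (hA : EllC r A) : ∃ K, IsKer r A K := by
  have hr1 : 1 ≤ r := by omega
  let E := expSchwartz hr1 (symb r A) (adm_symb hr A hA)
  have hE : ∀ ξ, E ξ = NormedSpace.exp (symb r A ξ) := fun ξ => rfl
  have hr0 : (r : ℝ) ≠ 0 := by positivity
  let c : ℝ := (2 * Real.pi) ^ r * (-1) ^ (r / 2)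
  have hsum : ∀ ξ, (∑ j, mulC _ j (∂_{ee j} E)) ξ =
      fderiv ℝ (fun ξ => NormedSpace.exp (symb r A ξ)) ξ ξ := by
    intro ξ
    have hξ : ξ = ∑ i, ξ i • (ee i : Vec n) := by
      simpa using ((EuclideanSpace.basisFun (Fin n) ℝ).sum_repr ξ).symm
    have h := congrArg (fderiv ℝ (fun ξ => NormedSpace.exp (symb r A ξ)) ξ) hξ
    rw [h, map_sum, sum_apply]
    refine Finset.sum_congr rfl fun j _ => ?_
    rw [mulC_apply, SchwartzMap.lineDerivOp_apply_eq_fderiv, map_smul]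
    rfl
  have hgen : ∀ Λ : (Fin r → Fin n) → (Vec l →L[ℝ] Vec l) →L[ℝ] (Vec l →L[ℝ] Vec l),
      (∀ ξ, (r : ℝ) • ∑ I, Λ I ((c * ∏ j, ξ (I j)) • E ξ) =
        fderiv ℝ (fun ξ => NormedSpace.exp (symb r A ξ)) ξ ξ) →
      ∀ y, ∑ I, Λ I ((∂^{fun j => ee (I j)} (reFI E)) y) =
        -(r : ℝ)⁻¹ • ((n : ℝ) • reFI E y + ∑ j, y j • (∂_{ee j} (reFI E)) y) := by
    intro Λ hΛ y
    have h1 : ∑ I, (∂^{fun j => ee (I j)} (reFI E)).postcompCLM (Λ I) =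
        (r : ℝ)⁻¹ • reFI (∑ j, mulC _ j (∂_{ee j} E)) := by
      rw [← reFI_smul]
      have h2 : ∀ I, (∂^{fun j => ee (I j)} (reFI E)).postcompCLM (Λ I) =
          reFIL ((c • mulM _ r I E).postcompCLM (Λ I)) := by
        intro I
        rw [iteratedLineDerivOp_reFI hrev, ← reFI_postcomp]
        rfl
      rw [Finset.sum_congr rfl fun I _ => h2 I, ← map_sum]
      change reFI _ = reFI _
      congr 1
      ext1 ξ
      rw [smul_apply, hsum, ← hΛ ξ, inv_smul_smul₀ hr0, sum_apply]
      refine Finset.sum_congr rfl fun I _ => ?_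
      rw [SchwartzMap.postcompCLM_apply, smul_apply, mulM_apply, smul_smul]
    have h3 := sum_coord_lineDerivOp_reFI E
    have h4 := congrArg (fun g : 𝓢(Vec n, Vec l →L[ℝ] Vec l) => g y) h1
    have h5 := congrArg (fun g : 𝓢(Vec n, Vec l →L[ℝ] Vec l) => g y) h3
    simp only [sum_apply, SchwartzMap.postcompCLM_apply, smul_apply, mulC_apply, sub_apply,
      neg_apply] at h4 h5
    rw [h4, h5]
    simp
  refine ⟨reFI E, ?_, ?_, ?_⟩
  · rw [integral_reFI, hE]
    have : symb r A 0 = 0 := by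
      have := symb_smul A 0 (0 : Vec n)
      rwa [zero_smul, zero_pow (by omega), zero_smul] at this
    rw [this, NormedSpace.exp_zero]
  · refine hgen (fun I => ContinuousLinearMap.compL ℝ _ _ _ (A I)) fun ξ => ?_
    rw [(euler_exp_symb A ξ).1, hE]
    congr 1
    simp only [symb, Finset.sum_mul, smul_mul_assoc, c]
    refine Finset.sum_congr rfl fun I _ => ?_
    rw [map_smul]; rfl
  · refine hgen (fun I => (ContinuousLinearMap.compL ℝ _ _ _).flip (A I)) fun ξ => ?_
    rw [(euler_exp_symb A ξ).2, hE]
    congr 1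
    conv_rhs => rw [symb]
    simp only [Finset.mul_sum, mul_smul_comm, c]
    refine Finset.sum_congr rfl fun I _ => ?_
    rw [map_smul]; rfl

end Kernel

/-- Matrices, as endomorphisms of `Vec l`. -/
abbrev Mat (l : ℕ) := Vec l →L[ℝ] Vec l

section Conv
variable {n l : ℕ}

/-- The rescaled convolution operator `g ↦ ∫ Φ(y) g(x - ρ y) dy`. -/
def conv (Φ : 𝓢(Vec n, Mat l)) (ρ : ℝ) (g : Vec n → Vec l) (x : Vec n) : Vec l :=
  ∫ y, Φ y (g (x - ρ • y))

/-- Weighted `L¹` norms. -/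
def mom (m : ℕ) (Φ : 𝓢(Vec n, Mat l)) : ℝ := ∫ y, (1 + ‖y‖) ^ m * ‖Φ y‖

theorem integrable_mom (m : ℕ) (Φ : 𝓢(Vec n, Mat l)) :
    Integrable (fun y => (1 + ‖y‖) ^ m * ‖Φ y‖) := by
  have : (fun y => (1 + ‖y‖) ^ m * ‖Φ y‖) = fun y =>
      ∑ i ∈ Finset.range (m + 1), (m.choose i : ℝ) * (‖y‖ ^ i * ‖Φ y‖) := by
    funext y
    rw [add_comm, add_pow, Finset.sum_mul]
    refine Finset.sum_congr rfl fun i _ => ?_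
    rw [one_pow]; ring
  rw [this]
  exact integrable_finsetSum _ fun i _ => (SchwartzMap.integrable_pow_mul volume Φ i).const_mul _

theorem mom_nonneg (m : ℕ) (Φ : 𝓢(Vec n, Mat l)) : 0 ≤ mom m Φ :=
  integral_nonneg fun y => by positivity

theorem norm_integral_le_mom {m : ℕ} {Φ : 𝓢(Vec n, Mat l)} {F : Vec n → Vec l} {N : ℝ}
    (h : ∀ y, ‖F y‖ ≤ N * ((1 + ‖y‖) ^ m * ‖Φ y‖)) : ‖∫ y, F y‖ ≤ mom m Φ * N := by
  refine (norm_integral_le_of_norm_le ((integrable_mom m Φ).const_mul N)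
    (Eventually.of_forall h)).trans (le_of_eq ?_)
  rw [integral_const_mul, mul_comm]; rfl

variable {Φ : 𝓢(Vec n, Mat l)} {ρ : ℝ} {g : Vec n → Vec l} {x : Vec n} {N H α : ℝ}

theorem integrable_conv (Φ : 𝓢(Vec n, Mat l)) (ρ : ℝ) (hg : Continuous g) (hN : ∀ z, ‖g z‖ ≤ N)
    (x : Vec n) : Integrable (fun y => Φ y (g (x - ρ • y))) := by
  refine Integrable.mono' ((integrable_mom 0 Φ).const_mul N) ?_ (Eventually.of_forall fun y => ?_)
  · exact (Φ.continuous.clm_apply (hg.comp (by fun_prop))).aestronglyMeasurable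
  · refine ((Φ y).le_opNorm _).trans ?_
    rw [pow_zero, one_mul, mul_comm]
    gcongr
    exact hN _

theorem norm_conv_le (hN : ∀ z, ‖g z‖ ≤ N) : ‖conv Φ ρ g x‖ ≤ mom 0 Φ * N := by
  refine norm_integral_le_mom fun y => ((Φ y).le_opNorm _).trans ?_
  rw [pow_zero, one_mul, mul_comm]
  gcongr
  exact hN _

theorem conv_sub_integral (hg : Continuous g) (hN : ∀ z, ‖g z‖ ≤ N) :
    conv Φ ρ g x - (∫ y, Φ y) (g x) = ∫ y, Φ y (g (x - ρ • y) - g x) := by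
  rw [ContinuousLinearMap.integral_apply Φ.integrable, conv, ← integral_sub]
  · simp
  · exact integrable_conv Φ ρ hg hN x
  · exact (ContinuousLinearMap.apply ℝ (Vec l) (g x)).integrable_comp Φ.integrable

theorem rpow_le_one_add {α q : ℝ} (hα1 : α ≤ 1) (hα0 : 0 ≤ α) (hq : 0 ≤ q) : q ^ α ≤ 1 + q := by
  rcases le_total q 1 with h | h
  · exact (Real.rpow_le_one hq h hα0).trans (by linarith)
  · calc q ^ α ≤ q ^ (1 : ℝ) := Real.rpow_le_rpow_of_exponent_le h hα1
      _ = q := Real.rpow_one q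
      _ ≤ 1 + q := by linarith

theorem norm_conv_sub_le (hg : Continuous g) (hN : ∀ z, ‖g z‖ ≤ N) (hα0 : 0 ≤ α) (hα1 : α ≤ 1)
    (hH : ∀ y z, ‖g y - g z‖ ≤ H * ‖y - z‖ ^ α) (hρ : 0 ≤ ρ) (hH0 : 0 ≤ H) :
    ‖conv Φ ρ g x - (∫ y, Φ y) (g x)‖ ≤ mom 1 Φ * (H * ρ ^ α) := by
  rw [conv_sub_integral hg hN]
  refine norm_integral_le_mom fun y => ((Φ y).le_opNorm _).trans ?_
  have h1 := hH (x - ρ • y) x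
  have h2 : ‖x - ρ • y - x‖ = ρ * ‖y‖ := by
    rw [sub_sub_cancel_left, norm_neg, norm_smul, Real.norm_of_nonneg hρ]
  rw [h2, Real.mul_rpow hρ (norm_nonneg y)] at h1
  have h3 := rpow_le_one_add hα1 hα0 (norm_nonneg y)
  have h4 : ‖g (x - ρ • y) - g x‖ ≤ H * ρ ^ α * (1 + ‖y‖) := by
    refine h1.trans ?_
    rw [← mul_assoc]
    have : 0 ≤ ρ ^ α := Real.rpow_nonneg hρ α
    gcongr
  calc ‖Φ y‖ * ‖g (x - ρ • y) - g x‖ ≤ ‖Φ y‖ * (H * ρ ^ α * (1 + ‖y‖)) := by gcongr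
    _ = _ := by ring

theorem norm_conv_le_of_integral_eq_zero (hΦ : ∫ y, Φ y = 0) (hg : Continuous g)
    (hN : ∀ z, ‖g z‖ ≤ N) (hα0 : 0 ≤ α) (hα1 : α ≤ 1)
    (hH : ∀ y z, ‖g y - g z‖ ≤ H * ‖y - z‖ ^ α) (hρ : 0 ≤ ρ) (hH0 : 0 ≤ H) :
    ‖conv Φ ρ g x‖ ≤ mom 1 Φ * (H * ρ ^ α) := by
  have := norm_conv_sub_le (Φ := Φ) (x := x) hg hN hα0 hα1 hH hρ hH0
  simpa [hΦ] using this

theorem norm_conv_le_of_eq_zero_on_ball {R : ℝ} (m : ℕ) (hR : 0 < R) (hN : ∀ z, ‖g z‖ ≤ N)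
    (h0 : ∀ z, ‖z - x‖ < R → g z = 0) (hρ : 0 ≤ ρ) :
    ‖conv Φ ρ g x‖ ≤ mom m Φ * (N * (ρ / R) ^ m) := by
  have hN0 : 0 ≤ N := (norm_nonneg _).trans (hN 0)
  refine norm_integral_le_mom fun y => ((Φ y).le_opNorm _).trans ?_
  by_cases hy : ρ * ‖y‖ < R
  · rw [h0 _ (by rwa [sub_sub_cancel_left, norm_neg, norm_smul, Real.norm_of_nonneg hρ])]
    simp only [norm_zero, mul_zero]
    positivity
  · push Not at hy
    have h1 : 1 ≤ ((ρ / R) * (1 + ‖y‖)) ^ m := by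
      refine one_le_pow₀ ?_
      rw [div_mul_eq_mul_div, one_le_div hR]
      nlinarith
    calc ‖Φ y‖ * ‖g (x - ρ • y)‖ ≤ ‖Φ y‖ * N * 1 := by rw [mul_one]; gcongr; exact hN _
      _ ≤ ‖Φ y‖ * N * ((ρ / R) * (1 + ‖y‖)) ^ m := by gcongr
      _ = _ := by rw [mul_pow]; ring

theorem conv_add {g' : Vec n → Vec l} {N' : ℝ} (hg : Continuous g) (hN : ∀ z, ‖g z‖ ≤ N)
    (hg' : Continuous g') (hN' : ∀ z, ‖g' z‖ ≤ N') :
    conv Φ ρ (fun z => g z + g' z) x = conv Φ ρ g x + conv Φ ρ g' x := by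
  rw [conv, conv, conv, ← integral_add (integrable_conv Φ ρ hg hN x)
    (integrable_conv Φ ρ hg' hN' x)]
  simp

theorem conv_smul (c : ℝ) : conv Φ ρ (fun z => c • g z) x = c • conv Φ ρ g x := by
  rw [conv, conv, ← integral_smul]
  simp

theorem conv_const (v : Vec l) : conv Φ ρ (fun _ => v) x = (∫ y, Φ y) v := by
  rw [ContinuousLinearMap.integral_apply Φ.integrable]; rfl

theorem conv_zero : conv Φ 0 g x = (∫ y, Φ y) (g x) := by
  rw [ContinuousLinearMap.integral_apply Φ.integrable]; simp [conv]

theorem conv_kernel_add {Ψ : 𝓢(Vec n, Mat l)} (hg : Continuous g) (hN : ∀ z, ‖g z‖ ≤ N) :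
    conv (Φ + Ψ) ρ g x = conv Φ ρ g x + conv Ψ ρ g x := by
  rw [conv, conv, conv, ← integral_add (integrable_conv Φ ρ hg hN x)
    (integrable_conv Ψ ρ hg hN x)]
  simp

theorem conv_kernel_smul (c : ℝ) : conv (c • Φ) ρ g x = c • conv Φ ρ g x := by
  rw [conv, conv, ← integral_smul]
  simp

theorem conv_kernel_sum {ι : Type*} (s : Finset ι) (Ψ : ι → 𝓢(Vec n, Mat l)) (hg : Continuous g)
    (hN : ∀ z, ‖g z‖ ≤ N) : conv (∑ i ∈ s, Ψ i) ρ g x = ∑ i ∈ s, conv (Ψ i) ρ g x := by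
  rw [conv]
  simp only [conv, sum_apply]
  rw [← integral_finsetSum _ fun i _ => integrable_conv (Ψ i) ρ hg hN x]

theorem continuous_conv {X : Type*} [TopologicalSpace X] [FirstCountableTopology X]
    {G : X → Vec n → Vec l} {ρ : X → ℝ} {p : X → Vec n}
    (hG : Continuous fun q : X × Vec n => G q.1 q.2) (hN : ∀ a z, ‖G a z‖ ≤ N)
    (hρ : Continuous ρ) (hp : Continuous p) :
    Continuous fun a => conv Φ (ρ a) (G a) (p a) := by
  refine continuous_of_dominated (bound := fun y => N * ((1 + ‖y‖) ^ 0 * ‖Φ y‖)) (fun a => ?_)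
    (fun a => Eventually.of_forall fun y => ?_) ((integrable_mom 0 Φ).const_mul N)
    (Eventually.of_forall fun y => ?_)
  · have : Continuous fun y => G a (p a - ρ a • y) :=
      hG.comp (Continuous.prodMk continuous_const (by fun_prop))
    exact (Φ.continuous.clm_apply this).aestronglyMeasurable
  · refine ((Φ y).le_opNorm _).trans ?_
    rw [pow_zero, one_mul, mul_comm]
    gcongr
    exact hN _ _
  · exact (Φ y).continuous.comp (hG.comp (continuous_id.prodMk (by fun_prop)))

/-- Change of variables. -/
theorem conv_eq (hρ : 0 < ρ) :
    conv Φ ρ g x = ∫ w, (ρ⁻¹) ^ n • Φ (ρ⁻¹ • (x - w)) (g w) := by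
  have h1 := integral_sub_left_eq_self
    (fun w => (ρ⁻¹) ^ n • Φ (ρ⁻¹ • (x - w)) (g w)) (volume : Measure (Vec n)) x
  rw [← h1]
  simp only [sub_sub_cancel]
  have h2 := Measure.integral_comp_smul (volume : Measure (Vec n))
    (fun w => (ρ⁻¹) ^ n • Φ (ρ⁻¹ • w) (g (x - w))) ρ
  simp only [finrank_euclideanSpace, Fintype.card_fin, smul_smul, inv_mul_cancel₀ hρ.ne',
    one_smul] at h2
  rw [integral_smul] at h2
  have h3 : |(ρ ^ n)⁻¹| = ρ⁻¹ ^ n := by rw [abs_of_pos (by positivity), inv_pow]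
  rw [h3] at h2
  have h4 : (ρ⁻¹ ^ n : ℝ) ≠ 0 := by positivity
  exact smul_right_injective _ h4 h2

theorem conv_lineDeriv (i : Fin n) {g' : Vec n → Vec l} {N' : ℝ}
    (hgd : Differentiable ℝ g) (hg' : ∀ z, fderiv ℝ g z (ee i) = g' z)
    (hN : ∀ z, ‖g z‖ ≤ N) (hN' : ∀ z, ‖g' z‖ ≤ N') (hc : Continuous g') :
    conv (∂_{ee i} Φ) ρ g x = ρ • conv Φ ρ g' x := by
  have hd : ∀ y, HasFDerivAt (fun y => g (x - ρ • y))
      ((fderiv ℝ g (x - ρ • y)).comp (-(ρ • ContinuousLinearMap.id ℝ (Vec n)))) y := by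
    intro y
    have : HasFDerivAt (fun y => x - ρ • y) (-(ρ • ContinuousLinearMap.id ℝ (Vec n))) y :=
      ((hasFDerivAt_id y).const_smul ρ).const_sub x
    exact (hgd _).hasFDerivAt.comp y this
  have hf : ∀ y, fderiv ℝ (fun y => g (x - ρ • y)) y (ee i) = -(ρ • g' (x - ρ • y)) := by
    intro y
    rw [(hd y).fderiv]
    simp [hg']
  have := integral_bilinear_fderiv_right_eq_neg_left_of_integrable
    (f := Φ) (g := fun y => g (x - ρ • y)) (μ := volume)
    (B := ContinuousLinearMap.id ℝ (Mat l)) (v := ee i) ?_ ?_ ?_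
    (fun y _ => Φ.differentiableAt) (fun y _ => (hd y).differentiableAt)
  · simp only [hf] at this
    simp only [ContinuousLinearMap.coe_id', id, map_neg, map_smul, integral_neg, integral_smul,
      neg_inj] at this
    exact this.symm
  · exact integrable_conv (∂_{ee i} Φ) ρ hgd.continuous hN x
  · simp only [hf]
    simp only [ContinuousLinearMap.coe_id', id, map_neg, map_smul]
    exact ((integrable_conv Φ ρ hc hN' x).smul ρ).neg
  · exact integrable_conv Φ ρ hgd.continuous hN x

theorem exists_dominating {E : Type} [NormedAddCommGroup E] [NormedSpace ℝ E] (Ψ : 𝓢(Vec n, E))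
    (hρ : 0 < ρ) (x₀ : Vec n) : ∃ b : Vec n → ℝ, Integrable b ∧
      ∀ x, ‖x - x₀‖ < 1 → ∀ s, ρ / 2 < s → s < 2 * ρ → ∀ w, ‖Ψ (s⁻¹ • (x - w))‖ ≤ b w := by
  obtain ⟨C, hC0, hC⟩ : ∃ C, 0 ≤ C ∧ ∀ y, (1 + ‖y‖) ^ (n + 1) * ‖Ψ y‖ ≤ C := by
    refine ⟨2 ^ (n + 1) * ((Finset.Iic (n + 1, 0)).sup fun m => SchwartzMap.seminorm ℝ m.1 m.2) Ψ,
      by positivity, fun y => ?_⟩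
    have := SchwartzMap.one_add_le_sup_seminorm_apply (𝕜 := ℝ) (m := (n + 1, 0)) (k := n + 1)
      (n := 0) le_rfl le_rfl Ψ y
    simpa using this
  have hi : Integrable (fun w : Vec n => (1 + ‖w - x₀‖) ^ (-((n : ℝ) + 1))) :=
    (integrable_one_add_norm (E := Vec n) (μ := volume) (r := (n : ℝ) + 1)
      (by simp)).comp_sub_right x₀
  refine ⟨fun w => (C * (2 + 2 * ρ) ^ (n + 1)) * (1 + ‖w - x₀‖) ^ (-((n : ℝ) + 1)),
    hi.const_mul _, fun x hx s hs1 hs2 w => ?_⟩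
  have hs : 0 < s := by linarith
  have h1 : 1 + ‖w - x₀‖ ≤ (2 + 2 * ρ) * (1 + ‖s⁻¹ • (x - w)‖) := by
    have e1 : ‖w - x₀‖ ≤ ‖x - x₀‖ + ‖x - w‖ := by
      have := norm_sub_le (x - x₀) (x - w)
      rwa [sub_sub_sub_cancel_left] at this
    rw [norm_smul, norm_inv, Real.norm_of_nonneg hs.le]
    have e2 : ‖x - w‖ ≤ 2 * ρ * (s⁻¹ * ‖x - w‖) := by
      have : 1 ≤ 2 * ρ * s⁻¹ := by rw [← div_eq_mul_inv, one_le_div hs]; exact hs2.le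
      nlinarith [norm_nonneg (x - w)]
    have e3 : 0 ≤ s⁻¹ * ‖x - w‖ := by positivity
    nlinarith
  have h2 := hC (s⁻¹ • (x - w))
  have hq : 0 < 1 + ‖w - x₀‖ := by positivity
  have e : (1 + ‖w - x₀‖) ^ (-((n : ℝ) + 1)) = ((1 + ‖w - x₀‖) ^ (n + 1))⁻¹ := by
    rw [Real.rpow_neg hq.le]
    congr 1
    exact_mod_cast Real.rpow_natCast (1 + ‖w - x₀‖) (n + 1)
  simp only [e]
  rw [← div_eq_mul_inv, le_div_iff₀ (by positivity)]
  calc ‖Ψ (s⁻¹ • (x - w))‖ * (1 + ‖w - x₀‖) ^ (n + 1)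
      ≤ ‖Ψ (s⁻¹ • (x - w))‖ * ((2 + 2 * ρ) * (1 + ‖s⁻¹ • (x - w)‖)) ^ (n + 1) := by gcongr
    _ = ((1 + ‖s⁻¹ • (x - w)‖) ^ (n + 1) * ‖Ψ (s⁻¹ • (x - w))‖) * (2 + 2 * ρ) ^ (n + 1) := by
      rw [mul_pow]; ring
    _ ≤ _ := by gcongr

theorem fderiv_apply_eq_sum {F : Type*} [NormedAddCommGroup F] [NormedSpace ℝ F]
    (L : Vec n →L[ℝ] F) (v : Vec n) : L v = ∑ i, v i • L (ee i) := by
  have hξ : v = ∑ i, v i • (ee i : Vec n) := by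
    simpa using ((EuclideanSpace.basisFun (Fin n) ℝ).sum_repr v).symm
  conv_lhs => rw [hξ]
  simp only [map_sum, map_smul]

/-- Assemble a linear map from partial derivatives. -/
def grad {F : Type*} [NormedAddCommGroup F] [NormedSpace ℝ F] (v : Fin n → F) : Vec n →L[ℝ] F :=
  ∑ i, (EuclideanSpace.proj i : Vec n →L[ℝ] ℝ).smulRight (v i)

theorem grad_apply {F : Type*} [NormedAddCommGroup F] [NormedSpace ℝ F] (v : Fin n → F)
    (x : Vec n) : grad v x = ∑ i, x i • v i := by
  simp [grad, sum_apply]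

theorem grad_ee {F : Type*} [NormedAddCommGroup F] [NormedSpace ℝ F] (v : Fin n → F)
    (i : Fin n) : grad v (ee i) = v i := by
  simp [grad_apply]

theorem eq_grad {F : Type*} [NormedAddCommGroup F] [NormedSpace ℝ F] (L : Vec n →L[ℝ] F) :
    L = grad fun i => L (ee i) := by
  ext v : 1
  rw [fderiv_apply_eq_sum, grad_apply]

theorem norm_grad_le {F : Type*} [NormedAddCommGroup F] [NormedSpace ℝ F] {v : Fin n → F} {C : ℝ}
    (h : ∀ i, ‖v i‖ ≤ C) : ‖grad v‖ ≤ n * C := by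
  rcases Nat.eq_zero_or_pos n with rfl | hn
  · simp [grad]
  have hC : 0 ≤ C := (norm_nonneg _).trans (h ⟨0, hn⟩)
  refine ContinuousLinearMap.opNorm_le_bound _ (by positivity) fun x => ?_
  rw [grad_apply]
  refine (norm_sum_le_of_le _ (fun i _ => (norm_smul_le _ _).trans
    (mul_le_mul (PiLp.norm_apply_le x i) (h i) (norm_nonneg _) (norm_nonneg _)))).trans ?_
  simp
  linarith [mul_comm C ‖x‖]

theorem integrable_kernel (hρ : 0 < ρ) (hg : Continuous g) (hN : ∀ z, ‖g z‖ ≤ N) (x : Vec n) :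
    Integrable fun w => Φ (ρ⁻¹ • (x - w)) (g w) := by
  obtain ⟨b, hb, hbd⟩ := exists_dominating Φ hρ x
  refine Integrable.mono' (hb.mul_const N) ?_ (Eventually.of_forall fun w => ?_)
  · exact ((Φ.continuous.comp (by fun_prop : Continuous fun w => ρ⁻¹ • (x - w))).clm_apply
      hg).aestronglyMeasurable
  · have hw := hbd x (by simp) ρ (by linarith) (by linarith) w
    have hbw : 0 ≤ b w := (norm_nonneg _).trans hw
    refine (ContinuousLinearMap.le_opNorm _ _).trans ?_
    gcongr
    exact hN w

theorem hasFDerivAt_conv (hρ : 0 < ρ) (hg : Continuous g) (hN : ∀ z, ‖g z‖ ≤ N) (x : Vec n) :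
    HasFDerivAt (conv Φ ρ g) (grad fun i => ρ⁻¹ • conv (∂_{ee i} Φ) ρ g x) x := by
  obtain ⟨b, hb, hbd⟩ := exists_dominating (SchwartzMap.fderivCLM ℝ _ _ Φ) hρ x
  let F : Vec n → Vec n → Vec l := fun x w => (ρ⁻¹) ^ n • Φ (ρ⁻¹ • (x - w)) (g w)
  let F' : Vec n → Vec n → Vec n →L[ℝ] Vec l := fun x w =>
    ((ρ⁻¹) ^ n * ρ⁻¹) • (fderiv ℝ Φ (ρ⁻¹ • (x - w))).flip (g w)
  have hF : conv Φ ρ g = fun x => ∫ w, F x w := funext fun x => conv_eq hρ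
  have hFc : ∀ x, Continuous (F x) := fun x => by
    exact Continuous.const_smul
      ((Φ.continuous.comp (by fun_prop : Continuous fun w => ρ⁻¹ • (x - w))).clm_apply hg)
      ((ρ⁻¹) ^ n)
  have hcF' : Continuous (F' x) := by
    have h1 : Continuous fun w => SchwartzMap.fderivCLM ℝ _ _ Φ (ρ⁻¹ • (x - w)) :=
      (SchwartzMap.fderivCLM ℝ _ _ Φ).continuous.comp
        (by fun_prop : Continuous fun w => ρ⁻¹ • (x - w))
    have h2 : Continuous fun w => (fderiv ℝ Φ (ρ⁻¹ • (x - w))).flip :=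
      (ContinuousLinearMap.flipₗᵢ ℝ (Vec n) (Vec l) (Vec l)).continuous.comp h1
    exact Continuous.const_smul (h2.clm_apply hg) ((ρ⁻¹) ^ n * ρ⁻¹)
  have hbound : ∀ z ∈ Metric.ball x 1, ∀ w, ‖F' z w‖ ≤ ((ρ⁻¹) ^ n * ρ⁻¹) * (N * b w) := by
    intro z hz w
    have hN0 : 0 ≤ N := (norm_nonneg _).trans (hN 0)
    simp only [F']
    rw [norm_smul, Real.norm_of_nonneg (by positivity)]
    gcongr
    refine (ContinuousLinearMap.le_opNorm _ _).trans ?_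
    rw [ContinuousLinearMap.opNorm_flip, mul_comm]
    gcongr
    · exact hN w
    · exact hbd z (by simpa [dist_eq_norm] using hz) ρ (by linarith) (by linarith) w
  have key := hasFDerivAt_integral_of_dominated_of_fderiv_le (μ := volume) (F := F) (F' := F')
    (x₀ := x) (bound := fun w => ((ρ⁻¹) ^ n * ρ⁻¹) * (N * b w)) (Metric.ball_mem_nhds x one_pos)
    (Eventually.of_forall fun z => (hFc z).aestronglyMeasurable) ?_
    hcF'.aestronglyMeasurable
    (Eventually.of_forall fun w z hz => hbound z hz w) ((hb.const_mul N).const_mul _)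
    (Eventually.of_forall fun w z _ => ?_)
  · rw [hF]
    refine key.congr_fderiv ?_
    rw [eq_grad (∫ w, F' x w)]
    congr 1
    funext i
    rw [ContinuousLinearMap.integral_apply, conv_eq hρ, ← integral_smul]
    · refine integral_congr_ae (Eventually.of_forall fun w => ?_)
      simp only [F', smul_apply, smul_smul, ContinuousLinearMap.flip_apply,
        SchwartzMap.lineDerivOp_apply_eq_fderiv, mul_comm]
    · exact Integrable.mono' ((hb.const_mul N).const_mul _) hcF'.aestronglyMeasurable
        (Eventually.of_forall fun w => hbound x (Metric.mem_ball_self one_pos) w)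
  · exact (integrable_kernel hρ hg hN x).smul ((ρ⁻¹) ^ n)
  · have h1 : HasFDerivAt (fun z : Vec n => ρ⁻¹ • (z - w)) (ρ⁻¹ • ContinuousLinearMap.id ℝ _) z :=
      ((hasFDerivAt_id z).sub_const w).const_smul ρ⁻¹
    have h2 := ((Φ.hasFDerivAt (ρ⁻¹ • (z - w))).comp z h1)
    have h3 := ((h2.clm_apply (hasFDerivAt_const (g w) z)).const_smul ((ρ⁻¹) ^ n))
    refine h3.congr_fderiv ?_
    ext v
    simp [F', smul_smul, mul_assoc]

/-- The radial derivative of a kernel. -/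
def sharp (Φ : 𝓢(Vec n, Mat l)) : 𝓢(Vec n, Mat l) :=
  -((n : ℝ) • Φ + ∑ i, mulC _ i (∂_{ee i} Φ))

theorem sharp_apply (y : Vec n) :
    sharp Φ y = -((n : ℝ) • Φ y + fderiv ℝ Φ y y) := by
  simp only [sharp, neg_apply, add_apply, sum_apply, smul_apply, mulC_apply,
    SchwartzMap.lineDerivOp_apply_eq_fderiv]
  rw [fderiv_apply_eq_sum (fderiv ℝ Φ y) y]

theorem hasDerivAt_conv (hρ : 0 < ρ) (hg : Continuous g) (hN : ∀ z, ‖g z‖ ≤ N) (x : Vec n) :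
    HasDerivAt (fun ρ => conv Φ ρ g x) (ρ⁻¹ • conv (sharp Φ) ρ g x) ρ := by
  obtain ⟨b, hb, hbd⟩ := exists_dominating (sharp Φ) hρ x
  have hN0 : 0 ≤ N := (norm_nonneg _).trans (hN 0)
  let F : ℝ → Vec n → Vec l := fun s w => (s⁻¹) ^ n • Φ (s⁻¹ • (x - w)) (g w)
  let F' : ℝ → Vec n → Vec l := fun s w =>
    s⁻¹ • (s⁻¹) ^ n • sharp Φ (s⁻¹ • (x - w)) (g w)
  have hnhds : Ioo (ρ / 2) (2 * ρ) ∈ 𝓝 ρ := Ioo_mem_nhds (by linarith) (by linarith)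
  have hF : (fun ρ => conv Φ ρ g x) =ᶠ[𝓝 ρ] fun s => ∫ w, F s w := by
    filter_upwards [hnhds] with s hs
    exact conv_eq (by linarith [hs.1])
  have hFc : ∀ s, Continuous (F s) := fun s =>
    Continuous.const_smul
      ((Φ.continuous.comp (by fun_prop : Continuous fun w => s⁻¹ • (x - w))).clm_apply hg)
      ((s⁻¹) ^ n)
  have hcF' : Continuous (F' ρ) :=
    Continuous.const_smul (Continuous.const_smul
      (((sharp Φ).continuous.comp (by fun_prop : Continuous fun w => ρ⁻¹ • (x - w))).clm_apply
        hg) ((ρ⁻¹) ^ n)) ρ⁻¹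
  have hbound : ∀ s ∈ Ioo (ρ / 2) (2 * ρ), ∀ w, ‖F' s w‖ ≤
      (ρ / 2)⁻¹ * ((ρ / 2)⁻¹ ^ n * (b w * N)) := by
    intro s hs w
    have hs0 : 0 < s := by linarith [hs.1]
    have hs1 : s⁻¹ ≤ (ρ / 2)⁻¹ := inv_anti₀ (by linarith) hs.1.le
    have hw := hbd x (by simp) s hs.1 hs.2 w
    have hbw : 0 ≤ b w := (norm_nonneg _).trans hw
    simp only [F']
    rw [norm_smul, norm_smul, Real.norm_of_nonneg (by positivity),
      Real.norm_of_nonneg (by positivity)]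
    gcongr
    refine (ContinuousLinearMap.le_opNorm _ _).trans ?_
    gcongr
    exact hN w
  have key := (hasDerivAt_integral_of_dominated_loc_of_deriv_le (μ := volume) (F := F) (F' := F')
    (x₀ := ρ) (bound := fun w => (ρ / 2)⁻¹ * ((ρ / 2)⁻¹ ^ n * (b w * N))) hnhds
    (Eventually.of_forall fun z => (hFc z).aestronglyMeasurable) ?_
    hcF'.aestronglyMeasurable
    (Eventually.of_forall fun w z hz => hbound z hz w)
    (((hb.mul_const N).const_mul _).const_mul _)
    (Eventually.of_forall fun w s hs => ?_)).2
  · refine (key.congr_of_eventuallyEq hF).congr_deriv ?_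
    rw [conv_eq hρ, ← integral_smul]
  · exact (integrable_kernel hρ hg hN x).smul ((ρ⁻¹) ^ n)
  · have hs0 : s ≠ 0 := by linarith [hs.1]
    have h0 : HasDerivAt (fun s : ℝ => s⁻¹) (-(s ^ 2)⁻¹) s := hasDerivAt_inv hs0
    have h1 : HasDerivAt (fun s : ℝ => s⁻¹ • (x - w)) (-(s ^ 2)⁻¹ • (x - w)) s :=
      h0.smul_const (x - w)
    have h2 := (Φ.hasFDerivAt (s⁻¹ • (x - w))).comp_hasDerivAt s h1
    have h3 := (h0.fun_pow n).fun_smul (h2.clm_apply (hasDerivAt_const s (g w)))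
    refine h3.congr_deriv ?_
    have e1 : (s ^ 2)⁻¹ = s⁻¹ * s⁻¹ := by rw [pow_two, mul_inv]
    have e2 : (n : ℝ) * s⁻¹ ^ (n - 1) * -(s⁻¹ * s⁻¹) = -(s⁻¹ * s⁻¹ ^ n) * n := by
      rcases Nat.eq_zero_or_pos n with hn | hn
      · simp [hn]
      · obtain ⟨p, hp⟩ : ∃ p, n = p + 1 := ⟨n - 1, by omega⟩
        rw [hp]; simp only [Nat.add_sub_cancel, pow_succ]; ring
    have e3 : -(s⁻¹ * s⁻¹) • (x - w) = -s⁻¹ • (s⁻¹ • (x - w)) := by rw [smul_smul]; ring_nf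
    simp only [F', sharp_apply, e1, e3, map_smul, Function.comp, map_zero, add_zero, neg_apply,
      smul_apply, add_apply, e2]
    module

theorem integral_lineDeriv (Φ : 𝓢(Vec n, Mat l)) (i : Fin n) : ∫ y, (∂_{ee i} Φ) y = 0 := by
  ext1 v
  have := conv_lineDeriv (Φ := Φ) (ρ := 1) (g := fun _ => v) (x := 0) (N := ‖v‖) i
    (g' := fun _ => 0) (N' := 0) (differentiable_const v) (by simp) (by simp) (by simp)
    continuous_const
  rw [conv_const, conv_const] at this
  simpa using this

theorem integral_sharp (Φ : 𝓢(Vec n, Mat l)) : ∫ y, sharp Φ y = 0 := by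
  ext1 v
  have := hasDerivAt_conv (Φ := Φ) (g := fun _ => v) (N := ‖v‖) one_pos continuous_const
    (by simp) 0
  simp only [conv_const] at this
  simpa using (this.unique (hasDerivAt_const _ _))

end Conv

section Scale

/-- The parabolic length scale. -/
def rt (r : ℕ) (σ : ℝ) : ℝ := σ ^ ((r : ℝ)⁻¹)

variable {r : ℕ}

theorem rt_pos {σ : ℝ} (hσ : 0 < σ) : 0 < rt r σ := Real.rpow_pos_of_pos hσ _

theorem continuous_rt (r : ℕ) : Continuous (rt r) :=
  Real.continuous_rpow_const (by positivity)

theorem rt_zero (hr : 2 ≤ r) : rt r 0 = 0 := Real.zero_rpow (by positivity)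

theorem rt_pow (hr : 2 ≤ r) {σ : ℝ} (hσ : 0 ≤ σ) : rt r σ ^ r = σ := by
  rw [rt, ← Real.rpow_natCast, ← Real.rpow_mul hσ, inv_mul_cancel₀ (by positivity), Real.rpow_one]

theorem hasDerivAt_rt {σ : ℝ} (hσ : 0 < σ) :
    HasDerivAt (rt r) ((r : ℝ)⁻¹ * σ⁻¹ * rt r σ) σ := by
  have := Real.hasDerivAt_rpow_const (p := (r : ℝ)⁻¹) (Or.inl hσ.ne')
  refine this.congr_deriv ?_
  rw [Real.rpow_sub_one hσ.ne', rt]; ring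

/-- Powers of the scale are powers of time. -/
theorem rt_rpow {σ p : ℝ} (hσ : 0 ≤ σ) : rt r σ ^ p = σ ^ (p / r) := by
  rw [rt, ← Real.rpow_mul hσ]; congr 1; ring

theorem rpow_le_rpow_of_le {T σ p q : ℝ} (m : ℕ) (hσ : 0 < σ) (hσT : σ ≤ T) (hpq : p ≤ q)
    (hm : q ≤ p + m) : σ ^ q ≤ (1 + T) ^ m * σ ^ p := by
  have h : q = (q - p) + p := by ring
  rw [h, Real.rpow_add hσ]
  gcongr
  calc σ ^ (q - p) ≤ (1 + T) ^ (q - p) := Real.rpow_le_rpow hσ.le (by linarith) (by linarith)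
    _ ≤ (1 + T) ^ (m : ℝ) := Real.rpow_le_rpow_of_exponent_le (by linarith) (by linarith)
    _ = _ := Real.rpow_natCast _ _

end Scale

section Heat
variable {n l r : ℕ}

/-- Derivative of a kernel along a multi-index. -/
def kerD (K : 𝓢(Vec n, Mat l)) {k : ℕ} (I : Fin k → Fin n) : 𝓢(Vec n, Mat l) :=
  ∂^{fun j => ee (I j)} K

theorem kerD_cons (K : 𝓢(Vec n, Mat l)) {k : ℕ} (i : Fin n) (I : Fin k → Fin n) :
    kerD K (Fin.cons i I : Fin (k + 1) → Fin n) = ∂_{ee i} (kerD K I) := by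
  rw [kerD, LineDeriv.iteratedLineDerivOp_succ_left]
  rfl

theorem kerD_zero (K : 𝓢(Vec n, Mat l)) (I : Fin 0 → Fin n) : kerD K I = K := rfl

theorem integral_kerD (K : 𝓢(Vec n, Mat l)) {k : ℕ} (hk : 1 ≤ k) (I : Fin k → Fin n) :
    ∫ y, kerD K I y = 0 := by
  obtain ⟨k, rfl⟩ : ∃ j, k = j + 1 := ⟨k - 1, by omega⟩
  rw [← Fin.cons_self_tail I, kerD_cons]
  exact integral_lineDeriv _ _

/-- Spatial derivatives of the heat semigroup with kernel `K`. -/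
def heat (r : ℕ) (K : 𝓢(Vec n, Mat l)) {k : ℕ} (I : Fin k → Fin n) (σ : ℝ)
    (g : Vec n → Vec l) (x : Vec n) : Vec l :=
  ((rt r σ)⁻¹) ^ k • conv (kerD K I) (rt r σ) g x

variable {K : 𝓢(Vec n, Mat l)} {k : ℕ} {I : Fin k → Fin n} {σ : ℝ} {g : Vec n → Vec l}
  {x : Vec n} {N α T : ℝ}

theorem hasFDerivAt_heat (hσ : 0 < σ) (hg : Continuous g) (hN : ∀ z, ‖g z‖ ≤ N) (x : Vec n) :
    HasFDerivAt (heat r K I σ g)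
      (grad fun i => heat r K (Fin.cons i I : Fin (k + 1) → Fin n) σ g x) x := by
  have := (hasFDerivAt_conv (Φ := kerD K I) (rt_pos (r := r) hσ) hg hN x).const_smul
    (((rt r σ)⁻¹) ^ k)
  refine this.congr_fderiv ?_
  ext v
  simp only [heat, kerD_cons, smul_apply, grad_apply, Finset.smul_sum, pow_succ]
  refine congrArg₂ _ (Finset.sum_congr rfl fun i _ => ?_) rfl
  module

theorem hasDerivAt_heat (hσ : 0 < σ) (hg : Continuous g) (hN : ∀ z, ‖g z‖ ≤ N) (x : Vec n) :
    HasDerivAt (fun σ => heat r K I σ g x)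
      (((r : ℝ)⁻¹ * σ⁻¹ * ((rt r σ)⁻¹) ^ k) •
        (conv (sharp (kerD K I)) (rt r σ) g x - (k : ℝ) • conv (kerD K I) (rt r σ) g x)) σ := by
  have hρ := rt_pos (r := r) hσ
  have h1 := (hasDerivAt_conv (Φ := kerD K I) hρ hg hN x).scomp σ (hasDerivAt_rt hσ)
  have h2 := ((hasDerivAt_rt (r := r) hσ).fun_inv hρ.ne').fun_pow k
  refine (h2.fun_smul h1).congr_deriv ?_
  have e2 : (k : ℝ) * (rt r σ)⁻¹ ^ (k - 1) * (-((r : ℝ)⁻¹ * σ⁻¹ * rt r σ) / rt r σ ^ 2) =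
      - ((r : ℝ)⁻¹ * σ⁻¹ * ((rt r σ)⁻¹) ^ k) * k := by
    have : -((r : ℝ)⁻¹ * σ⁻¹ * rt r σ) / rt r σ ^ 2 = -((r : ℝ)⁻¹ * σ⁻¹) * (rt r σ)⁻¹ := by
      field_simp
    rw [this]
    rcases Nat.eq_zero_or_pos k with hn | hn
    · simp [hn]
    · obtain ⟨p, hp⟩ : ∃ p, k = p + 1 := ⟨k - 1, by omega⟩
      rw [hp]; simp only [Nat.add_sub_cancel, pow_succ]; ring
  rw [e2, smul_smul, smul_smul]
  have e3 : (rt r σ)⁻¹ ^ k * ((r : ℝ)⁻¹ * σ⁻¹ * rt r σ * (rt r σ)⁻¹) =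
      (r : ℝ)⁻¹ * σ⁻¹ * ((rt r σ)⁻¹) ^ k := by
    field_simp
  simp only [Function.comp]
  rw [mul_assoc, e3]
  module

/-- Time-bounds on `(0, T]` for kernels with vanishing integral. -/
theorem norm_scaled_conv_le {Φ : 𝓢(Vec n, Mat l)} (hΦ : ∫ y, Φ y = 0) (hg : Continuous g)
    (hN : ∀ z, ‖g z‖ ≤ N) (hα0 : 0 ≤ α) (hα1 : α ≤ 1)
    (hH : ∀ y z, ‖g y - g z‖ ≤ N * ‖y - z‖ ^ α) (hσ : 0 < σ) (hσT : σ ≤ T) {j J : ℕ}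
    (hj : j ≤ J) (hr : 2 ≤ r) :
    ‖((rt r σ)⁻¹) ^ j • conv Φ (rt r σ) g x‖ ≤
      (1 + T) ^ J * mom 1 Φ * N * σ ^ ((α - J) / r) := by
  have hρ := rt_pos (r := r) hσ
  have hN0 : 0 ≤ N := (norm_nonneg _).trans (hN 0)
  have h1 := norm_conv_le_of_integral_eq_zero (x := x) hΦ hg hN hα0 hα1 hH hρ.le hN0
  rw [norm_smul, Real.norm_of_nonneg (by positivity)]
  have h2 : (rt r σ)⁻¹ ^ j * rt r σ ^ α = σ ^ ((α - j) / r) := by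
    rw [← rt_rpow hσ.le, Real.rpow_sub hρ, Real.rpow_natCast, inv_pow]; field_simp
  have hr0 : (0 : ℝ) < r := by positivity
  have hr1 : (1 : ℝ) ≤ r := by exact_mod_cast (by omega : 1 ≤ r)
  have h3 : σ ^ ((α - j) / r) ≤ (1 + T) ^ J * σ ^ ((α - J) / r) := by
    refine rpow_le_rpow_of_le J hσ hσT ?_ ?_
    · have : (j : ℝ) ≤ J := by exact_mod_cast hj
      gcongr
    · rw [div_le_iff₀ hr0, add_mul, div_mul_cancel₀ _ hr0.ne']
      have h5 : (J : ℝ) ≤ J * r := le_mul_of_one_le_right (by positivity) hr1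
      have : (0 : ℝ) ≤ j := by positivity
      linarith
  calc _ ≤ (rt r σ)⁻¹ ^ j * (mom 1 Φ * (N * rt r σ ^ α)) := by gcongr
    _ = mom 1 Φ * N * ((rt r σ)⁻¹ ^ j * rt r σ ^ α) := by ring
    _ ≤ mom 1 Φ * N * ((1 + T) ^ J * σ ^ ((α - J) / r)) := by
      rw [h2]; have := mom_nonneg 1 Φ; gcongr
    _ = _ := by ring

theorem norm_heat_le (hα0 : 0 ≤ α) (hα1 : α < 1) (hr : 2 ≤ r) (hT : 0 ≤ T)
    (K : 𝓢(Vec n, Mat l)) (hk : k ≤ r) (I : Fin k → Fin n) :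
    ∃ C, 0 ≤ C ∧ ∀ (g : Vec n → Vec l) (N : ℝ), Continuous g → (∀ z, ‖g z‖ ≤ N) →
      (∀ y z, ‖g y - g z‖ ≤ N * ‖y - z‖ ^ α) → ∀ σ, 0 < σ → σ ≤ T → ∀ x,
      ‖heat r K I σ g x‖ ≤ C * N * σ ^ (α / r - 1) := by
  have hr0 : (0 : ℝ) < r := by positivity
  have hr1 : (1 : ℝ) ≤ r := by exact_mod_cast (by omega : 1 ≤ r)
  rcases Nat.eq_zero_or_pos k with rfl | hk0
  · refine ⟨mom 0 (kerD K I) * (1 + T), mul_nonneg (mom_nonneg _ _) (by linarith), ?_⟩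
    intro g N hg hN hH σ hσ hσT x
    have hN0 : 0 ≤ N := (norm_nonneg _).trans (hN 0)
    rw [heat, pow_zero, one_smul]
    refine (norm_conv_le hN).trans ?_
    have : σ ^ (0 : ℝ) ≤ (1 + T) ^ 1 * σ ^ (α / r - 1) := by
      refine rpow_le_rpow_of_le 1 hσ hσT ?_ ?_
      · rw [sub_nonpos, div_le_one hr0]; linarith
      · simp; positivity
    rw [Real.rpow_zero, pow_one] at this
    have h2 := mom_nonneg 0 (kerD K I)
    calc _ = mom 0 (kerD K I) * N * 1 := by ring
      _ ≤ mom 0 (kerD K I) * N * ((1 + T) * σ ^ (α / r - 1)) := by gcongr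
      _ = _ := by ring
  · refine ⟨(1 + T) ^ r * mom 1 (kerD K I),
      mul_nonneg (by positivity) (mom_nonneg _ _), ?_⟩
    intro g N hg hN hH σ hσ hσT x
    have := norm_scaled_conv_le (x := x) (integral_kerD K hk0 I) hg hN hα0 hα1.le hH hσ hσT hk hr
    rwa [sub_div, div_self hr0.ne'] at this

theorem norm_heat_succ_le (hα0 : 0 ≤ α) (hα1 : α < 1) (hr : 2 ≤ r) (hT : 0 ≤ T)
    (K : 𝓢(Vec n, Mat l)) (hk : k ≤ r) (I : Fin (k + 1) → Fin n) :
    ∃ C, 0 ≤ C ∧ ∀ (g : Vec n → Vec l) (N : ℝ), Continuous g → (∀ z, ‖g z‖ ≤ N) →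
      (∀ y z, ‖g y - g z‖ ≤ N * ‖y - z‖ ^ α) → ∀ σ, 0 < σ → σ ≤ T → ∀ x,
      ‖heat r K I σ g x‖ ≤ C * N * σ ^ (α / r - 1 - (r : ℝ)⁻¹) := by
  have hr0 : (0 : ℝ) < r := by positivity
  refine ⟨(1 + T) ^ (r + 1) * mom 1 (kerD K I),
      mul_nonneg (by positivity) (mom_nonneg _ _), ?_⟩
  intro g N hg hN hH σ hσ hσT x
  have := norm_scaled_conv_le (x := x) (integral_kerD K (by omega) I) hg hN hα0 hα1.le hH hσ hσT
    (Nat.succ_le_succ hk) hr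
  have e : (α - (r + 1 : ℕ)) / r = α / r - 1 - (r : ℝ)⁻¹ := by
    push_cast
    field_simp
    ring
  rw [← e]
  exact this

theorem norm_deriv_heat_le (hα0 : 0 ≤ α) (hα1 : α < 1) (hr : 2 ≤ r) (hT : 0 ≤ T)
    (K : 𝓢(Vec n, Mat l)) (hk : k ≤ r) (I : Fin k → Fin n) :
    ∃ C, 0 ≤ C ∧ ∀ (g : Vec n → Vec l) (N : ℝ), Continuous g → (∀ z, ‖g z‖ ≤ N) →
      (∀ y z, ‖g y - g z‖ ≤ N * ‖y - z‖ ^ α) → ∀ σ, 0 < σ → σ ≤ T → ∀ x,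
      ‖deriv (fun σ => heat r K I σ g x) σ‖ ≤ C * N * σ ^ (α / r - 2) := by
  have hr0 : (0 : ℝ) < r := by positivity
  let Ψ := sharp (kerD K I) + (-(k : ℝ)) • kerD K I
  have hΨ : ∫ y, Ψ y = 0 := by
    have h1 : ∫ y, (kerD K I) y * (k : ℝ) • (1 : Mat l) = 0 := by
      rcases Nat.eq_zero_or_pos k with rfl | hk0
      · simp
      · have := integral_kerD K hk0 I
        simp [this, integral_smul]
    have h2 : ∫ y, Ψ y = ∫ y, sharp (kerD K I) y - (kerD K I) y * (k : ℝ) • (1 : Mat l) := by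
      congr 1; funext y; simp [Ψ, sub_eq_add_neg]
    rw [h2, integral_sub (SchwartzMap.integrable _), h1, integral_sharp, sub_zero]
    have h4 : (fun y => (kerD K I) y * (k : ℝ) • (1 : Mat l)) = fun y => ((k : ℝ) • kerD K I) y := by
      funext y; simp
    rw [h4]
    exact SchwartzMap.integrable _
  refine ⟨(r : ℝ)⁻¹ * ((1 + T) ^ r * mom 1 Ψ),
      mul_nonneg (by positivity) (mul_nonneg (by positivity) (mom_nonneg _ _)), ?_⟩
  intro g N hg hN hH σ hσ hσT x
  rw [(hasDerivAt_heat hσ hg hN x).deriv]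
  have h3 : conv (sharp (kerD K I)) (rt r σ) g x - (k : ℝ) • conv (kerD K I) (rt r σ) g x =
      conv Ψ (rt r σ) g x := by
    rw [conv_kernel_add hg hN, conv_kernel_smul, neg_smul, sub_eq_add_neg]
  have := norm_scaled_conv_le (x := x) hΨ hg hN hα0 hα1.le hH hσ hσT hk hr
  rw [h3, mul_smul, norm_smul, Real.norm_of_nonneg (by positivity)]
  calc _ ≤ (r : ℝ)⁻¹ * σ⁻¹ * ((1 + T) ^ r * mom 1 Ψ * N * σ ^ ((α - r) / r)) := by gcongr
    _ = (r : ℝ)⁻¹ * ((1 + T) ^ r * mom 1 Ψ) * N * (σ ^ ((α - r) / r) * σ⁻¹) := by ring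
    _ = _ := by
      rw [← Real.rpow_neg_one σ, ← Real.rpow_add hσ]
      congr 2
      field_simp
      ring

/-- The semigroup solves the constant-coefficient equation. -/
theorem hasDerivAt_heat_zero {A : (Fin r → Fin n) → Mat l} (hK : IsKer r A K) (hr : 2 ≤ r)
    (hσ : 0 < σ) (hg : Continuous g) (hN : ∀ z, ‖g z‖ ≤ N) (x : Vec n) (I₀ : Fin 0 → Fin n) :
    HasDerivAt (fun σ => heat r K I₀ σ g x) (∑ I, A I (heat r K I σ g x)) σ := by
  refine (hasDerivAt_heat hσ hg hN x).congr_deriv ?_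
  have h1 : ∑ I, (kerD K I).postcompCLM (ContinuousLinearMap.compL ℝ _ _ _ (A I)) =
      (r : ℝ)⁻¹ • sharp K := by
    ext1 y
    have := hK.left y
    rw [sum_apply, smul_apply, sharp_apply, fderiv_apply_eq_sum (fderiv ℝ K y) y, smul_neg,
      ← neg_smul]
    exact this
  have h2 : ∀ I, A I (conv (kerD K I) (rt r σ) g x) =
      conv ((kerD K I).postcompCLM (ContinuousLinearMap.compL ℝ _ _ _ (A I))) (rt r σ) g x := by
    intro I
    rw [conv, ← ContinuousLinearMap.integral_comp_comm _ (integrable_conv _ _ hg hN x)]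
    rfl
  simp only [heat, map_smul, h2]
  rw [← Finset.smul_sum, ← conv_kernel_sum _ _ hg hN, h1, conv_kernel_smul, inv_pow _ r,
    rt_pow hr hσ.le, kerD_zero]
  simp [smul_smul, mul_comm]

theorem continuousOn_heat {X : Type*} [TopologicalSpace X] [FirstCountableTopology X]
    {G : X → Vec n → Vec l} {s : X → ℝ} {p : X → Vec n}
    (hG : Continuous fun q : X × Vec n => G q.1 q.2) (hN : ∀ a z, ‖G a z‖ ≤ N)
    (hs : Continuous s) (hp : Continuous p) (K : 𝓢(Vec n, Mat l)) (I : Fin k → Fin n) :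
    ContinuousOn (fun a => heat r K I (s a) (G a) (p a)) {a | 0 < s a} := by
  have hρ : Continuous fun a => rt r (s a) := (continuous_rt r).comp hs
  refine ContinuousOn.fun_smul (ContinuousOn.fun_pow (ContinuousOn.inv₀ hρ.continuousOn ?_) k) ?_
  · intro a ha; exact (rt_pos ha).ne'
  · exact (continuous_conv hG hN hρ hp).continuousOn

end Heat

section Singular
variable {E : Type*} [NormedAddCommGroup E] [NormedSpace ℝ E]

theorem intervalIntegrable_of_le_rpow {F : ℝ → E} {a M t : ℝ} (ha : 0 < a) (ht : 0 ≤ t)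
    (hF : ContinuousOn F (Ioc 0 t)) (h1 : ∀ σ ∈ Ioc 0 t, ‖F σ‖ ≤ M * σ ^ (a - 1)) :
    IntervalIntegrable F volume 0 t := by
  have h2 : IntervalIntegrable (fun σ : ℝ => M * σ ^ (a - 1)) volume 0 t :=
    (intervalIntegral.intervalIntegrable_rpow' (by linarith)).const_mul M
  rw [intervalIntegrable_iff_integrableOn_Ioc_of_le ht] at h2 ⊢
  refine Integrable.mono' h2 (hF.aestronglyMeasurable measurableSet_Ioc) ?_
  exact (ae_restrict_mem measurableSet_Ioc).mono fun σ hσ => h1 σ hσ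

theorem norm_integral_le_of_le_rpow {F : ℝ → E} {a M t : ℝ} (ha : 0 < a) (ht : 0 ≤ t)
    (h1 : ∀ σ ∈ Ioc 0 t, ‖F σ‖ ≤ M * σ ^ (a - 1)) :
    ‖∫ σ in (0 : ℝ)..t, F σ‖ ≤ M * (t ^ a / a) := by
  have h2 : IntervalIntegrable (fun σ : ℝ => M * σ ^ (a - 1)) volume 0 t :=
    (intervalIntegral.intervalIntegrable_rpow' (by linarith)).const_mul M
  refine (intervalIntegral.norm_integral_le_of_norm_le ht
    (Eventually.of_forall h1) h2).trans (le_of_eq ?_)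
  rw [intervalIntegral.integral_const_mul, integral_rpow (Or.inl (by linarith)), sub_add_cancel,
    Real.zero_rpow ha.ne', sub_zero]

theorem norm_integral_le_of_le_min {F : ℝ → E} {a b M h t : ℝ} (ha : 0 < a) (hab : a < b)
    (hh : 0 ≤ h) (hM : 0 ≤ M) (ht : 0 ≤ t) (hF : ContinuousOn F (Ioc 0 t))
    (h1 : ∀ σ ∈ Ioc 0 t, ‖F σ‖ ≤ M * σ ^ (a - 1))
    (h2 : ∀ σ ∈ Ioc 0 t, ‖F σ‖ ≤ M * h * σ ^ (a - 1 - b)) :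
    ‖∫ σ in (0 : ℝ)..t, F σ‖ ≤ (1 / a + 1 / (b - a)) * M * h ^ (a / b) := by
  have hb : 0 < b := ha.trans hab
  have hba : 0 < b - a := by linarith
  rcases hh.eq_or_lt with rfl | hh
  · have : ∫ σ in (0 : ℝ)..t, F σ = ∫ σ in (0 : ℝ)..t, 0 := by
      refine intervalIntegral.integral_congr_ae (Eventually.of_forall fun σ hσ => ?_)
      rw [uIoc_of_le ht] at hσ
      simpa using h2 σ hσ
    rw [this]
    simp only [intervalIntegral.integral_zero, norm_zero]
    positivity
  set d := h ^ (1 / b) with hd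
  have hd0 : 0 < d := Real.rpow_pos_of_pos hh _
  have hda : d ^ a = h ^ (a / b) := by rw [hd, ← Real.rpow_mul hh.le]; congr 1; ring
  have hdb : d ^ b = h := by
    rw [hd, ← Real.rpow_mul hh.le, one_div_mul_cancel hb.ne', Real.rpow_one]
  rw [← hda]
  have hq : 0 ≤ 1 / (b - a) * M * d ^ a := by positivity
  rcases le_total t d with htd | htd
  · refine (norm_integral_le_of_le_rpow ha ht h1).trans ?_
    have : t ^ a ≤ d ^ a := Real.rpow_le_rpow ht htd ha.le
    calc M * (t ^ a / a) ≤ M * (d ^ a / a) := by gcongr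
      _ ≤ _ := by rw [add_mul, add_mul]; linarith [show M * (d ^ a / a) = 1 / a * M * d ^ a by ring]
  · have hi := intervalIntegrable_of_le_rpow ha ht hF h1
    have hsub1 : uIcc 0 d ⊆ uIcc 0 t := by
      rw [uIcc_of_le hd0.le, uIcc_of_le ht]; exact Icc_subset_Icc le_rfl htd
    have hsub2 : uIcc d t ⊆ uIcc 0 t := by
      rw [uIcc_of_le htd, uIcc_of_le ht]; exact Icc_subset_Icc hd0.le le_rfl
    rw [← intervalIntegral.integral_add_adjacent_intervals (hi.mono_set hsub1)
      (hi.mono_set hsub2)]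
    have e1 := norm_integral_le_of_le_rpow (F := F) (M := M) ha hd0.le
      (fun σ hσ => h1 σ ⟨hσ.1, hσ.2.trans htd⟩)
    have hne : (0 : ℝ) ∉ uIcc d t := by
      rw [uIcc_of_le htd]; intro h0; linarith [h0.1]
    have e3 : IntervalIntegrable (fun σ : ℝ => M * h * σ ^ (a - 1 - b)) volume d t :=
      (intervalIntegral.intervalIntegrable_rpow (Or.inr hne)).const_mul _
    have e2 : ‖∫ σ in d..t, F σ‖ ≤ 1 / (b - a) * M * d ^ a := by
      refine (intervalIntegral.norm_integral_le_of_norm_le htd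
        (Eventually.of_forall fun σ hσ => h2 σ ⟨hd0.trans hσ.1, hσ.2⟩) e3).trans ?_
      rw [intervalIntegral.integral_const_mul, integral_rpow (Or.inr ⟨by linarith, hne⟩)]
      have e4 : a - 1 - b + 1 = -(b - a) := by ring
      have e5 : h * d ^ (-(b - a)) = d ^ a := by
        conv_lhs => rw [← hdb]
        rw [← Real.rpow_add hd0]; congr 1; ring
      have e6 : 0 ≤ t ^ (-(b - a)) := Real.rpow_nonneg ht _
      rw [e4, div_neg, ← neg_div, neg_sub]
      calc M * h * ((d ^ (-(b - a)) - t ^ (-(b - a))) / (b - a))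
          ≤ M * h * (d ^ (-(b - a)) / (b - a)) := by gcongr; linarith
        _ = 1 / (b - a) * M * (h * d ^ (-(b - a))) := by ring
        _ = _ := by rw [e5]
    refine (norm_add_le _ _).trans ((add_le_add e1 e2).trans (le_of_eq ?_))
    ring

theorem norm_integral_le_of_le_exp {F : ℝ → E} {a M t γ : ℝ} (ha : 0 < a) (ht : 0 ≤ t)
    (hM : 0 ≤ M) (hγ : 0 < γ)
    (h1 : ∀ σ ∈ Ioc 0 t, ‖F σ‖ ≤ M * Real.exp (γ * (t - σ)) * σ ^ (a - 1)) :
    ‖∫ σ in (0 : ℝ)..t, F σ‖ ≤ Real.Gamma a * M * γ ^ (-a) * Real.exp (γ * t) := by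
  have h3 := Real.integral_rpow_mul_exp_neg_mul_Ioi ha hγ
  have h4 : IntegrableOn (fun σ : ℝ => σ ^ (a - 1) * Real.exp (-(γ * σ))) (Ioi 0) := by
    have hpos : 0 < (1 / γ) ^ a * Real.Gamma a :=
      mul_pos (Real.rpow_pos_of_pos (by positivity) _) (Real.Gamma_pos_of_pos ha)
    by_contra hcon
    rw [integral_undef hcon] at h3
    linarith
  have h5 : IntervalIntegrable (fun σ : ℝ => (M * Real.exp (γ * t)) *
      (σ ^ (a - 1) * Real.exp (-(γ * σ)))) volume 0 t := by
    refine IntervalIntegrable.const_mul ?_ _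
    rw [intervalIntegrable_iff_integrableOn_Ioc_of_le ht]
    exact h4.mono_set Ioc_subset_Ioi_self
  refine (intervalIntegral.norm_integral_le_of_norm_le ht
    (Eventually.of_forall fun σ hσ => (h1 σ hσ).trans (le_of_eq ?_)) h5).trans ?_
  · rw [mul_sub, sub_eq_add_neg, Real.exp_add]; ring
  · rw [intervalIntegral.integral_const_mul, intervalIntegral.integral_of_le ht]
    have h6 : ∫ σ in Ioc 0 t, σ ^ (a - 1) * Real.exp (-(γ * σ)) ≤
        ∫ σ in Ioi 0, σ ^ (a - 1) * Real.exp (-(γ * σ)) := by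
      refine setIntegral_mono_set h4 ?_ (LE.le.eventuallyLE Ioc_subset_Ioi_self)
      refine (ae_restrict_mem measurableSet_Ioi).mono fun σ hσ => ?_
      have : (0 : ℝ) < σ := hσ
      simp only [Pi.zero_apply]
      positivity
    rw [h3, one_div, Real.inv_rpow hγ.le, ← Real.rpow_neg hγ.le] at h6
    calc _ ≤ M * Real.exp (γ * t) * (γ ^ (-a) * Real.Gamma a) := by gcongr
      _ = _ := by ring

end Singular

section Weights
variable {n l : ℕ}

/-- Truncation to `[0, T]`. -/
def clamp (T t : ℝ) : ℝ := max 0 (min T t)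

theorem clamp_mem {T : ℝ} (hT : 0 ≤ T) (t : ℝ) : clamp T t ∈ Icc 0 T :=
  ⟨le_max_left _ _, max_le hT (min_le_left _ _)⟩

theorem clamp_eq {T t : ℝ} (ht : t ∈ Icc 0 T) : clamp T t = t := by
  rw [clamp, min_eq_right ht.2, max_eq_right ht.1]

theorem clamp_clamp {T : ℝ} (hT : 0 ≤ T) (t : ℝ) : clamp T (clamp T t) = clamp T t :=
  clamp_eq (clamp_mem hT t)

theorem continuous_clamp (T : ℝ) : Continuous (clamp T) := by
  unfold clamp; fun_prop

theorem abs_clamp_sub_le (T s t : ℝ) : |clamp T s - clamp T t| ≤ |s - t| := by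
  simp only [clamp, max_def, min_def]
  split_ifs <;> rw [abs_le] <;> constructor <;>
    cases abs_cases (s - t) <;> linarith

/-- Continuity together with a spatial Hölder bound, with exponential weight in time. -/
structure Wt (T α γ N : ℝ) (g : Vec n → ℝ → Vec l) : Prop where
  cont : Continuous fun p : Vec n × ℝ => g p.1 p.2
  clamped : ∀ x s, g x (clamp T s) = g x s
  sup : ∀ s ∈ Icc 0 T, ∀ x, ‖g x s‖ ≤ N * Real.exp (γ * s)
  hol : ∀ s ∈ Icc 0 T, ∀ x y, ‖g x s - g y s‖ ≤ N * Real.exp (γ * s) * ‖x - y‖ ^ α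

variable {T α γ N : ℝ} {g : Vec n → ℝ → Vec l}

theorem Wt.nonneg (hT : 0 ≤ T) (h : Wt T α γ N g) : 0 ≤ N := by
  have := (norm_nonneg _).trans (h.sup 0 ⟨le_rfl, hT⟩ 0)
  simpa using this

theorem Wt.mono {N' : ℝ} (h : Wt T α γ N g) (hN : N ≤ N') : Wt T α γ N' g where
  cont := h.cont
  clamped := h.clamped
  sup s hs x := (h.sup s hs x).trans (by gcongr)
  hol s hs x y := (h.hol s hs x y).trans (by
    have : 0 ≤ ‖x - y‖ ^ α := by positivity
    gcongr)

theorem Wt.bdd (hT : 0 ≤ T) (hγ : 0 ≤ γ) (h : Wt T α γ N g) (x : Vec n) (s : ℝ) :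
    ‖g x s‖ ≤ N * Real.exp (γ * T) := by
  rw [← h.clamped]
  have h0 := h.nonneg hT
  refine (h.sup _ (clamp_mem hT s) x).trans ?_
  have := (clamp_mem hT s).2
  gcongr

theorem Wt.unweight (hT : 0 ≤ T) (hγ : 0 ≤ γ) (h : Wt T α γ N g) :
    Wt T α 0 (N * Real.exp (γ * T)) g where
  cont := h.cont
  clamped := h.clamped
  sup s _ x := by simpa using h.bdd hT hγ x s
  hol s hs x y := (h.hol s hs x y).trans (by
    have h0 := h.nonneg hT
    have : 0 ≤ ‖x - y‖ ^ α := by positivity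
    rw [zero_mul, Real.exp_zero, mul_one]
    have := hs.2
    gcongr)

theorem Wt.cont_slice (h : Wt T α γ N g) (s : ℝ) : Continuous fun z => g z s :=
  h.cont.comp (by fun_prop : Continuous fun z : Vec n => (z, s))

theorem Wt.add {N' : ℝ} {g' : Vec n → ℝ → Vec l} (h : Wt T α γ N g) (h' : Wt T α γ N' g') :
    Wt T α γ (N + N') (fun x t => g x t + g' x t) where
  cont := h.cont.add h'.cont
  clamped x s := by rw [h.clamped, h'.clamped]
  sup s hs x := (norm_add_le _ _).trans ((add_le_add (h.sup s hs x) (h'.sup s hs x)).trans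
    (le_of_eq (by ring)))
  hol s hs x y := by
    rw [add_sub_add_comm]
    exact (norm_add_le _ _).trans ((add_le_add (h.hol s hs x y) (h'.hol s hs x y)).trans
      (le_of_eq (by ring)))

theorem Wt.const_smul (h : Wt T α γ N g) (c : ℝ) : Wt T α γ (|c| * N) (fun x t => c • g x t) where
  cont := h.cont.const_smul c
  clamped x s := by rw [h.clamped]
  sup s hs x := by
    rw [norm_smul, Real.norm_eq_abs, mul_assoc]
    have := h.sup s hs x
    gcongr
  hol s hs x y := by
    rw [← smul_sub, norm_smul, Real.norm_eq_abs, mul_assoc, mul_assoc, ← mul_assoc N]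
    have := h.hol s hs x y
    gcongr

end Weights

section Triangle
variable {E : Type*} [NormedAddCommGroup E] [NormedSpace ℝ E]

/-- Fubini on a triangle for an integrand with an integrable singularity on the diagonal. -/
theorem integral_triangle {Q : ℝ → ℝ → E} {a M t : ℝ} (ha : 0 < a) (ht : 0 ≤ t)
    (hQ : ContinuousOn (fun p : ℝ × ℝ => Q p.1 p.2) {p | 0 < p.1})
    (hM : ∀ σ ∈ Ioc 0 t, ∀ s ∈ Icc 0 t, ‖Q σ s‖ ≤ M * σ ^ (a - 1)) :
    ∫ τ in (0 : ℝ)..t, ∫ s in (0 : ℝ)..τ, Q (τ - s) s =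
      ∫ s in (0 : ℝ)..t, ∫ σ in (0 : ℝ)..(t - s), Q σ s := by
  let S : Set (ℝ × ℝ) := {p | 0 < p.2 ∧ p.2 < p.1 ∧ p.1 ≤ t}
  have hS : MeasurableSet S :=
    (measurableSet_lt measurable_const measurable_snd).inter
      ((measurableSet_lt measurable_snd measurable_fst).inter
        (measurableSet_le measurable_fst measurable_const))
  let H : ℝ → ℝ → E := fun τ s => S.indicator (fun p : ℝ × ℝ => Q (p.1 - p.2) p.2) (τ, s)
  let f₁ : ℝ → ℝ := (Ioc 0 t).indicator fun _ => M
  let f₂ : ℝ → ℝ := (Ioc 0 t).indicator fun σ => σ ^ (a - 1)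
  have hf₁ : Integrable f₁ volume := (integrable_indicator_iff measurableSet_Ioc).2
    (integrableOn_const (by simp))
  have hf₂ : Integrable f₂ volume := by
    refine (integrable_indicator_iff measurableSet_Ioc).2 ?_
    rw [← intervalIntegrable_iff_integrableOn_Ioc_of_le ht]
    exact intervalIntegral.intervalIntegrable_rpow' (by linarith)
  have hdom := hf₁.convolution_integrand (ContinuousLinearMap.mul ℝ ℝ) hf₂
  have hint : Integrable (Function.uncurry H) (volume.prod volume) := by
    refine hdom.mono' ?_ (Eventually.of_forall fun p => ?_)
    · have : ContinuousOn (fun p : ℝ × ℝ => Q (p.1 - p.2) p.2) S := by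
        refine hQ.comp (f := fun p : ℝ × ℝ => (p.1 - p.2, p.2))
          (by fun_prop : Continuous fun p : ℝ × ℝ => (p.1 - p.2, p.2)).continuousOn ?_
        rintro p ⟨-, h2, -⟩
        exact sub_pos.2 h2
      exact (aestronglyMeasurable_indicator_iff hS).2 (this.aestronglyMeasurable hS)
    · have h0 : Function.uncurry H p = S.indicator (fun p : ℝ × ℝ => Q (p.1 - p.2) p.2) p := rfl
      rw [h0]
      by_cases hp : p ∈ S
      · rw [indicator_of_mem hp]
        obtain ⟨h1, h2, h3⟩ := hp
        have e1 : p.1 - p.2 ∈ Ioc 0 t := ⟨by linarith, by linarith⟩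
        have e2 : p.2 ∈ Ioc 0 t := ⟨h1, by linarith⟩
        simp only [ContinuousLinearMap.mul_apply', f₁, f₂, indicator_of_mem e1,
          indicator_of_mem e2]
        exact hM _ e1 _ (Ioc_subset_Icc_self e2)
      · rw [indicator_of_notMem hp, norm_zero]
        simp only [ContinuousLinearMap.mul_apply', f₁, f₂]
        by_cases e1 : p.1 - p.2 ∈ Ioc 0 t
        · rw [indicator_of_mem e1]
          have hp1 : 0 ≤ (p.1 - p.2) ^ (a - 1) := Real.rpow_nonneg e1.1.le _
          have hMp : 0 ≤ M * (p.1 - p.2) ^ (a - 1) :=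
            (norm_nonneg _).trans (hM _ e1 0 ⟨le_rfl, ht⟩)
          by_cases e2 : p.2 ∈ Ioc 0 t
          · rw [indicator_of_mem e2]; exact hMp
          · rw [indicator_of_notMem e2, zero_mul]
        · rw [indicator_of_notMem e1, mul_zero]
  have hswap := integral_integral_swap hint
  have hL : ∫ τ in (0 : ℝ)..t, ∫ s in (0 : ℝ)..τ, Q (τ - s) s = ∫ τ, ∫ s, H τ s := by
    rw [intervalIntegral.integral_of_le ht, ← integral_indicator measurableSet_Ioc]
    congr 1; funext τ
    by_cases hτ : τ ∈ Ioc 0 t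
    · rw [indicator_of_mem hτ, intervalIntegral.integral_of_le hτ.1.le, integral_Ioc_eq_integral_Ioo,
        ← integral_indicator measurableSet_Ioo]
      congr 1; funext s
      by_cases hs : s ∈ Ioo 0 τ
      · rw [indicator_of_mem hs]
        exact (indicator_of_mem (show (τ, s) ∈ S from ⟨hs.1, hs.2, hτ.2⟩)
          fun p : ℝ × ℝ => Q (p.1 - p.2) p.2).symm
      · rw [indicator_of_notMem hs]
        exact (indicator_of_notMem (fun h : (τ, s) ∈ S => hs ⟨h.1, h.2.1⟩) _).symm
    · rw [indicator_of_notMem hτ]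
      have : ∀ s, H τ s = 0 := fun s =>
        indicator_of_notMem (fun h : (τ, s) ∈ S => hτ ⟨h.1.trans h.2.1, h.2.2⟩) _
      simp [this]
  have hR : ∫ s in (0 : ℝ)..t, ∫ σ in (0 : ℝ)..(t - s), Q σ s = ∫ s, ∫ τ, H τ s := by
    rw [intervalIntegral.integral_of_le ht, ← integral_indicator measurableSet_Ioc]
    congr 1; funext s
    by_cases hs : s ∈ Ioc 0 t
    · have h1 : ∫ σ in (0 : ℝ)..(t - s), Q σ s = ∫ τ in s..t, Q (τ - s) s := by
        rw [intervalIntegral.integral_comp_sub_right (fun σ => Q σ s) s, sub_self]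
      rw [indicator_of_mem hs, h1, intervalIntegral.integral_of_le hs.2,
        ← integral_indicator measurableSet_Ioc]
      congr 1; funext τ
      by_cases hτ : τ ∈ Ioc s t
      · rw [indicator_of_mem hτ]
        exact (indicator_of_mem (show (τ, s) ∈ S from ⟨hs.1, hτ.1, hτ.2⟩)
          fun p : ℝ × ℝ => Q (p.1 - p.2) p.2).symm
      · rw [indicator_of_notMem hτ]
        exact (indicator_of_notMem (fun h : (τ, s) ∈ S => hτ ⟨h.2.1, h.2.2⟩) _).symm
    · rw [indicator_of_notMem hs]
      have : ∀ τ, H τ s = 0 := fun τ =>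
        indicator_of_notMem (fun h : (τ, s) ∈ S => hs ⟨h.1, h.2.1.le.trans h.2.2⟩) _
      simp [this]
  rw [hL, hR, hswap]

end Triangle

section HeatEst
variable {n l r : ℕ}

theorem exists_uniform (r : ℕ) {P : ∀ k, (Fin k → Fin n) → ℝ → Prop}
    (hmono : ∀ k I C C', C ≤ C' → 0 ≤ C → P k I C → P k I C')
    (h : ∀ k, k ≤ r → ∀ I, ∃ C, 0 ≤ C ∧ P k I C) : ∃ C, 0 ≤ C ∧ ∀ k, k ≤ r → ∀ I, P k I C := by
  have h' : ∀ k, ∀ I : Fin k → Fin n, ∃ C, 0 ≤ C ∧ (k ≤ r → P k I C) := by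
    intro k I
    by_cases hk : k ≤ r
    · obtain ⟨C, h1, h2⟩ := h k hk I
      exact ⟨C, h1, fun _ => h2⟩
    · exact ⟨0, le_rfl, fun h => absurd h hk⟩
  choose C hC0 hC using h'
  refine ⟨∑ k ∈ Finset.range (r + 1), ∑ I, C k I,
    Finset.sum_nonneg fun k _ => Finset.sum_nonneg fun I _ => hC0 k I, fun k hk I => ?_⟩
  refine hmono k I (C k I) _ ?_ (hC0 k I) (hC k I hk)
  refine (Finset.single_le_sum (f := C k) (fun I _ => hC0 k I) (Finset.mem_univ I)).trans ?_
  exact Finset.single_le_sum (f := fun k => ∑ I, C k I)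
    (fun k _ => Finset.sum_nonneg fun I _ => hC0 k I) (Finset.mem_range.2 (by omega))

/-- Estimates for the heat semigroup, uniform in the order `k ≤ r` of differentiation. -/
structure HeatEst (r : ℕ) (α T C : ℝ) (K : 𝓢(Vec n, Mat l)) : Prop where
  nonneg : 0 ≤ C
  size : ∀ k, k ≤ r → ∀ I : Fin k → Fin n, ∀ (g : Vec n → Vec l) (N : ℝ), Continuous g →
    (∀ z, ‖g z‖ ≤ N) → (∀ y z, ‖g y - g z‖ ≤ N * ‖y - z‖ ^ α) → ∀ σ, 0 < σ → σ ≤ T → ∀ x,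
    ‖heat r K I σ g x‖ ≤ C * N * σ ^ (α / r - 1)
  lip : ∀ k, k ≤ r → ∀ I : Fin k → Fin n, ∀ (g : Vec n → Vec l) (N : ℝ), Continuous g →
    (∀ z, ‖g z‖ ≤ N) → (∀ y z, ‖g y - g z‖ ≤ N * ‖y - z‖ ^ α) → ∀ σ, 0 < σ → σ ≤ T → ∀ x y,
    ‖heat r K I σ g x - heat r K I σ g y‖ ≤ C * N * ‖x - y‖ * σ ^ (α / r - 1 - (r : ℝ)⁻¹)
  time : ∀ k, k ≤ r → ∀ I : Fin k → Fin n, ∀ (g : Vec n → Vec l) (N : ℝ), Continuous g →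
    (∀ z, ‖g z‖ ≤ N) → (∀ y z, ‖g y - g z‖ ≤ N * ‖y - z‖ ^ α) → ∀ σ h, 0 < σ → 0 ≤ h →
    σ + h ≤ T → ∀ x, ‖heat r K I (σ + h) g x - heat r K I σ g x‖ ≤ C * N * h * σ ^ (α / r - 2)

variable {α T : ℝ}

theorem exists_heatEst (hα0 : 0 < α) (hα1 : α < 1) (hr : 2 ≤ r) (hT : 0 ≤ T)
    (K : 𝓢(Vec n, Mat l)) : ∃ C, HeatEst r α T C K := by
  have hr0 : (0 : ℝ) < r := by positivity
  have har : α / r < 1 := by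
    rw [div_lt_one hr0]; have : (1 : ℝ) ≤ r := by exact_mod_cast (by omega : 1 ≤ r)
    linarith
  have key : ∀ {C C' N q : ℝ} {g : Vec n → Vec l}, C ≤ C' → (∀ z, ‖g z‖ ≤ N) → 0 ≤ q →
      C * N * q ≤ C' * N * q := by
    intro C C' N q g h hN hq
    have : 0 ≤ N := (norm_nonneg _).trans (hN 0)
    gcongr
  obtain ⟨C₁, h01, h1⟩ := exists_uniform r (n := n) (P := fun k I C =>
    ∀ (g : Vec n → Vec l) (N : ℝ), Continuous g →
      (∀ z, ‖g z‖ ≤ N) → (∀ y z, ‖g y - g z‖ ≤ N * ‖y - z‖ ^ α) → ∀ σ, 0 < σ → σ ≤ T → ∀ x,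
      ‖heat r K I σ g x‖ ≤ C * N * σ ^ (α / r - 1))
    (fun k I C C' h _ hC g N hg hN hH σ hσ hσT x => (hC g N hg hN hH σ hσ hσT x).trans
      (key h hN (by positivity)))
    (fun k hk I => norm_heat_le hα0.le hα1 hr hT K hk I)
  obtain ⟨C₂, h02, h2⟩ := exists_uniform r (n := n) (P := fun k I C =>
    ∀ i, ∀ (g : Vec n → Vec l) (N : ℝ), Continuous g →
      (∀ z, ‖g z‖ ≤ N) → (∀ y z, ‖g y - g z‖ ≤ N * ‖y - z‖ ^ α) → ∀ σ, 0 < σ → σ ≤ T → ∀ x,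
      ‖heat r K (Fin.cons i I : Fin (k + 1) → Fin n) σ g x‖ ≤
        C * N * σ ^ (α / r - 1 - (r : ℝ)⁻¹))
    (fun k I C C' h _ hC i g N hg hN hH σ hσ hσT x => (hC i g N hg hN hH σ hσ hσT x).trans
      (key h hN (by positivity)))
    (fun k hk I => by
      choose C h0 h using fun i => norm_heat_succ_le hα0.le hα1 hr hT K hk
        (Fin.cons i I : Fin (k + 1) → Fin n)
      refine ⟨∑ i, C i, Finset.sum_nonneg fun i _ => h0 i, ?_⟩
      intro i g N hg hN hH σ hσ hσT x
      refine (h i g N hg hN hH σ hσ hσT x).trans (key ?_ hN (by positivity))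
      exact Finset.single_le_sum (f := C) (fun i _ => h0 i) (Finset.mem_univ i))
  obtain ⟨C₃, h03, h3⟩ := exists_uniform r (n := n) (P := fun k I C =>
    ∀ (g : Vec n → Vec l) (N : ℝ), Continuous g →
      (∀ z, ‖g z‖ ≤ N) → (∀ y z, ‖g y - g z‖ ≤ N * ‖y - z‖ ^ α) → ∀ σ, 0 < σ → σ ≤ T → ∀ x,
      ‖deriv (fun σ => heat r K I σ g x) σ‖ ≤ C * N * σ ^ (α / r - 2))
    (fun k I C C' h _ hC g N hg hN hH σ hσ hσT x => (hC g N hg hN hH σ hσ hσT x).trans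
      (key h hN (by positivity)))
    (fun k hk I => norm_deriv_heat_le hα0.le hα1 hr hT K hk I)
  refine ⟨C₁ + n * C₂ + C₃, by positivity, ?_, ?_, ?_⟩
  · intro k hk I g N hg hN hH σ hσ hσT x
    refine (h1 k hk I g N hg hN hH σ hσ hσT x).trans (key ?_ hN (by positivity))
    linarith [show 0 ≤ n * C₂ by positivity]
  · intro k hk I g N hg hN hH σ hσ hσT x y
    have hb : ∀ z ∈ (univ : Set (Vec n)),
        ‖grad fun i => heat r K (Fin.cons i I : Fin (k + 1) → Fin n) σ g z‖ ≤
          n * (C₂ * N * σ ^ (α / r - 1 - (r : ℝ)⁻¹)) := fun z _ =>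
      norm_grad_le fun i => h2 k hk I i g N hg hN hH σ hσ hσT z
    refine (convex_univ.norm_image_sub_le_of_norm_hasFDerivWithin_le
      (fun z _ => (hasFDerivAt_heat hσ hg hN z).hasFDerivWithinAt) hb (mem_univ y)
      (mem_univ x)).trans ?_
    calc n * (C₂ * N * σ ^ (α / r - 1 - (r : ℝ)⁻¹)) * ‖x - y‖
        = n * C₂ * N * (‖x - y‖ * σ ^ (α / r - 1 - (r : ℝ)⁻¹)) := by ring
      _ ≤ (C₁ + n * C₂ + C₃) * N * (‖x - y‖ * σ ^ (α / r - 1 - (r : ℝ)⁻¹)) :=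
        key (by linarith) hN (by positivity)
      _ = _ := by ring
  · intro k hk I g N hg hN hH σ h hσ hh hσT x
    have hN0 : 0 ≤ N := (norm_nonneg _).trans (hN 0)
    have hd : ∀ s ∈ Icc σ (σ + h), HasDerivWithinAt (fun σ => heat r K I σ g x)
        (deriv (fun σ => heat r K I σ g x) s) (Icc σ (σ + h)) s := fun s hs =>
      (hasDerivAt_heat (hσ.trans_le hs.1) hg hN x).differentiableAt.hasDerivAt.hasDerivWithinAt
    have hb : ∀ s ∈ Ico σ (σ + h), ‖deriv (fun σ => heat r K I σ g x) s‖ ≤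
        C₃ * N * σ ^ (α / r - 2) := fun s hs => by
      refine (h3 k hk I g N hg hN hH s (hσ.trans_le hs.1) (hs.2.le.trans hσT) x).trans ?_
      gcongr ?_ * ?_
      exact Real.rpow_le_rpow_of_nonpos hσ hs.1 (by linarith)
    refine (norm_image_sub_le_of_norm_deriv_le_segment' hd hb (σ + h)
      ⟨by linarith, le_rfl⟩).trans ?_
    calc C₃ * N * σ ^ (α / r - 2) * (σ + h - σ) = C₃ * N * (h * σ ^ (α / r - 2)) := by ring
      _ ≤ (C₁ + n * C₂ + C₃) * N * (h * σ ^ (α / r - 2)) :=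
        key (by linarith [show 0 ≤ n * C₂ by positivity]) hN (by positivity)
      _ = _ := by ring

end HeatEst

section Duhamel
variable {n l r : ℕ}

/-- Spatial derivatives of the Duhamel integral with kernel `K`. -/
def duh (r : ℕ) (K : 𝓢(Vec n, Mat l)) {k : ℕ} (I : Fin k → Fin n) (g : Vec n → ℝ → Vec l)
    (x : Vec n) (t : ℝ) : Vec l :=
  ∫ σ in (0 : ℝ)..t, heat r K I σ (fun z => g z (t - σ)) x

variable {α T γ N C : ℝ} {K : 𝓢(Vec n, Mat l)} {g : Vec n → ℝ → Vec l} {k : ℕ}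
  {I : Fin k → Fin n}

theorem continuousOn_heat_slice (hT : 0 ≤ T) (hγ : 0 ≤ γ) (h : Wt T α γ N g) (x : Vec n) (c : ℝ)
    (K : 𝓢(Vec n, Mat l)) (I : Fin k → Fin n) :
    ContinuousOn (fun σ => heat r K I σ (fun z => g z (c - σ)) x) (Ioi 0) :=
  continuousOn_heat (X := ℝ) (G := fun σ z => g z (c - σ)) (s := fun σ => σ) (p := fun _ => x)
    (h.cont.comp (by fun_prop : Continuous fun q : ℝ × Vec n => (q.2, c - q.1)))
    (fun a z => h.bdd hT hγ z _) continuous_id continuous_const K I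

theorem continuousOn_heat_time (hT : 0 ≤ T) (hγ : 0 ≤ γ) (h : Wt T α γ N g) (x : Vec n)
    (K : 𝓢(Vec n, Mat l)) (I : Fin k → Fin n) :
    ContinuousOn (fun p : ℝ × ℝ => heat r K I p.1 (fun z => g z p.2) x) {p | 0 < p.1} :=
  continuousOn_heat (X := ℝ × ℝ) (G := fun p z => g z p.2) (s := fun p => p.1) (p := fun _ => x)
    (h.cont.comp (by fun_prop : Continuous fun q : (ℝ × ℝ) × Vec n => (q.2, q.1.2)))
    (fun a z => h.bdd hT hγ z _) continuous_fst continuous_const K I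

theorem Wt.size_le (hE : HeatEst r α T C K) (h : Wt T α γ N g) (hk : k ≤ r) {s σ : ℝ}
    (hs : s ∈ Icc 0 T) (hσ : 0 < σ) (hσT : σ ≤ T) (x : Vec n) :
    ‖heat r K I σ (fun z => g z s) x‖ ≤ C * N * Real.exp (γ * s) * σ ^ (α / r - 1) := by
  refine (hE.size k hk I _ (N * Real.exp (γ * s)) (h.cont_slice s) (h.sup s hs) (h.hol s hs) σ hσ
    hσT x).trans (le_of_eq (by ring))

theorem Wt.intervalIntegrable (hE : HeatEst r α T C K) (hr : 2 ≤ r) (hα0 : 0 < α) (hγ : 0 ≤ γ)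
    (h : Wt T α γ N g) (hk : k ≤ r) {t : ℝ} (ht : t ∈ Icc 0 T) (x : Vec n) :
    IntervalIntegrable (fun σ => heat r K I σ (fun z => g z (t - σ)) x) volume 0 t := by
  have hT : 0 ≤ T := ht.1.trans ht.2
  have hr0 : (0 : ℝ) < r := by positivity
  refine intervalIntegrable_of_le_rpow (a := α / r) (M := C * N * Real.exp (γ * T))
    (by positivity) ht.1
    ((continuousOn_heat_slice hT hγ h x t K I).mono Ioc_subset_Ioi_self) fun σ hσ => ?_
  refine (h.size_le hE hk ⟨by linarith [hσ.2], by linarith [hσ.1, ht.2]⟩ hσ.1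
    (hσ.2.trans ht.2) x).trans ?_
  have := h.nonneg hT
  have := hE.nonneg
  have := hσ.1
  have := Real.rpow_nonneg hσ.1.le (α / r - 1)
  gcongr
  linarith [ht.2]

theorem norm_duh_le (hE : HeatEst r α T C K) (hr : 2 ≤ r) (hα0 : 0 < α) (hγ : 0 < γ)
    (h : Wt T α γ N g) (hk : k ≤ r) (I : Fin k → Fin n) {t : ℝ} (ht : t ∈ Icc 0 T) (x : Vec n) :
    ‖duh r K I g x t‖ ≤ Real.Gamma (α / r) * C * N * γ ^ (-(α / r)) * Real.exp (γ * t) := by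
  have hT : 0 ≤ T := ht.1.trans ht.2
  have hr0 : (0 : ℝ) < r := by positivity
  have := norm_integral_le_of_le_exp (F := fun σ => heat r K I σ (fun z => g z (t - σ)) x)
    (a := α / r) (M := C * N) (by positivity) ht.1 (mul_nonneg hE.nonneg (h.nonneg hT)) hγ
    fun σ hσ => h.size_le hE hk ⟨by linarith [hσ.2], by linarith [hσ.1, ht.2]⟩ hσ.1
      (hσ.2.trans ht.2) x
  refine this.trans (le_of_eq (by ring))

theorem norm_duh_sub_le (hE : HeatEst r α T C K) (hr : 2 ≤ r) (hα0 : 0 < α) (hα1 : α < 1)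
    (hγ : 0 ≤ γ) (h : Wt T α γ N g) (hk : k ≤ r) (I : Fin k → Fin n) {t : ℝ} (ht : t ∈ Icc 0 T)
    (x y : Vec n) : ‖duh r K I g x t - duh r K I g y t‖ ≤
      (r / α + r / (1 - α)) * (2 * C) * N * Real.exp (γ * t) * ‖x - y‖ ^ α := by
  have hT : 0 ≤ T := ht.1.trans ht.2
  have hr0 : (0 : ℝ) < r := by positivity
  have hN := h.nonneg hT
  have hC := hE.nonneg
  have hmem : ∀ σ ∈ Ioc 0 t, t - σ ∈ Icc 0 T := fun σ hσ =>
    ⟨by linarith [hσ.2], by linarith [hσ.1, ht.2]⟩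
  rw [duh, duh, ← intervalIntegral.integral_sub (h.intervalIntegrable hE hr hα0 hγ hk ht x)
    (h.intervalIntegrable hE hr hα0 hγ hk ht y)]
  refine (norm_integral_le_of_le_min (a := α / r) (b := (r : ℝ)⁻¹) (h := ‖x - y‖)
    (M := 2 * C * N * Real.exp (γ * t)) (by positivity) ?_ (norm_nonneg _) (by positivity) ht.1
    (((continuousOn_heat_slice hT hγ h x t K I).sub
      (continuousOn_heat_slice hT hγ h y t K I)).mono Ioc_subset_Ioi_self) ?_ ?_).trans
    (le_of_eq ?_)
  · rw [div_eq_mul_inv]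
    exact mul_lt_of_lt_one_left (by positivity) hα1
  · intro σ hσ
    have h0 : 0 ≤ σ ^ (α / r - 1) := Real.rpow_nonneg hσ.1.le _
    have h1 := h.size_le (I := I) hE hk (hmem σ hσ) hσ.1 (hσ.2.trans ht.2) x
    have h2 := h.size_le (I := I) hE hk (hmem σ hσ) hσ.1 (hσ.2.trans ht.2) y
    refine (norm_sub_le _ _).trans ((add_le_add h1 h2).trans ?_)
    calc _ = 2 * C * N * Real.exp (γ * (t - σ)) * σ ^ (α / r - 1) := by ring
      _ ≤ _ := by gcongr; linarith [hσ.1]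
  · intro σ hσ
    have h0 : 0 ≤ σ ^ (α / r - 1 - (r : ℝ)⁻¹) := Real.rpow_nonneg hσ.1.le _
    refine (hE.lip k hk I _ (N * Real.exp (γ * (t - σ))) (h.cont_slice _) (h.sup _ (hmem σ hσ))
      (h.hol _ (hmem σ hσ)) σ hσ.1 (hσ.2.trans ht.2) x y).trans ?_
    calc C * (N * Real.exp (γ * (t - σ))) * ‖x - y‖ * σ ^ (α / r - 1 - (r : ℝ)⁻¹)
        ≤ C * (N * Real.exp (γ * t)) * ‖x - y‖ * σ ^ (α / r - 1 - (r : ℝ)⁻¹) := by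
          gcongr; linarith [hσ.1]
      _ ≤ 2 * (C * (N * Real.exp (γ * t)) * ‖x - y‖ * σ ^ (α / r - 1 - (r : ℝ)⁻¹)) := by
          have : 0 ≤ C * (N * Real.exp (γ * t)) * ‖x - y‖ * σ ^ (α / r - 1 - (r : ℝ)⁻¹) := by
            positivity
          linarith
      _ = _ := by ring
  · have e1 : α / r / (r : ℝ)⁻¹ = α := by field_simp
    have e2 : 1 - α ≠ 0 := by linarith
    have e3 : 1 / ((r : ℝ)⁻¹ - α / r) = r / (1 - α) := by
      rw [show (r : ℝ)⁻¹ - α / r = (1 - α) / r by ring, one_div_div]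
    rw [e1, e3, one_div_div]; ring

theorem norm_duh_time_sub_le (hE : HeatEst r α T C K) (hr : 2 ≤ r) (hα0 : 0 < α) (hα1 : α < 1)
    (h : Wt T α 0 N g) (hk : k ≤ r) (I : Fin k → Fin n) {t t' : ℝ} (ht : t ∈ Icc 0 T)
    (ht' : t' ∈ Icc 0 T) (x : Vec n) : ‖duh r K I g x t - duh r K I g x t'‖ ≤
      (r / α + (r / α + 1 / (1 - α / r)) * 2) * C * N * |t - t'| ^ (α / r) := by
  have hT : 0 ≤ T := ht.1.trans ht.2
  have hr0 : (0 : ℝ) < r := by positivity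
  have har : α / r < 1 := by
    rw [div_lt_one hr0]; have : (1 : ℝ) ≤ r := by exact_mod_cast (by omega : 1 ≤ r)
    linarith
  have ha : 0 < α / r := by positivity
  have hN := h.nonneg hT
  have hC := hE.nonneg
  wlog htt : t' ≤ t generalizing t t'
  · rw [norm_sub_rev, abs_sub_comm]
    exact this ht' ht (not_le.1 htt).le
  obtain ⟨d, rfl⟩ : ∃ d, t = t' + d := ⟨t - t', by ring⟩
  have hd : 0 ≤ d := by linarith
  have hsz : ∀ s ∈ Icc 0 T, ∀ σ, 0 < σ → σ ≤ T →
      ‖heat r K I σ (fun z => g z s) x‖ ≤ C * N * σ ^ (α / r - 1) := fun s hs σ h1 h2 => by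
    simpa using h.size_le (I := I) hE hk hs h1 h2 x
  have hi := h.intervalIntegrable (I := I) hE hr hα0 le_rfl hk ht x
  have hi' := h.intervalIntegrable (I := I) hE hr hα0 le_rfl hk ht' x
  have hs1 : uIcc 0 d ⊆ uIcc 0 (t' + d) := by
    rw [uIcc_of_le hd, uIcc_of_le ht.1]; exact Icc_subset_Icc le_rfl (by linarith [ht'.1])
  have hs2 : uIcc d (t' + d) ⊆ uIcc 0 (t' + d) := by
    rw [uIcc_of_le (by linarith [ht'.1]), uIcc_of_le ht.1]; exact Icc_subset_Icc hd le_rfl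
  have hshift : ∫ σ in d..(t' + d), heat r K I σ (fun z => g z (t' + d - σ)) x =
      ∫ σ in (0 : ℝ)..t', heat r K I (σ + d) (fun z => g z (t' - σ)) x := by
    have := intervalIntegral.integral_comp_add_right (a := 0) (b := t')
      (fun σ => heat r K I σ (fun z => g z (t' + d - σ)) x) d
    rw [zero_add] at this
    rw [← this]
    simp only [add_sub_add_right_eq_sub]
  have hcs : ContinuousOn (fun σ => heat r K I (σ + d) (fun z => g z (t' - σ)) x) (Ioi 0) := by
    have h1 := continuousOn_heat_slice (r := r) hT le_rfl h x (t' + d) K I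
    have h2 := h1.comp (f := fun σ : ℝ => σ + d) (s := Ioi 0) (by fun_prop)
      (fun σ hσ => add_pos_of_pos_of_nonneg hσ hd)
    refine h2.congr fun σ _ => ?_
    simp only [Function.comp, add_sub_add_right_eq_sub]
  have hish : IntervalIntegrable (fun σ => heat r K I (σ + d) (fun z => g z (t' - σ)) x)
      volume 0 t' := by
    refine intervalIntegrable_of_le_rpow (a := α / r) (M := C * N) ha ht'.1
      (hcs.mono Ioc_subset_Ioi_self) fun σ hσ => ?_
    refine (hsz _ ⟨by linarith [hσ.2], by linarith [hσ.1, ht'.2]⟩ (σ + d)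
      (add_pos_of_pos_of_nonneg hσ.1 hd) (by linarith [hσ.2, ht.2])).trans ?_
    gcongr ?_ * ?_
    exact Real.rpow_le_rpow_of_nonpos hσ.1 (by linarith) (by linarith)
  have e : duh r K I g x (t' + d) - duh r K I g x t' =
      (∫ σ in (0 : ℝ)..d, heat r K I σ (fun z => g z (t' + d - σ)) x) +
      ∫ σ in (0 : ℝ)..t', (heat r K I (σ + d) (fun z => g z (t' - σ)) x -
        heat r K I σ (fun z => g z (t' - σ)) x) := by
    rw [intervalIntegral.integral_sub hish hi', ← hshift, duh, duh,
      ← intervalIntegral.integral_add_adjacent_intervals (hi.mono_set hs1) (hi.mono_set hs2)]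
    abel
  have b1 : ‖∫ σ in (0 : ℝ)..d, heat r K I σ (fun z => g z (t' + d - σ)) x‖ ≤
      C * N * (d ^ (α / r) / (α / r)) :=
    norm_integral_le_of_le_rpow ha hd fun σ hσ => hsz _
      ⟨by linarith [hσ.2, ht'.1], by linarith [hσ.1, ht.2]⟩ σ hσ.1 (by linarith [hσ.2, ht'.1, ht.2])
  have b2 := norm_integral_le_of_le_min (a := α / r) (b := 1) (h := d) (M := 2 * C * N) (t := t')
    (F := fun σ => heat r K I (σ + d) (fun z => g z (t' - σ)) x -
        heat r K I σ (fun z => g z (t' - σ)) x) ha har hd (by positivity) ht'.1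
    ((hcs.sub (continuousOn_heat_slice hT le_rfl h x t' K I)).mono Ioc_subset_Ioi_self)
    (fun σ hσ => by
      have hm : t' - σ ∈ Icc 0 T := ⟨by linarith [hσ.2], by linarith [hσ.1, ht'.2]⟩
      have h1 := hsz _ hm (σ + d) (add_pos_of_pos_of_nonneg hσ.1 hd) (by linarith [hσ.2, ht.2])
      have h2 := hsz _ hm σ hσ.1 (by linarith [hσ.2, ht'.2])
      have h3 : (σ + d) ^ (α / r - 1) ≤ σ ^ (α / r - 1) :=
        Real.rpow_le_rpow_of_nonpos hσ.1 (by linarith) (by linarith)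
      have h4 : C * N * (σ + d) ^ (α / r - 1) ≤ C * N * σ ^ (α / r - 1) := by gcongr
      exact (norm_sub_le _ _).trans ((add_le_add h1 h2).trans (by linarith)))
    (fun σ hσ => by
      have hm : t' - σ ∈ Icc 0 T := ⟨by linarith [hσ.2], by linarith [hσ.1, ht'.2]⟩
      have h1 := hE.time k hk I _ N (h.cont_slice (t' - σ)) (by simpa using h.sup _ hm)
        (by simpa using h.hol _ hm) σ d hσ.1 hd (by linarith [hσ.2, ht.2]) x
      refine h1.trans ?_
      rw [show α / r - 1 - 1 = α / r - 2 by ring]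
      have : 0 ≤ C * N * d * σ ^ (α / r - 2) := by
        have := hσ.1; positivity
      linarith)
  rw [div_one] at b2
  rw [e, add_sub_cancel_left, abs_of_nonneg hd]
  refine (norm_add_le _ _).trans ((add_le_add b1 b2).trans (le_of_eq ?_))
  rw [one_div_div]
  field_simp

theorem hasFDerivAt_duh (hE : HeatEst r α T C K) (hr : 2 ≤ r) (hα0 : 0 < α) (hγ : 0 ≤ γ)
    (h : Wt T α γ N g) (hk : k < r) (I : Fin k → Fin n) {t : ℝ} (ht : t ∈ Icc 0 T) (x : Vec n) :
    HasFDerivAt (fun x => duh r K I g x t)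
      (grad fun i => duh r K (Fin.cons i I : Fin (k + 1) → Fin n) g x t) x := by
  have hT : 0 ≤ T := ht.1.trans ht.2
  have hr0 : (0 : ℝ) < r := by positivity
  have hN := h.nonneg hT
  have hC := hE.nonneg
  have hbd : ∀ s z, ‖g z s‖ ≤ N * Real.exp (γ * T) := fun s z => h.bdd hT hγ z s
  have hsub : uIoc 0 t = Ioc 0 t := uIoc_of_le ht.1
  have hgc : ContinuousOn (fun σ => grad fun i =>
      heat r K (Fin.cons i I : Fin (k + 1) → Fin n) σ (fun z => g z (t - σ)) x) (Ioi 0) := by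
    unfold grad
    refine continuousOn_finsetSum _ fun i _ => ?_
    exact ((ContinuousLinearMap.smulRightL ℝ (Vec n) (Vec l) (EuclideanSpace.proj i)).continuous.comp_continuousOn
      (continuousOn_heat_slice hT hγ h x t K _))
  have hb : ∀ σ ∈ Ioc 0 t, ∀ z, ‖grad fun i => heat r K (Fin.cons i I : Fin (k + 1) → Fin n) σ
      (fun z => g z (t - σ)) z‖ ≤ n * (C * N * Real.exp (γ * T)) * σ ^ (α / r - 1) := by
    intro σ hσ z
    rw [mul_assoc]
    refine norm_grad_le fun i => ?_
    refine (h.size_le hE hk ⟨by linarith [hσ.2], by linarith [hσ.1, ht.2]⟩ hσ.1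
      (hσ.2.trans ht.2) z).trans ?_
    have := Real.rpow_nonneg hσ.1.le (α / r - 1)
    have := hσ.1
    gcongr
    linarith [ht.2]
  have key := intervalIntegral.hasFDerivAt_integral_of_dominated_of_fderiv_le (𝕜 := ℝ)
    (μ := volume) (a := 0) (b := t) (s := univ) (x₀ := x)
    (F := fun x σ => heat r K I σ (fun z => g z (t - σ)) x)
    (F' := fun x σ => grad fun i => heat r K (Fin.cons i I : Fin (k + 1) → Fin n) σ
      (fun z => g z (t - σ)) x)
    (bound := fun σ => n * (C * N * Real.exp (γ * T)) * σ ^ (α / r - 1)) univ_mem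
    (Eventually.of_forall fun z =>
      (h.intervalIntegrable hE hr hα0 hγ hk.le ht z).def'.aestronglyMeasurable)
    (h.intervalIntegrable hE hr hα0 hγ hk.le ht x)
    (by rw [hsub]
        exact (hgc.mono Ioc_subset_Ioi_self).aestronglyMeasurable measurableSet_Ioc)
    (Eventually.of_forall fun σ hσ z _ => hb σ (hsub ▸ hσ) z)
    ((intervalIntegral.intervalIntegrable_rpow'
      (by have : 0 < α / r := by positivity
          linarith)).const_mul _)
    (Eventually.of_forall fun σ hσ z _ =>
      hasFDerivAt_heat (hsub ▸ hσ).1 (h.cont_slice _) (hbd _) z)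
  refine key.congr_fderiv ?_
  have hint : IntervalIntegrable (fun σ => grad fun i =>
      heat r K (Fin.cons i I : Fin (k + 1) → Fin n) σ (fun z => g z (t - σ)) x) volume 0 t :=
    intervalIntegrable_of_le_rpow (a := α / r) (by positivity) ht.1
      (hgc.mono Ioc_subset_Ioi_self) fun σ hσ => hb σ hσ x
  rw [eq_grad (∫ σ in (0 : ℝ)..t, _)]
  congr 1; funext i
  rw [ContinuousLinearMap.intervalIntegral_apply hint]
  simp only [grad_ee]
  rfl

end Duhamel

section DuhamelEq
variable {n l r : ℕ}
variable {α T γ N C : ℝ} {K : 𝓢(Vec n, Mat l)} {g : Vec n → ℝ → Vec l} {k : ℕ}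
  {I : Fin k → Fin n} {A : (Fin r → Fin n) → Mat l}

theorem continuous_duh_clamp (hE : HeatEst r α T C K) (hr : 2 ≤ r) (hα0 : 0 < α) (hα1 : α < 1)
    (hT : 0 ≤ T) (hγ : 0 ≤ γ) (h : Wt T α γ N g) (hk : k ≤ r) (I : Fin k → Fin n) :
    Continuous fun p : Vec n × ℝ => duh r K I g p.1 (clamp T p.2) := by
  have hr0 : (0 : ℝ) < r := by positivity
  have h0 := h.unweight hT hγ
  set N' := N * Real.exp (γ * T)
  rw [continuous_iff_continuousAt]
  rintro ⟨x, t⟩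
  obtain ⟨C₁, hC₁⟩ : ∃ C₁, ∀ y z : Vec n, ∀ s : ℝ, ‖duh r K I g y (clamp T s) -
      duh r K I g z (clamp T s)‖ ≤ C₁ * ‖y - z‖ ^ α :=
    ⟨_, fun y z s => by
      simpa using norm_duh_sub_le hE hr hα0 hα1 le_rfl h0 hk I (clamp_mem hT s) y z⟩
  obtain ⟨C₂, hC₂⟩ : ∃ C₂, ∀ z : Vec n, ∀ s s' : ℝ, ‖duh r K I g z (clamp T s) -
      duh r K I g z (clamp T s')‖ ≤ C₂ * |clamp T s - clamp T s'| ^ (α / r) :=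
    ⟨_, fun z s s' => norm_duh_time_sub_le hE hr hα0 hα1 h0 hk I (clamp_mem hT s)
      (clamp_mem hT s') z⟩
  rw [ContinuousAt, tendsto_iff_norm_sub_tendsto_zero]
  have hlim : Tendsto (fun p : Vec n × ℝ => C₁ * ‖p.1 - x‖ ^ α +
      C₂ * |clamp T p.2 - clamp T t| ^ (α / r)) (𝓝 (x, t)) (𝓝 0) := by
    have hc : Continuous fun p : Vec n × ℝ => C₁ * ‖p.1 - x‖ ^ α +
        C₂ * |clamp T p.2 - clamp T t| ^ (α / r) := by
      refine (continuous_const.mul ?_).add (continuous_const.mul ?_)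
      · exact (by fun_prop : Continuous fun p : Vec n × ℝ => ‖p.1 - x‖).rpow_const
          fun _ => Or.inr hα0.le
      · refine Continuous.rpow_const ?_ fun _ => Or.inr (by positivity)
        exact (((continuous_clamp T).comp continuous_snd).sub continuous_const).abs
    have := hc.tendsto (x, t)
    simp only [sub_self, norm_zero, abs_zero] at this
    rwa [Real.zero_rpow hα0.ne', Real.zero_rpow (by positivity), mul_zero, mul_zero,
      add_zero] at this
  refine squeeze_zero (fun _ => norm_nonneg _) (fun p => ?_) hlim
  calc _ = ‖(duh r K I g p.1 (clamp T p.2) - duh r K I g x (clamp T p.2)) +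
        (duh r K I g x (clamp T p.2) - duh r K I g x (clamp T t))‖ := by rw [sub_add_sub_cancel]
    _ ≤ _ := (norm_add_le _ _).trans (add_le_add (hC₁ _ _ _) (hC₂ _ _ _))

theorem duh_eq_integral (hK : IsKer r A K) (hE : HeatEst r α T C K) (hr : 2 ≤ r) (hα0 : 0 < α)
    (hα1 : α < 1) (hγ : 0 ≤ γ) (h : Wt T α γ N g) (I₀ : Fin 0 → Fin n) {t : ℝ} (ht : t ∈ Icc 0 T)
    (x : Vec n) : duh r K I₀ g x t =
      ∫ τ in (0 : ℝ)..t, (∑ I, A I (duh r K I g x (clamp T τ)) + g x τ) := by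
  have hT : 0 ≤ T := ht.1.trans ht.2
  have hr0 : (0 : ℝ) < r := by positivity
  have ha : 0 < α / r := by positivity
  have hN := h.nonneg hT
  have hC := hE.nonneg
  let Q : ℝ → ℝ → Vec l := fun σ s => ∑ I, A I (heat r K I σ (fun z => g z s) x)
  have hQ : ContinuousOn (fun p : ℝ × ℝ => Q p.1 p.2) {p | 0 < p.1} :=
    continuousOn_finsetSum _ fun I _ =>
      (A I).continuous.comp_continuousOn (continuousOn_heat_time hT hγ h x K I)
  have hM : ∀ σ ∈ Ioc 0 t, ∀ s ∈ Icc 0 t, ‖Q σ s‖ ≤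
      (∑ I, ‖A I‖ * (C * N * Real.exp (γ * T))) * σ ^ (α / r - 1) := by
    intro σ hσ s hs
    rw [Finset.sum_mul]
    refine norm_sum_le_of_le _ fun I _ => ((A I).le_opNorm _).trans ?_
    rw [mul_assoc]
    gcongr
    have := Real.rpow_nonneg hσ.1.le (α / r - 1)
    refine (h.size_le hE le_rfl ⟨hs.1, hs.2.trans ht.2⟩ hσ.1 (hσ.2.trans ht.2) x).trans ?_
    gcongr
    exact hs.2.trans ht.2
  have hQi : ∀ s ∈ Icc 0 t, IntervalIntegrable (fun σ => Q σ s) volume 0 (t - s) := fun s hs =>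
    intervalIntegrable_of_le_rpow ha (by linarith [hs.2])
      (hQ.comp (f := fun σ : ℝ => (σ, s))
        (by fun_prop : Continuous fun σ : ℝ => (σ, s)).continuousOn fun σ hσ => hσ.1)
      fun σ hσ => hM σ ⟨hσ.1, by linarith [hσ.2, hs.1]⟩ s hs
  have hftc : ∀ s ∈ Icc 0 t, ∫ σ in (0 : ℝ)..(t - s), Q σ s =
      heat r K I₀ (t - s) (fun z => g z s) x - g x s := by
    intro s hs
    have h1 := intervalIntegral.integral_eq_sub_of_hasDerivAt_of_le
      (f := fun σ => heat r K I₀ σ (fun z => g z s) x) (f' := fun σ => Q σ s)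
      (a := 0) (b := t - s) (by linarith [hs.2]) ?_
      (fun σ hσ => hasDerivAt_heat_zero hK hr hσ.1 (h.cont_slice s)
        (fun z => h.bdd hT hγ z s) x I₀) (hQi s hs)
    · rw [h1]
      congr 1
      rw [heat, pow_zero, one_smul, rt_zero hr, conv_zero, kerD_zero, hK.integral_eq]
      rfl
    · simp only [heat, pow_zero, one_smul]
      exact (continuous_conv (X := ℝ) (G := fun _ z => g z s)
        ((h.cont_slice s).comp continuous_snd) (fun _ z => h.bdd hT hγ z s) (continuous_rt r)
        continuous_const).continuousOn
  have htri := integral_triangle ha ht.1 hQ hM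
  have hdc : ∀ I : Fin r → Fin n, Continuous fun τ => duh r K I g x (clamp T τ) := fun I =>
    (continuous_duh_clamp hE hr hα0 hα1 hT hγ h le_rfl I).comp
      (by fun_prop : Continuous fun τ : ℝ => (x, τ))
  have hSc : Continuous fun τ => ∑ I, A I (duh r K I g x (clamp T τ)) :=
    continuous_finsetSum _ fun I _ => (A I).continuous.comp (hdc I)
  have hgc : Continuous fun τ => g x τ := h.cont.comp (by fun_prop : Continuous fun τ : ℝ => (x, τ))
  rw [intervalIntegral.integral_add (hSc.intervalIntegrable _ _) (hgc.intervalIntegrable _ _)]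
  have hS : ∫ τ in (0 : ℝ)..t, ∑ I, A I (duh r K I g x (clamp T τ)) =
      ∫ τ in (0 : ℝ)..t, ∫ s in (0 : ℝ)..τ, Q (τ - s) s := by
    refine intervalIntegral.integral_congr fun τ hτ => ?_
    rw [uIcc_of_le ht.1] at hτ
    have hτT : τ ∈ Icc 0 T := ⟨hτ.1, hτ.2.trans ht.2⟩
    rw [clamp_eq hτT]
    have h2 := intervalIntegral.integral_comp_sub_left (a := 0) (b := τ)
      (fun σ => Q σ (τ - σ)) τ
    simp only [sub_sub_cancel, sub_self, sub_zero] at h2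
    rw [h2]
    simp only [Q, duh]
    rw [intervalIntegral.integral_finsetSum fun I _ =>
      have hi := h.intervalIntegrable (I := I) hE hr hα0 hγ le_rfl hτT x
      show IntervalIntegrable _ volume 0 τ from
        ⟨(A I).integrable_comp hi.1, (A I).integrable_comp hi.2⟩]
    refine Finset.sum_congr rfl fun I _ => ?_
    exact ((A I).intervalIntegral_comp_comm
      (h.intervalIntegrable hE hr hα0 hγ le_rfl hτT x)).symm
  have hR : ∫ s in (0 : ℝ)..t, ∫ σ in (0 : ℝ)..(t - s), Q σ s =
      ∫ s in (0 : ℝ)..t, (heat r K I₀ (t - s) (fun z => g z s) x - g x s) :=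
    intervalIntegral.integral_congr fun s hs => hftc s (by rwa [uIcc_of_le ht.1] at hs)
  have hrev := intervalIntegral.integral_comp_sub_left (a := 0) (b := t)
    (fun σ => heat r K I₀ σ (fun z => g z (t - σ)) x) t
  simp only [sub_sub_cancel, sub_self, sub_zero] at hrev
  have hii : IntervalIntegrable (fun s => heat r K I₀ (t - s) (fun z => g z s) x) volume 0 t := by
    have := (h.intervalIntegrable (I := I₀) hE hr hα0 hγ (by omega) ht x).comp_sub_left t
    simp only [sub_sub_cancel, sub_self, sub_zero] at this
    exact this.symm
  rw [hS, htri, hR, intervalIntegral.integral_sub hii (hgc.intervalIntegrable _ _), hrev]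
  simp only [duh, sub_add_cancel]

/-- A space-time function together with its spatial derivatives, solving a constant coefficient
system with zero initial value. -/
structure IsSol (r : ℕ) (T : ℝ) (A : (Fin r → Fin n) → Mat l)
    (U : (k : ℕ) → (Fin k → Fin n) → Vec n → ℝ → Vec l) (g : Vec n → ℝ → Vec l) : Prop where
  cont : ∀ k, k ≤ r → ∀ I, Continuous fun p : Vec n × ℝ => U k I p.1 p.2
  clamped : ∀ k, k ≤ r → ∀ I x s, U k I x (clamp T s) = U k I x s
  bdd : ∃ B, ∀ k, k ≤ r → ∀ I x s, ‖U k I x s‖ ≤ B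
  fderiv : ∀ k, k < r → ∀ (I : Fin k → Fin n) x s, HasFDerivAt (fun x => U k I x s)
    (grad fun i => U (k + 1) (Fin.cons i I : Fin (k + 1) → Fin n) x s) x
  time : ∀ I₀ x, ∀ t ∈ Icc 0 T, HasDerivWithinAt (U 0 I₀ x)
    (∑ I, A I (U r I x t) + g x t) (Icc 0 T) t
  init : ∀ I₀ x, U 0 I₀ x 0 = 0

/-- The Duhamel solution and its spatial derivatives. -/
def vfam (r : ℕ) (T : ℝ) (K : 𝓢(Vec n, Mat l)) (g : Vec n → ℝ → Vec l) (k : ℕ)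
    (I : Fin k → Fin n) (x : Vec n) (t : ℝ) : Vec l := duh r K I g x (clamp T t)

theorem isSol_vfam (hK : IsKer r A K) (hE : HeatEst r α T C K) (hr : 2 ≤ r) (hα0 : 0 < α)
    (hα1 : α < 1) (hT : 0 ≤ T) (hγ : 0 ≤ γ) (h : Wt T α γ N g) :
    IsSol r T A (vfam r T K g) g where
  cont k hk I := continuous_duh_clamp hE hr hα0 hα1 hT hγ h hk I
  clamped k _ I x s := by rw [vfam, clamp_clamp hT, vfam]
  bdd := by
    have h1 : Wt T α 1 (N * Real.exp (γ * T)) g := by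
      have h0 := h.unweight hT hγ
      have hN := h0.nonneg hT
      refine ⟨h.cont, h.clamped, fun s hs x => ?_, fun s hs x y => ?_⟩
      · refine (h0.sup s hs x).trans ?_
        gcongr 1; simpa using hs.1
      · refine (h0.hol s hs x y).trans ?_
        gcongr ?_ * _
        gcongr 1; simpa using hs.1
    refine ⟨Real.Gamma (α / r) * C * (N * Real.exp (γ * T)) * 1 ^ (-(α / r)) *
      Real.exp (1 * T), fun k hk I x s => ?_⟩
    refine (norm_duh_le hE hr hα0 one_pos h1 hk I (clamp_mem hT s) x).trans ?_
    have : 0 < Real.Gamma (α / r) := Real.Gamma_pos_of_pos (by positivity)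
    have := hE.nonneg
    have := h1.nonneg hT
    have := (clamp_mem hT s).2
    gcongr
  fderiv k hk I x s := hasFDerivAt_duh hE hr hα0 hγ h hk I (clamp_mem hT s) x
  time I₀ x t ht := by
    have hdc : ∀ I : Fin r → Fin n, Continuous fun τ => duh r K I g x (clamp T τ) := fun I =>
      (continuous_duh_clamp hE hr hα0 hα1 hT hγ h le_rfl I).comp
        (by fun_prop : Continuous fun τ : ℝ => (x, τ))
    have hc : Continuous fun τ => ∑ I, A I (duh r K I g x (clamp T τ)) + g x τ :=
      (continuous_finsetSum _ fun I _ => (A I).continuous.comp (hdc I)).add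
        (h.cont.comp (by fun_prop : Continuous fun τ : ℝ => (x, τ)))
    have hd := (hc.integral_hasStrictDerivAt 0 t).hasDerivAt.hasDerivWithinAt (s := Icc 0 T)
    refine hd.congr (fun s hs => ?_) ?_
    · rw [vfam, clamp_eq hs, duh_eq_integral hK hE hr hα0 hα1 hγ h I₀ hs x]
    · rw [vfam, clamp_eq ht, duh_eq_integral hK hE hr hα0 hα1 hγ h I₀ ht x]
  init I₀ x := by
    rw [vfam, clamp_eq ⟨le_rfl, hT⟩, duh, intervalIntegral.integral_same]

theorem vfam_add {N' : ℝ} {g' : Vec n → ℝ → Vec l} (hE : HeatEst r α T C K) (hr : 2 ≤ r)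
    (hα0 : 0 < α) (hT : 0 ≤ T) (hγ : 0 ≤ γ) (h : Wt T α γ N g) (h' : Wt T α γ N' g') (hk : k ≤ r)
    (I : Fin k → Fin n) (x : Vec n) (t : ℝ) :
    vfam r T K (fun x t => g x t + g' x t) k I x t = vfam r T K g k I x t + vfam r T K g' k I x t := by
  rw [vfam, vfam, vfam, duh, duh, duh, ← intervalIntegral.integral_add
    (h.intervalIntegrable hE hr hα0 hγ hk (clamp_mem hT t) x)
    (h'.intervalIntegrable hE hr hα0 hγ hk (clamp_mem hT t) x)]
  refine intervalIntegral.integral_congr fun σ _ => ?_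
  simp only [heat]
  rw [← smul_add, ← conv_add (h.cont_slice _) (fun z => h.bdd hT hγ z _) (h'.cont_slice _)
    (fun z => h'.bdd hT hγ z _)]

theorem vfam_smul (c : ℝ) (I : Fin k → Fin n) (x : Vec n) (t : ℝ) :
    vfam r T K (fun x t => c • g x t) k I x t = c • vfam r T K g k I x t := by
  rw [vfam, vfam, duh, duh, ← intervalIntegral.integral_smul]
  refine intervalIntegral.integral_congr fun σ _ => ?_
  simp only [heat]
  rw [conv_smul, smul_comm]

theorem vfam_shift {p : Vec n} (hp : ∀ x t, g (x + p) t = g x t) (I : Fin k → Fin n) (x : Vec n)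
    (t : ℝ) : vfam r T K g k I (x + p) t = vfam r T K g k I x t := by
  simp only [vfam, duh, heat, conv]
  simp_rw [fun (y : Vec n) (c : ℝ) => show x + p - c • y = x - c • y + p by abel, hp]

end DuhamelEq

section KernelCalculus
variable {n l : ℕ} {W : Type} [NormedAddCommGroup W] [NormedSpace ℝ W]

theorem lineDerivOp_swap (f : 𝓢(Vec n, W)) (a b : Vec n) : ∂_{a} (∂_{b} f) = ∂_{b} (∂_{a} f) := by
  ext x
  have hd : ∀ y, DifferentiableAt ℝ (fderiv ℝ f) y := fun y =>
    ((f.smooth 2).fderiv_right (m := 1) (by norm_num)).contDiffAt.differentiableAt (by norm_num)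
  have key : ∀ u v : Vec n, (∂_{u} (∂_{v} f)) x = fderiv ℝ (fderiv ℝ f) x u v := by
    intro u v
    rw [SchwartzMap.lineDerivOp_apply_eq_fderiv]
    have : ⇑(∂_{v} f : 𝓢(Vec n, W)) = fun y => fderiv ℝ f y v := by
      ext y
      rw [SchwartzMap.lineDerivOp_apply_eq_fderiv]
    rw [this, fderiv_clm_apply (hd x) (differentiableAt_const v)]
    simp
  rw [key, key]
  exact (((f.smooth 2).contDiffAt).isSymmSndFDerivAt (by simp)).eq _ _

theorem lineDerivOp_mulC (f : 𝓢(Vec n, W)) (j : Fin n) :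
    ∂_{ee j} (mulC W j f) = f + mulC W j (∂_{ee j} f) := by
  ext x
  rw [SchwartzMap.lineDerivOp_apply_eq_fderiv]
  have h1 : (⇑(mulC W j f) : Vec n → W) = fun y => (y j) • f y := by
    ext y
    rw [mulC_apply]
  have h2 : HasFDerivAt (fun y : Vec n => y j) (EuclideanSpace.proj j : Vec n →L[ℝ] ℝ) x :=
    (EuclideanSpace.proj j : Vec n →L[ℝ] ℝ).hasFDerivAt
  rw [h1, (h2.fun_smul (f.hasFDerivAt x)).fderiv]
  simp [mulC_apply, SchwartzMap.lineDerivOp_apply_eq_fderiv, add_comm]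

theorem kerD_cons' (K : 𝓢(Vec n, Mat l)) {k : ℕ} (i : Fin n) (I : Fin k → Fin n) :
    kerD K (Fin.cons i I : Fin (k + 1) → Fin n) = kerD (∂_{ee i} K) I := by
  induction k with
  | zero => rw [kerD_cons, kerD_zero, kerD_zero]
  | succ k ih =>
    rw [← Fin.cons_self_tail I, kerD_cons, kerD_cons, kerD_cons, lineDerivOp_swap, ← kerD_cons, ih]

end KernelCalculus

section Unique
variable {n l r : ℕ} {T : ℝ} {A : (Fin r → Fin n) → Mat l} {K : 𝓢(Vec n, Mat l)}
  {U V : (k : ℕ) → (Fin k → Fin n) → Vec n → ℝ → Vec l} {g : Vec n → ℝ → Vec l}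

theorem IsSol.sub (h : IsSol r T A U g) (h' : IsSol r T A V g) :
    IsSol r T A (fun k I x t => U k I x t - V k I x t) (fun _ _ => 0) where
  cont k hk I := (h.cont k hk I).sub (h'.cont k hk I)
  clamped k hk I x s := by rw [h.clamped k hk, h'.clamped k hk]
  bdd := by
    obtain ⟨B, hB⟩ := h.bdd
    obtain ⟨B', hB'⟩ := h'.bdd
    exact ⟨B + B', fun k hk I x s => (norm_sub_le _ _).trans
      (add_le_add (hB k hk I x s) (hB' k hk I x s))⟩
  fderiv k hk I x s := by
    refine ((h.fderiv k hk I x s).fun_sub (h'.fderiv k hk I x s)).congr_fderiv ?_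
    ext1 v
    simp [grad_apply, smul_sub, sub_apply]
  time I₀ x t ht := by
    refine ((h.time I₀ x t ht).fun_sub (h'.time I₀ x t ht)).congr_deriv ?_
    simp [map_sub, Finset.sum_sub_distrib]
  init I₀ x := by rw [h.init, h'.init, sub_zero]

theorem IsSol.conv_kerD (h : IsSol r T A U g) {k : ℕ} (hk : k ≤ r) (I : Fin k → Fin n)
    (I₀ : Fin 0 → Fin n) (K : 𝓢(Vec n, Mat l)) (ρ s : ℝ) (x : Vec n) :
    conv (kerD K I) ρ (fun z => U 0 I₀ z s) x = ρ ^ k • conv K ρ (fun z => U k I z s) x := by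
  obtain ⟨B, hB⟩ := h.bdd
  induction k generalizing K with
  | zero =>
    rw [kerD_zero, pow_zero, one_smul, Subsingleton.elim I₀ I]
  | succ k ih =>
    obtain ⟨i, I, rfl⟩ : ∃ i J, I = Fin.cons i J := ⟨I 0, Fin.tail I, (Fin.cons_self_tail I).symm⟩
    rw [kerD_cons', ih (by omega), conv_lineDeriv i
      (fun z => (h.fderiv k (by omega) I z s).differentiableAt)
      (g' := fun z => U (k + 1) (Fin.cons i I) z s)
      (fun z => by rw [(h.fderiv k (by omega) I z s).fderiv, grad_ee])
      (fun z => hB k (by omega) I z s) (fun z => hB _ hk _ z s)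
      ((h.cont _ hk _).comp (by fun_prop : Continuous fun z : Vec n => (z, s))), smul_smul, pow_succ]

theorem IsSol.hasFDerivAt (hr : 2 ≤ r) (h : IsSol r T A U (fun _ _ => 0)) (I₀ : Fin 0 → Fin n)
    (x : Vec n) {t : ℝ} (ht : t ∈ Ioo 0 T) :
    HasFDerivAt (fun p : Vec n × ℝ => U 0 I₀ p.1 p.2)
      ((grad fun i => U 1 (Fin.cons i I₀ : Fin 1 → Fin n) x t).coprod
        ((1 : ℝ →L[ℝ] ℝ).smulRight (∑ I, A I (U r I x t)))) (x, t) := by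
  have hO : ∀ᶠ v : Vec n × ℝ in 𝓝 (x, t), v.2 ∈ Ioo 0 T :=
    continuous_snd.continuousAt.eventually (isOpen_Ioo.mem_nhds ht)
  have := hasStrictFDerivAt_uncurry_coprod (u := (x, t)) (f := fun y s => U 0 I₀ y s)
    (f₁ := fun y s => grad fun i => U 1 (Fin.cons i I₀ : Fin 1 → Fin n) y s)
    (f₂ := fun y s => (1 : ℝ →L[ℝ] ℝ).smulRight (∑ I, A I (U r I y s)))
    (Eventually.of_forall fun v => h.fderiv 0 (by omega) I₀ v.1 v.2)
    (by
      filter_upwards [hO] with v hv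
      have := (h.time I₀ v.1 v.2 ⟨hv.1.le, hv.2.le⟩).hasDerivAt (Icc_mem_nhds hv.1 hv.2)
      rw [add_zero] at this
      exact this.hasFDerivAt)
    (by
      refine Continuous.continuousAt ?_
      simp only [grad]
      exact continuous_finsetSum Finset.univ fun i _ =>
        (ContinuousLinearMap.smulRightL ℝ (Vec n) (Vec l)
          (EuclideanSpace.proj i : Vec n →L[ℝ] ℝ)).continuous.comp
            (h.cont 1 (by omega) (Fin.cons i I₀ : Fin 1 → Fin n)))
    (by
      refine Continuous.continuousAt ?_
      exact (ContinuousLinearMap.smulRightL ℝ ℝ (Vec l) 1).continuous.comp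
        (continuous_finsetSum _ fun I _ => (A I).continuous.comp (h.cont r le_rfl I)))
  exact this.hasFDerivAt

/-- Composition of a kernel with a matrix on the right. -/
def compR (K : 𝓢(Vec n, Mat l)) (M : Mat l) : 𝓢(Vec n, Mat l) :=
  K.postcompCLM ((ContinuousLinearMap.compL ℝ (Vec l) (Vec l) (Vec l)).flip M)

theorem compR_apply (M : Mat l) (y : Vec n) : compR K M y = (K y).comp M := by
  simp [compR]

theorem kerD_compR (M : Mat l) {k : ℕ} (I : Fin k → Fin n) :
    kerD (compR K M) I = compR (kerD K I) M := by
  rw [kerD, compR, iteratedLineDerivOp_postcomp]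
  rfl

theorem IsKer.sum_compR (hK : IsKer r A K) :
    ∑ I, compR (kerD K I) (A I) = (r : ℝ)⁻¹ • sharp K := by
  ext1 y
  have := hK.right y
  simp only [sum_apply, compR_apply, kerD, smul_apply] at this ⊢
  rw [this, sharp]
  simp [mulC_apply, add_comm]

/-- The derivative of the duality pairing of a homogeneous solution with the kernel vanishes. -/
theorem IsSol.integral_deriv_eq_zero (hr : 2 ≤ r) (hK : IsKer r A K)
    (h : IsSol r T A U (fun _ _ => 0)) (I₀ : Fin 0 → Fin n) (x : Vec n) (s : ℝ) {ρ : ℝ}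
    (hρ : 0 < ρ) :
    ∫ y, K y (((r : ℝ)⁻¹ * (ρ ^ r)⁻¹ * ρ) •
      ∑ j, y j • U 1 (Fin.cons j I₀ : Fin 1 → Fin n) (x - ρ • y) s +
        ∑ I, A I (U r I (x - ρ • y) s)) = 0 := by
  obtain ⟨B, hB⟩ := h.bdd
  have hc : ∀ k, k ≤ r → ∀ I, Continuous fun z => U k I z s := fun k hk I =>
    (h.cont k hk I).comp (by fun_prop : Continuous fun z : Vec n => (z, s))
  set c := (r : ℝ)⁻¹ * (ρ ^ r)⁻¹ * ρ
  have e1 : ∀ y, K y (c • ∑ j, y j • U 1 (Fin.cons j I₀ : Fin 1 → Fin n) (x - ρ • y) s +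
        ∑ I, A I (U r I (x - ρ • y) s)) =
      ∑ j, c • (mulC _ j K) y (U 1 (Fin.cons j I₀ : Fin 1 → Fin n) (x - ρ • y) s) +
        ∑ I, (compR K (A I)) y (U r I (x - ρ • y) s) := by
    intro y
    simp [mulC_apply, compR_apply, map_sum, Finset.smul_sum]
  have i1 : ∀ j, Integrable fun y =>
      c • (mulC _ j K) y (U 1 (Fin.cons j I₀ : Fin 1 → Fin n) (x - ρ • y) s) := fun j =>
    (integrable_conv (mulC _ j K) ρ (hc 1 (by omega) (Fin.cons j I₀))
      (fun z => hB 1 (by omega) _ z s) x).fun_smul c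
  have i2 : ∀ I, Integrable fun y => (compR K (A I)) y (U r I (x - ρ • y) s) := fun I =>
    integrable_conv (compR K (A I)) ρ (hc r le_rfl I) (fun z => hB r le_rfl _ z s) x
  simp_rw [e1]
  rw [integral_add (integrable_finsetSum _ fun j _ => i1 j) (integrable_finsetSum _ fun I _ => i2 I),
    integral_finsetSum _ fun j _ => i1 j, integral_finsetSum _ fun I _ => i2 I]
  simp_rw [integral_smul]
  have c1 : ∀ j, ρ • ∫ y, (mulC _ j K) y (U 1 (Fin.cons j I₀ : Fin 1 → Fin n) (x - ρ • y) s) =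
      conv (K + mulC _ j (∂_{ee j} K)) ρ (fun z => U 0 I₀ z s) x := fun j => by
    rw [← lineDerivOp_mulC, conv_lineDeriv j
      (fun z => (h.fderiv 0 (by omega) I₀ z s).differentiableAt)
      (g' := fun z => U 1 (Fin.cons j I₀) z s)
      (fun z => by rw [(h.fderiv 0 (by omega) I₀ z s).fderiv, grad_ee])
      (fun z => hB 0 (by omega) I₀ z s) (fun z => hB 1 (by omega) _ z s) (hc 1 (by omega) _)]
    rfl
  have c2 : ∀ I, ∫ y, (compR K (A I)) y (U r I (x - ρ • y) s) =
      (ρ ^ r)⁻¹ • conv (compR (kerD K I) (A I)) ρ (fun z => U 0 I₀ z s) x := fun I => by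
    rw [← kerD_compR, h.conv_kerD le_rfl, inv_smul_smul₀ (by positivity)]
    rfl
  simp_rw [c2, show c = ((r : ℝ)⁻¹ * (ρ ^ r)⁻¹) * ρ from rfl, mul_smul _ ρ, c1]
  rw [← Finset.smul_sum, ← Finset.smul_sum, ← conv_kernel_sum _ _ (hc 0 (by omega) I₀)
    (fun z => hB 0 (by omega) I₀ z s), ← conv_kernel_sum _ _ (hc 0 (by omega) I₀)
    (fun z => hB 0 (by omega) I₀ z s), hK.sum_compR, conv_kernel_smul]
  have : ∑ i : Fin n, (K + mulC _ i (∂_{ee i} K)) = (-1 : ℝ) • sharp K := by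
    simp [sharp, Finset.sum_add_distrib, add_comm, Nat.cast_smul_eq_nsmul]
  rw [this, conv_kernel_smul]
  module

theorem IsSol.eq_zero_aux (hr : 2 ≤ r) (hK : IsKer r A K)
    (h : IsSol r T A U (fun _ _ => 0))
    (I₀ : Fin 0 → Fin n) (x : Vec n) {t : ℝ} (ht : t ∈ Icc 0 T) : U 0 I₀ x t = 0 := by
  obtain ⟨B, hB⟩ := h.bdd
  have hB0 : 0 ≤ B := (norm_nonneg _).trans (hB 0 (by omega) I₀ x t)
  have hr0 : (0 : ℝ) < r := by positivity
  let φ : ℝ → Vec l := fun s => conv K (rt r (t - s)) (fun z => U 0 I₀ z s) x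
  have hφc : Continuous φ := by
    refine continuous_conv (N := B) ((h.cont 0 (by omega) I₀).comp
      (by fun_prop : Continuous fun q : ℝ × Vec n => (q.2, q.1)))
      (fun s z => hB 0 (by omega) I₀ z s) ?_ continuous_const
    exact (continuous_rt r).comp (by fun_prop : Continuous fun s : ℝ => t - s)
  have hφt : φ t = U 0 I₀ x t := by
    simp only [φ, sub_self, rt_zero hr, conv_zero, hK.integral_eq]
    rfl
  have hφ0 : φ 0 = 0 := by
    simp [φ, h.init, conv]
  have hder : ∀ s ∈ Ioo 0 t, HasDerivAt φ 0 s := by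
    intro s₀ hs₀
    let c : ℝ → ℝ := fun s => (r : ℝ)⁻¹ * (t - s)⁻¹ * rt r (t - s)
    have hcc : ContinuousAt c s₀ := by
      refine ContinuousAt.mul (continuousAt_const.mul (ContinuousAt.inv₀ (by fun_prop) ?_)) ?_
      · have := hs₀.2; linarith
      · exact ((continuous_rt r).comp (by fun_prop : Continuous fun s : ℝ => t - s)).continuousAt
    let S : Set ℝ := {s | s ∈ Ioo 0 t ∧ c s < c s₀ + 1}
    have hS : S ∈ 𝓝 s₀ := by
      filter_upwards [isOpen_Ioo.mem_nhds hs₀, hcc.eventually (gt_mem_nhds (lt_add_one (c s₀)))]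
        with s h1 h2 using ⟨h1, h2⟩
    have hc0 : ∀ s ∈ Ioo 0 t, 0 ≤ c s := fun s hs => by
      have : 0 < t - s := by linarith [hs.2]
      have := rt_pos (r := r) this
      positivity
    let F' : ℝ → Vec n → Vec l := fun s y => K y (c s •
      ∑ j, y j • U 1 (Fin.cons j I₀ : Fin 1 → Fin n) (x - rt r (t - s) • y) s +
        ∑ I, A I (U r I (x - rt r (t - s) • y) s))
    have hcont : ∀ s, Continuous (F' s) := fun s => by
      have h2 : Continuous fun y : Vec n => (x - rt r (t - s) • y, s) := by fun_prop
      refine K.continuous.clm_apply (Continuous.add (Continuous.fun_const_smul (continuous_finsetSum _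
        fun j _ => ?_) _) (continuous_finsetSum _ fun I _ => ?_))
      · exact (by fun_prop : Continuous fun y : Vec n => y j).smul
          ((h.cont 1 (by omega) _).comp h2)
      · exact (A I).continuous.comp ((h.cont r le_rfl _).comp h2)
    have key := hasDerivAt_integral_of_dominated_loc_of_deriv_le (μ := volume) (s := S) hS
      (F := fun s y => K y (U 0 I₀ (x - rt r (t - s) • y) s)) (F' := F')
      (bound := fun y => ((c s₀ + 1) * (n * B) + ∑ I, ‖A I‖ * B) * ((1 + ‖y‖) ^ 1 * ‖K y‖))
      (Eventually.of_forall fun s => (K.continuous.clm_apply ((h.cont 0 (by omega) I₀).comp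
        (by fun_prop : Continuous fun y : Vec n => (x - rt r (t - s) • y, s)))).aestronglyMeasurable)
      (integrable_conv K _ ((h.cont 0 (by omega) I₀).comp
        (by fun_prop : Continuous fun z : Vec n => (z, s₀))) (fun z => hB 0 (by omega) I₀ z s₀) x)
      (hcont s₀).aestronglyMeasurable
      (Eventually.of_forall fun y s hs => ?_)
      ((integrable_mom 1 K).const_mul _)
      (Eventually.of_forall fun y s hs => ?_)
    · have hts : 0 < t - s₀ := by linarith [hs₀.2]
      have e := h.integral_deriv_eq_zero hr hK I₀ x s₀ (rt_pos (r := r) hts)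
      rw [rt_pow hr hts.le] at e
      rw [← show ∫ y, F' s₀ y = 0 from e]
      exact key.2
    · have hy : ∀ j, |y j| ≤ 1 + ‖y‖ := fun j => by
        have := PiLp.norm_apply_le y j
        rw [Real.norm_eq_abs] at this
        linarith
      have hb := hc0 s hs.1
      have hy1 : 1 ≤ 1 + ‖y‖ := by simp
      calc ‖F' s y‖ ≤ ‖K y‖ * ((c s₀ + 1) * ∑ j : Fin n, (1 + ‖y‖) * B +
              ∑ I, ‖A I‖ * B * (1 + ‖y‖)) := by
            refine ((K y).le_opNorm _).trans ?_
            gcongr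
            refine (norm_add_le _ _).trans (add_le_add ?_ (norm_sum_le_of_le _ fun I _ => ?_))
            · rw [norm_smul, Real.norm_of_nonneg hb]
              refine mul_le_mul hs.2.le (norm_sum_le_of_le _ fun j _ => ?_) (norm_nonneg _)
                (hb.trans hs.2.le)
              rw [norm_smul, Real.norm_eq_abs]
              exact mul_le_mul (hy j) (hB _ (by omega) _ _ _) (norm_nonneg _) (by positivity)
            · calc _ ≤ ‖A I‖ * B := (A I).le_opNorm_of_le (hB _ le_rfl _ _ _)
                _ ≤ _ := le_mul_of_one_le_right (by positivity) hy1
        _ = _ := by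
            rw [Finset.sum_const, Finset.card_univ, Fintype.card_fin, nsmul_eq_mul,
              ← Finset.sum_mul]
            ring
    · have hts : 0 < t - s := by linarith [hs.1.2]
      have h1 : HasDerivAt (fun s => rt r (t - s)) (-(c s)) s := by
        have := (hasDerivAt_rt (r := r) hts).comp s ((hasDerivAt_id s).const_sub t)
        simpa [c, Function.comp_def] using this
      have h2 : HasDerivAt (fun s => (x - rt r (t - s) • y, s)) (c s • y, (1 : ℝ)) s := by
        have := (h1.smul_const y).const_sub x
        simp only [neg_smul, neg_neg] at this
        exact this.prodMk (hasDerivAt_id s)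
      have h3 := (h.hasFDerivAt hr I₀ (x - rt r (t - s) • y)
        ⟨hs.1.1, hs.1.2.trans_le ht.2⟩).comp_hasDerivAt_of_eq s h2 rfl
      have h4 := (K y).hasFDerivAt.comp_hasDerivAt s h3
      refine h4.congr_deriv ?_
      simp [F', grad_apply]
  have := intervalIntegral.integral_eq_sub_of_hasDerivAt_of_le (f := φ) (f' := fun _ => 0) ht.1
    hφc.continuousOn hder (by simp)
  simpa [hφt, hφ0, eq_comm] using this

theorem IsSol.eq_zero (hr : 2 ≤ r) (hT : 0 ≤ T) (hK : IsKer r A K)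
    (h : IsSol r T A U (fun _ _ => 0)) {k : ℕ} (hk : k ≤ r) (I : Fin k → Fin n) (x : Vec n)
    (t : ℝ) : U k I x t = 0 := by
  induction k generalizing x with
  | zero => rw [← h.clamped 0 hk, h.eq_zero_aux hr hK I x (clamp_mem hT t)]
  | succ k ih =>
    obtain ⟨i, I, rfl⟩ : ∃ i J, I = Fin.cons i J := ⟨I 0, Fin.tail I, (Fin.cons_self_tail I).symm⟩
    have h1 := h.fderiv k (by omega) I x t
    simp_rw [ih (by omega) I] at h1
    rw [← grad_ee (fun i => U (k + 1) (Fin.cons i I : Fin (k + 1) → Fin n) x t) i,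
      h1.unique (hasFDerivAt_const 0 x)]
    rfl

/-- Solutions of the constant coefficient problem are unique. -/
theorem IsSol.unique (hr : 2 ≤ r) (hT : 0 ≤ T) (hK : IsKer r A K) (h : IsSol r T A U g)
    (h' : IsSol r T A V g) {k : ℕ} (hk : k ≤ r) (I : Fin k → Fin n) (x : Vec n) (t : ℝ) :
    U k I x t = V k I x t :=
  sub_eq_zero.1 ((h.sub h').eq_zero hr hT hK hk I x t)

end Unique

section Far
variable {n l r : ℕ} {α T C : ℝ} {K : 𝓢(Vec n, Mat l)}

theorem exists_norm_heat_le_far (hr : 2 ≤ r) (K : 𝓢(Vec n, Mat l)) {δ : ℝ} (hδ : 0 < δ) :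
    ∃ D, 0 ≤ D ∧ ∀ (I : Fin (r + 1) → Fin n) (g : Vec n → Vec l) (M σ : ℝ) (x : Vec n), 0 < σ →
      (∀ z, ‖g z‖ ≤ M) → (σ < δ → ∀ z, ‖z - x‖ < δ → g z = 0) →
      ‖heat r K I σ g x‖ ≤ D * M := by
  refine ⟨∑ I : Fin (r + 1) → Fin n, (mom (r + 1) (kerD K I) * (δ⁻¹) ^ (r + 1) +
    ((rt r δ)⁻¹) ^ (r + 1) * mom 0 (kerD K I)), ?_, ?_⟩
  · refine Finset.sum_nonneg fun I _ => ?_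
    have := mom_nonneg (r + 1) (kerD K I)
    have := mom_nonneg 0 (kerD K I)
    have := rt_pos (r := r) hδ
    positivity
  intro I g M σ x hσ hM h0
  have hM0 : 0 ≤ M := (norm_nonneg _).trans (hM 0)
  have hm1 := fun I : Fin (r + 1) → Fin n => mom_nonneg (r + 1) (kerD K I)
  have hm0 := fun I : Fin (r + 1) → Fin n => mom_nonneg 0 (kerD K I)
  have hρδ := rt_pos (r := r) hδ
  have hρ := rt_pos (r := r) hσ
  suffices h : ‖heat r K I σ g x‖ ≤ (mom (r + 1) (kerD K I) * (δ⁻¹) ^ (r + 1) +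
      ((rt r δ)⁻¹) ^ (r + 1) * mom 0 (kerD K I)) * M by
    refine h.trans (mul_le_mul_of_nonneg_right ?_ hM0)
    refine Finset.single_le_sum (f := fun I : Fin (r + 1) → Fin n =>
      mom (r + 1) (kerD K I) * (δ⁻¹) ^ (r + 1) + ((rt r δ)⁻¹) ^ (r + 1) * mom 0 (kerD K I))
      (fun I _ => ?_) (Finset.mem_univ I)
    have := hm1 I
    have := hm0 I
    positivity
  rw [heat, norm_smul, Real.norm_of_nonneg (by positivity), add_mul]
  have hm1 := hm1 I
  have hm0 := hm0 I
  rcases lt_or_ge σ δ with hs | hs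
  · calc _ ≤ ((rt r σ)⁻¹) ^ (r + 1) * (mom (r + 1) (kerD K I) * (M * (rt r σ / δ) ^ (r + 1))) := by
          gcongr
          exact norm_conv_le_of_eq_zero_on_ball (r + 1) hδ hM (h0 hs) hρ.le
      _ = mom (r + 1) (kerD K I) * (δ⁻¹) ^ (r + 1) * M := by
          rw [div_pow, inv_pow, inv_pow]
          field_simp
      _ ≤ _ := le_add_of_nonneg_right (by positivity)
  · calc _ ≤ ((rt r δ)⁻¹) ^ (r + 1) * (mom 0 (kerD K I) * M) := by
          gcongr
          · exact Real.rpow_le_rpow hδ.le hs (by positivity)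
          · exact norm_conv_le hM
      _ ≤ _ := by
          rw [← mul_assoc]
          exact le_add_of_nonneg_left (by positivity)

/-- Away from the support of the right-hand side the Duhamel integral is smooth. -/
theorem exists_duh_far (hE : HeatEst r α T C K) (hr : 2 ≤ r) (hα0 : 0 < α) (hT : 0 ≤ T) {δ : ℝ}
    (hδ : 0 < δ) : ∃ D, 0 ≤ D ∧ ∀ (γ N M : ℝ) (h : Vec n → ℝ → Vec l) (x₀ : Vec n) (t₀ : ℝ),
      0 ≤ γ → Wt T α γ N h → (∀ s ∈ Icc 0 T, ∀ x, ‖h x s‖ ≤ M * Real.exp (γ * s)) →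
      (∀ s x, ‖x - x₀‖ < δ → |s - t₀| < δ → h x s = 0) →
      ∀ (I : Fin r → Fin n), ∀ t ∈ Icc 0 T, |t - t₀| < δ / 2 → ∀ x y, ‖x - x₀‖ < δ / 2 →
        ‖y - x₀‖ < δ / 2 → ‖duh r K I h x t - duh r K I h y t‖ ≤
          D * M * Real.exp (γ * t) * ‖x - y‖ := by
  obtain ⟨D, hD, hD'⟩ := exists_norm_heat_le_far (n := n) (l := l) hr K (half_pos hδ)
  refine ⟨T * (n * D), by positivity, ?_⟩
  intro γ N M h x₀ t₀ hγ hh hM h0 I t ht htt x y hx hy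
  have hM0 : 0 ≤ M := by
    have := (norm_nonneg _).trans (hM 0 ⟨le_rfl, hT⟩ 0)
    simpa using this
  rw [duh, duh, ← intervalIntegral.integral_sub
    (hh.intervalIntegrable hE hr hα0 hγ le_rfl ht x) (hh.intervalIntegrable hE hr hα0 hγ le_rfl ht y)]
  have key : ∀ σ ∈ uIoc 0 t, ‖heat r K I σ (fun z => h z (t - σ)) x -
      heat r K I σ (fun z => h z (t - σ)) y‖ ≤ n * (D * (M * Real.exp (γ * t))) * ‖x - y‖ := by
    intro σ hσ
    rw [uIoc_of_le ht.1] at hσ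
    have hts : t - σ ∈ Icc 0 T := ⟨by linarith [hσ.2], by linarith [hσ.1, ht.2]⟩
    have hb : ∀ z, ‖h z (t - σ)‖ ≤ M * Real.exp (γ * t) := fun z => by
      refine (hM _ hts z).trans ?_
      gcongr
      linarith [hσ.1]
    have := Convex.norm_image_sub_le_of_norm_hasFDerivWithin_le (𝕜 := ℝ)
      (f := heat r K I σ (fun z => h z (t - σ)))
      (s := Metric.ball x₀ (δ / 2)) (x := y) (y := x)
      (C := n * (D * (M * Real.exp (γ * t))))
      (fun z _ => (hasFDerivAt_heat hσ.1 (hh.cont_slice _) hb z).hasFDerivWithinAt)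
      (fun z hz => ?_) (convex_ball _ _) (by rwa [mem_ball_iff_norm]) (by rwa [mem_ball_iff_norm])
    · exact this
    · refine norm_grad_le fun i => hD' _ _ _ _ _ hσ.1 hb fun hs w hw => ?_
      refine h0 _ _ ?_ ?_
      · rw [mem_ball_iff_norm] at hz
        calc ‖w - x₀‖ ≤ ‖w - z‖ + ‖z - x₀‖ := norm_sub_le_norm_sub_add_norm_sub _ _ _
          _ < δ := by linarith
      · rw [abs_lt] at htt ⊢
        constructor <;> linarith [hσ.1]
  refine (intervalIntegral.norm_integral_le_of_norm_le_const key).trans ?_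
  rw [sub_zero, abs_of_nonneg ht.1]
  calc _ ≤ n * (D * (M * Real.exp (γ * t))) * ‖x - y‖ * T := by
        gcongr
        exact ht.2
    _ = _ := by ring

end Far

section Holder
variable {n l r : ℕ} {E F G : Type*} [NormedAddCommGroup E] [NormedSpace ℝ E]
  [NormedAddCommGroup F] [NormedSpace ℝ F] [NormedAddCommGroup G] [NormedSpace ℝ G]
  {T α γ : ℝ}

/-- Weighted spatial Hölder bounds with separate constants for the supremum norm and for the
seminorm. -/
structure Ht (T α γ S H : ℝ) (g : Vec n → ℝ → E) : Prop where
  cont : Continuous fun p : Vec n × ℝ => g p.1 p.2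
  clamped : ∀ x s, g x (clamp T s) = g x s
  sup : ∀ s ∈ Icc 0 T, ∀ x, ‖g x s‖ ≤ S * Real.exp (γ * s)
  hol : ∀ s ∈ Icc 0 T, ∀ x y, ‖g x s - g y s‖ ≤ H * Real.exp (γ * s) * ‖x - y‖ ^ α

theorem Wt.ht {N : ℝ} {g : Vec n → ℝ → Vec l} (h : Wt T α γ N g) : Ht T α γ N N g :=
  ⟨h.cont, h.clamped, h.sup, h.hol⟩

variable {S H S' H' : ℝ} {g : Vec n → ℝ → E} {g' : Vec n → ℝ → E}

theorem Ht.sup_nonneg (hT : 0 ≤ T) (h : Ht T α γ S H g) : 0 ≤ S := by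
  have := (norm_nonneg _).trans (h.sup 0 ⟨le_rfl, hT⟩ 0)
  simpa using this

theorem Ht.mono (h : Ht T α γ S H g) (hS : S ≤ S') (hH : H ≤ H') : Ht T α γ S' H' g where
  cont := h.cont
  clamped := h.clamped
  sup s hs x := (h.sup s hs x).trans (by gcongr)
  hol s hs x y := (h.hol s hs x y).trans (by gcongr)

theorem Ht.wt {N : ℝ} {g : Vec n → ℝ → Vec l} (h : Ht T α γ S H g) (hS : S ≤ N) (hH : H ≤ N) :
    Wt T α γ N g :=
  have h' := h.mono hS hH
  ⟨h'.cont, h'.clamped, h'.sup, h'.hol⟩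

theorem Ht.add (h : Ht T α γ S H g) (h' : Ht T α γ S' H' g') :
    Ht T α γ (S + S') (H + H') (fun x t => g x t + g' x t) where
  cont := h.cont.add h'.cont
  clamped x s := by rw [h.clamped, h'.clamped]
  sup s hs x := (norm_add_le _ _).trans (by
    rw [add_mul]; exact add_le_add (h.sup s hs x) (h'.sup s hs x))
  hol s hs x y := by
    rw [add_sub_add_comm, add_mul, add_mul]
    exact (norm_add_le _ _).trans (add_le_add (h.hol s hs x y) (h'.hol s hs x y))

theorem Ht.neg (h : Ht T α γ S H g) : Ht T α γ S H (fun x t => -g x t) where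
  cont := h.cont.neg
  clamped x s := by rw [h.clamped]
  sup s hs x := by rw [norm_neg]; exact h.sup s hs x
  hol s hs x y := by
    rw [neg_sub_neg, norm_sub_rev]
    exact h.hol s hs x y

theorem Ht.sub (h : Ht T α γ S H g) (h' : Ht T α γ S' H' g') :
    Ht T α γ (S + S') (H + H') (fun x t => g x t - g' x t) := by
  simpa only [sub_eq_add_neg] using h.add h'.neg

theorem ht_zero : Ht T α γ 0 0 (fun (_ : Vec n) (_ : ℝ) => (0 : E)) where
  cont := continuous_const
  clamped _ _ := rfl
  sup s _ x := by simp
  hol s _ x y := by simp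

theorem ht_const (e : E) : Ht T α 0 ‖e‖ 0 (fun (_ : Vec n) (_ : ℝ) => e) where
  cont := continuous_const
  clamped _ _ := rfl
  sup s _ x := by simp
  hol s _ x y := by simp

theorem Ht.sum {ι : Type*} (u : Finset ι) {S H : ι → ℝ} {g : ι → Vec n → ℝ → E}
    (h : ∀ i ∈ u, Ht T α γ (S i) (H i) (g i)) :
    Ht T α γ (∑ i ∈ u, S i) (∑ i ∈ u, H i) (fun x t => ∑ i ∈ u, g i x t) := by
  classical
  induction u using Finset.induction_on with
  | empty => simpa using ht_zero
  | insert i u hi ih =>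
    simp only [Finset.sum_insert hi]
    exact (h i (Finset.mem_insert_self _ _)).add (ih fun j hj => h j (Finset.mem_insert_of_mem hj))

/-- Products. -/
theorem Ht.bilin (B : E →L[ℝ] F →L[ℝ] G) (hB : ∀ a b, ‖B a b‖ ≤ ‖a‖ * ‖b‖) (hT : 0 ≤ T)
    {u : Vec n → ℝ → F} (h : Ht T α 0 S H g) (h' : Ht T α γ S' H' u) :
    Ht T α γ (S * S') (S * H' + H * S') (fun x t => B (g x t) (u x t)) where
  cont := (B.continuous.comp h.cont).clm_apply h'.cont
  clamped x s := by rw [h.clamped, h'.clamped]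
  sup s hs x := by
    have h1 := h.sup s hs x
    rw [zero_mul, Real.exp_zero, mul_one] at h1
    refine (hB _ _).trans ?_
    rw [mul_assoc]
    exact mul_le_mul h1 (h'.sup s hs x) (norm_nonneg _) (h.sup_nonneg hT)
  hol s hs x y := by
    have h1 := h.sup s hs x
    have h2 := h.hol s hs x y
    rw [zero_mul, Real.exp_zero, mul_one] at h1 h2
    have e : B (g x s) (u x s) - B (g y s) (u y s) =
        B (g x s) (u x s - u y s) + B (g x s - g y s) (u y s) := by
      simp [map_sub, sub_apply]
    rw [e]
    calc _ ≤ ‖g x s‖ * ‖u x s - u y s‖ + ‖g x s - g y s‖ * ‖u y s‖ :=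
          (norm_add_le _ _).trans (add_le_add (hB _ _) (hB _ _))
      _ ≤ S * (H' * Real.exp (γ * s) * ‖x - y‖ ^ α) +
          (H * ‖x - y‖ ^ α) * (S' * Real.exp (γ * s)) := by
          refine add_le_add (mul_le_mul h1 (h'.hol s hs x y) (norm_nonneg _) (h.sup_nonneg hT))
            (mul_le_mul h2 (h'.sup s hs y) (norm_nonneg _) ((norm_nonneg _).trans h2))
      _ = _ := by ring

theorem Ht.clm (hT : 0 ≤ T) {a : Vec n → ℝ → E →L[ℝ] F} {u : Vec n → ℝ → E}
    (h : Ht T α 0 S H a) (h' : Ht T α γ S' H' u) :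
    Ht T α γ (S * S') (S * H' + H * S') (fun x t => a x t (u x t)) :=
  h.bilin (ContinuousLinearMap.id ℝ (E →L[ℝ] F)) (fun a b => a.le_opNorm b) hT h'

theorem Ht.smul (hT : 0 ≤ T) {a : Vec n → ℝ → ℝ} {u : Vec n → ℝ → E}
    (h : Ht T α 0 S H a) (h' : Ht T α γ S' H' u) :
    Ht T α γ (S * S') (S * H' + H * S') (fun x t => a x t • u x t) :=
  h.bilin (ContinuousLinearMap.lsmul ℝ ℝ) (fun a b => (norm_smul a b).le) hT h'

theorem Ht.const_smul (h : Ht T α γ S H g) (c : ℝ) :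
    Ht T α γ (|c| * S) (|c| * H) (fun x t => c • g x t) where
  cont := h.cont.fun_const_smul c
  clamped x s := by rw [h.clamped]
  sup s hs x := by
    rw [norm_smul, Real.norm_eq_abs, mul_assoc]
    exact mul_le_mul_of_nonneg_left (h.sup s hs x) (abs_nonneg _)
  hol s hs x y := by
    rw [← smul_sub, norm_smul, Real.norm_eq_abs, mul_assoc |c|, mul_assoc |c|]
    exact mul_le_mul_of_nonneg_left (h.hol s hs x y) (abs_nonneg _)

theorem le_rpow_of_le_of_le {d L S q : ℝ} (hL : 0 ≤ L) (hS : 0 ≤ S) (hα0 : 0 < α) (hα1 : α < 1)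
    (hq : 0 ≤ q) (h1 : d ≤ L * q) (h2 : d ≤ S) : d ≤ (L + S) * q ^ α := by
  have hq' := Real.rpow_nonneg hq α
  rcases le_total q 1 with h | h
  · have : q ≤ q ^ α := by
      simpa using Real.rpow_le_rpow_of_exponent_ge' hq h hα0.le hα1.le
    nlinarith
  · have : 1 ≤ q ^ α := Real.one_le_rpow h hα0.le
    nlinarith

/-- A piecewise linear bump function. -/
def bump (q : ℝ) : ℝ := max 0 (min 1 (2 - q))

theorem bump_nonneg (q : ℝ) : 0 ≤ bump q := le_max_left _ _
theorem bump_le_one (q : ℝ) : bump q ≤ 1 := max_le zero_le_one (min_le_left _ _)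
theorem bump_eq_one {q : ℝ} (h : q ≤ 1) : bump q = 1 := by
  rw [bump, min_eq_left (by linarith), max_eq_right zero_le_one]
theorem bump_eq_zero {q : ℝ} (h : 2 ≤ q) : bump q = 0 := by
  rw [bump, min_eq_right (by linarith), max_eq_left (by linarith)]
theorem abs_bump_sub_le (p q : ℝ) : |bump p - bump q| ≤ |p - q| := by
  refine (abs_max_sub_max_le_max _ _ _ _).trans (max_le (by simp) ?_)
  refine (abs_min_sub_min_le_max _ _ _ _).trans (max_le (by simp) ?_)
  rw [sub_sub_sub_cancel_left, abs_sub_comm]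
theorem continuous_bump : Continuous bump := by unfold bump; fun_prop

/-- Lipschitz cutoff function around a space-time point. -/
def cut (T δ : ℝ) (x₀ : Vec n) (t₀ : ℝ) (x : Vec n) (t : ℝ) : ℝ :=
  bump (‖x - x₀‖ / δ) * bump (|clamp T t - t₀| / δ)

variable {δ : ℝ} {x₀ : Vec n} {t₀ : ℝ}

theorem cut_nonneg (x : Vec n) (t : ℝ) : 0 ≤ cut T δ x₀ t₀ x t :=
  mul_nonneg (bump_nonneg _) (bump_nonneg _)

theorem cut_le_one (x : Vec n) (t : ℝ) : cut T δ x₀ t₀ x t ≤ 1 :=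
  mul_le_one₀ (bump_le_one _) (bump_nonneg _) (bump_le_one _)

theorem cut_eq_one (hδ : 0 < δ) {x : Vec n} {t : ℝ} (hx : ‖x - x₀‖ ≤ δ)
    (ht : |clamp T t - t₀| ≤ δ) : cut T δ x₀ t₀ x t = 1 := by
  rw [cut, bump_eq_one ((div_le_one hδ).2 hx), bump_eq_one ((div_le_one hδ).2 ht), one_mul]

theorem cut_eq_zero (hδ : 0 < δ) {x : Vec n} {t : ℝ}
    (h : ¬ (‖x - x₀‖ < 2 * δ ∧ |clamp T t - t₀| < 2 * δ)) : cut T δ x₀ t₀ x t = 0 := by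
  rw [not_and_or, not_lt, not_lt] at h
  rcases h with h | h
  · rw [cut, bump_eq_zero ((le_div_iff₀ hδ).2 h), zero_mul]
  · rw [cut, bump_eq_zero ((le_div_iff₀ hδ).2 h), mul_zero]

theorem ht_cut (hT : 0 ≤ T) (hα0 : 0 < α) (hα1 : α < 1) (hδ : 0 < δ) :
    Ht T α 0 1 (δ⁻¹ + 1) (cut T δ x₀ t₀) where
  cont := by
    refine (continuous_bump.comp (by fun_prop)).mul (continuous_bump.comp ?_)
    exact ((((continuous_clamp T).comp continuous_snd).sub continuous_const).abs).div_const δ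
  clamped x s := by rw [cut, cut, clamp_clamp hT]
  sup s _ x := by
    rw [zero_mul, Real.exp_zero, mul_one, Real.norm_of_nonneg (cut_nonneg _ _)]
    exact cut_le_one _ _
  hol s _ x y := by
    rw [zero_mul, Real.exp_zero, mul_one, Real.norm_eq_abs]
    refine le_rpow_of_le_of_le (by positivity) zero_le_one hα0 hα1 (norm_nonneg _) ?_ ?_
    · rw [cut, cut, ← sub_mul, abs_mul, abs_of_nonneg (bump_nonneg (|clamp T s - t₀| / δ))]
      calc _ ≤ |bump (‖x - x₀‖ / δ) - bump (‖y - x₀‖ / δ)| * 1 := by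
            gcongr
            exact bump_le_one _
        _ ≤ |‖x - x₀‖ / δ - ‖y - x₀‖ / δ| := by rw [mul_one]; exact abs_bump_sub_le _ _
        _ = δ⁻¹ * |‖x - x₀‖ - ‖y - x₀‖| := by
            rw [← sub_div, abs_div, abs_of_pos hδ, div_eq_inv_mul]
        _ ≤ _ := by
            gcongr
            simpa using abs_norm_sub_norm_le (x - x₀) (y - x₀)
    · exact abs_sub_le_of_nonneg_of_le (cut_nonneg _ _) (cut_le_one _ _) (cut_nonneg _ _)
        (cut_le_one _ _)

/-- Localized coefficients are small if the coefficients are small near the base point. -/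
theorem Ht.cut_smul (hT : 0 ≤ T) (hα0 : 0 < α) (hα1 : α < 1) (hδ : 0 < δ) {ε : ℝ} (hε : 0 ≤ ε)
    (h : Ht T α 0 S H g)
    (hs : ∀ x, ∀ t ∈ Icc 0 T, ‖x - x₀‖ < 2 * δ → |t - t₀| < 2 * δ → ‖g x t‖ ≤ ε) :
    Ht T α 0 ε (H + (δ⁻¹ + 1) * S) (fun x t => cut T δ x₀ t₀ x t • g x t) where
  cont := (Ht.smul hT (ht_cut (x₀ := x₀) (t₀ := t₀) hT hα0 hα1 hδ) h).cont
  clamped := (Ht.smul hT (ht_cut (x₀ := x₀) (t₀ := t₀) hT hα0 hα1 hδ) h).clamped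
  hol := by
    have := (Ht.smul hT (ht_cut (x₀ := x₀) (t₀ := t₀) hT hα0 hα1 hδ) h).hol
    simpa only [one_mul] using this
  sup t ht x := by
    rw [zero_mul, Real.exp_zero, mul_one, norm_smul, Real.norm_of_nonneg (cut_nonneg _ _)]
    by_cases hx : ‖x - x₀‖ < 2 * δ ∧ |clamp T t - t₀| < 2 * δ
    · rw [clamp_eq ht] at hx
      exact (mul_le_of_le_one_left (norm_nonneg _) (cut_le_one _ _)).trans (hs x t ht hx.1 hx.2)
    · rw [cut_eq_zero hδ hx, zero_mul]
      exact hε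

end Holder

section LocalEst
variable {n l r : ℕ} {α T γ : ℝ}

/-- The terms of order `k < m` of a linear operator applied to a function with derivatives `U`. -/
def Lop (m : ℕ) (𝒜 : (k : ℕ) → (Fin k → Fin n) → Vec n → ℝ → Mat l)
    (U : (k : ℕ) → (Fin k → Fin n) → Vec n → ℝ → Vec l) (x : Vec n) (t : ℝ) : Vec l :=
  ∑ k ∈ Finset.range m, ∑ I, 𝒜 k I x t (U k I x t)

theorem lop_succ (m : ℕ) (𝒜 : (k : ℕ) → (Fin k → Fin n) → Vec n → ℝ → Mat l)
    (U : (k : ℕ) → (Fin k → Fin n) → Vec n → ℝ → Vec l) (x : Vec n) (t : ℝ) :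
    Lop (m + 1) 𝒜 U x t = Lop m 𝒜 U x t + ∑ I, 𝒜 m I x t (U m I x t) :=
  Finset.sum_range_succ _ _

/-- Hölder coefficients. -/
def Coef (r : ℕ) (T α H : ℝ) (𝒜 : (k : ℕ) → (Fin k → Fin n) → Vec n → ℝ → Mat l) : Prop :=
  ∀ k, k ≤ r → ∀ I, Ht T α 0 H H (𝒜 k I)

/-- Solutions of a variable coefficient problem together with quantitative bounds. -/
structure Sol (r : ℕ) (T α : ℝ) (𝒜 : (k : ℕ) → (Fin k → Fin n) → Vec n → ℝ → Mat l)
    (γ Nf W M : ℝ) (U : (k : ℕ) → (Fin k → Fin n) → Vec n → ℝ → Vec l)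
    (f : Vec n → ℝ → Vec l) : Prop where
  sol : IsSol r T 0 U (fun x t => f x t + Lop (r + 1) 𝒜 U x t)
  f_wt : Wt T α γ Nf f
  W_nonneg : 0 ≤ W
  M_nonneg : 0 ≤ M
  sup : ∀ k, k ≤ r → ∀ I, ∀ s ∈ Icc 0 T, ∀ x, ‖U k I x s‖ ≤ W * Real.exp (γ * s)
  hol : ∀ I : Fin r → Fin n, ∀ s ∈ Icc 0 T, ∀ x y,
    ‖U r I x s - U r I y s‖ ≤ M * Real.exp (γ * s) * ‖x - y‖ ^ α

variable {A : (Fin r → Fin n) → Mat l} {K : 𝓢(Vec n, Mat l)} {C : ℝ}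
  {𝒜 : (k : ℕ) → (Fin k → Fin n) → Vec n → ℝ → Mat l} {Nf W M H : ℝ}
  {U : (k : ℕ) → (Fin k → Fin n) → Vec n → ℝ → Vec l} {f : Vec n → ℝ → Vec l}

theorem IsSol.congr {A' : (Fin r → Fin n) → Mat l} {g g' : Vec n → ℝ → Vec l}
    (h : IsSol r T A U g) (hg : ∀ x, ∀ t ∈ Icc 0 T,
      ∑ I, A I (U r I x t) + g x t = ∑ I, A' I (U r I x t) + g' x t) : IsSol r T A' U g' where
  cont := h.cont
  clamped := h.clamped
  bdd := h.bdd
  fderiv := h.fderiv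
  init := h.init
  time I₀ x t ht := (h.time I₀ x t ht).congr_deriv (hg x t ht)

theorem norm_sub_le_of_grad {u : Vec n → Vec l} {v : Fin n → Vec n → Vec l} (hα0 : 0 < α)
    (hα1 : α < 1) (hW : 0 ≤ W) (hd : ∀ x, HasFDerivAt u (grad fun i => v i x) x)
    (hu : ∀ x, ‖u x‖ ≤ W) (hv : ∀ i x, ‖v i x‖ ≤ W) (x y : Vec n) :
    ‖u x - u y‖ ≤ (n + 2) * W * ‖x - y‖ ^ α := by
  have h1 : ‖u x - u y‖ ≤ n * W * ‖x - y‖ :=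
    Convex.norm_image_sub_le_of_norm_hasFDerivWithin_le (s := univ)
      (fun z _ => (hd z).hasFDerivWithinAt) (fun z _ => norm_grad_le fun i => hv i z) convex_univ
      (mem_univ _) (mem_univ _)
  have h2 : ‖u x - u y‖ ≤ 2 * W := (norm_sub_le _ _).trans (by linarith [hu x, hu y])
  exact (le_rpow_of_le_of_le (by positivity) (by positivity) hα0 hα1 (norm_nonneg _) h1
    h2).trans (le_of_eq (by ring))

/-- Derivatives of lower order are Hölder continuous. -/
theorem IsSol.ht_of_lt {g : Vec n → ℝ → Vec l} (h : IsSol r T A U g) (hα0 : 0 < α) (hα1 : α < 1)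
    (hW : 0 ≤ W)
    (hs : ∀ k, k ≤ r → ∀ I, ∀ s ∈ Icc 0 T, ∀ x, ‖U k I x s‖ ≤ W * Real.exp (γ * s))
    {k : ℕ} (hk : k < r) (I : Fin k → Fin n) : Ht T α γ W ((n + 2) * W) (U k I) where
  cont := h.cont k hk.le I
  clamped := h.clamped k hk.le I
  sup s hs' x := hs k hk.le I s hs' x
  hol s hs' x y := (norm_sub_le_of_grad hα0 hα1 (by positivity) (fun z => h.fderiv k hk I z s)
    (hs k hk.le I s hs') (fun _ => hs (k + 1) hk _ s hs') x y).trans (le_of_eq (by ring))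

theorem Sol.ht_top (h : Sol r T α 𝒜 γ Nf W M U f) (I : Fin r → Fin n) :
    Ht T α γ W M (U r I) :=
  ⟨h.sol.cont r le_rfl I, h.sol.clamped r le_rfl I, h.sup r le_rfl I, h.hol I⟩

/-- The number of multi-indices of length less than `m`. -/
def cnt (n m : ℕ) : ℝ := ∑ k ∈ Finset.range m, (Fintype.card (Fin k → Fin n) : ℝ)

theorem cnt_nonneg (n m : ℕ) : 0 ≤ cnt n m := Finset.sum_nonneg fun _ _ => Nat.cast_nonneg _

theorem ht_lop (hT : 0 ≤ T) {m : ℕ} {S S' H' : ℝ}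
    (h𝒜 : ∀ k < m, ∀ I, Ht T α 0 S H (𝒜 k I)) (hU : ∀ k < m, ∀ I, Ht T α γ S' H' (U k I)) :
    Ht T α γ (cnt n m * (S * S')) (cnt n m * (S * H' + H * S')) (Lop m 𝒜 U) := by
  have := Ht.sum (Finset.range m) fun k hk => Ht.sum (Finset.univ : Finset (Fin k → Fin n))
    fun I _ => (h𝒜 k (Finset.mem_range.1 hk) I).clm hT (hU k (Finset.mem_range.1 hk) I)
  simp only [Finset.sum_const, nsmul_eq_mul, ← Finset.sum_mul, Finset.card_univ] at this
  exact this

set_option maxHeartbeats 1000000 in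
theorem Sol.exists_local (hK : IsKer r A K) (hE : HeatEst r α T C K) (hr : 2 ≤ r) (hα0 : 0 < α)
    (hα1 : α < 1) (hT : 0 ≤ T) (hH : 0 ≤ H) {η : ℝ} (hη : 0 < η) :
    ∃ ε, 0 < ε ∧ ∀ δ, 0 < δ → δ ≤ 1 → ∃ Cs, 0 ≤ Cs ∧
      ∀ (𝒜 : (k : ℕ) → (Fin k → Fin n) → Vec n → ℝ → Mat l) (γ Nf W M : ℝ)
        (U : (k : ℕ) → (Fin k → Fin n) → Vec n → ℝ → Vec l) (f : Vec n → ℝ → Vec l)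
        (x₀ : Vec n) (t₀ : ℝ), t₀ ∈ Icc 0 T → Coef r T α H 𝒜 → 0 ≤ γ →
        (∀ I x, ∀ t ∈ Icc 0 T, ‖x - x₀‖ < 2 * δ → |t - t₀| < 2 * δ → ‖𝒜 r I x t - A I‖ ≤ ε) →
        Sol r T α 𝒜 γ Nf W M U f → ∀ I : Fin r → Fin n, ∀ t ∈ Icc 0 T, |t - t₀| < δ / 2 →
        ∀ x y, ‖x - x₀‖ < δ / 4 →
        ‖U r I x t - U r I y t‖ ≤ (η * M + Cs * (Nf + W)) * Real.exp (γ * t) * ‖x - y‖ ^ α := by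
  have hr0 : (0 : ℝ) < r := by positivity
  have hC := hE.nonneg
  set c : ℝ := (r / α + r / (1 - α)) * (2 * C) with hc
  have hc0 : 0 ≤ c := by
    have : 0 < 1 - α := by linarith
    positivity
  set m' : ℝ := (Fintype.card (Fin r → Fin n) : ℝ) with hm'
  have hm'0 : 0 ≤ m' := Nat.cast_nonneg _
  set m := cnt n r with hm
  have hm0 : 0 ≤ m := cnt_nonneg _ _
  set HA : ℝ := H + ∑ I, ‖A I‖ with hHA
  have hHA0 : 0 ≤ HA := by positivity
  refine ⟨η / (c * m' + 1), by positivity, fun δ hδ hδ1 => ?_⟩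
  set ε := η / (c * m' + 1) with hε
  have hε0 : 0 < ε := by positivity
  have hcε : c * (m' * ε) ≤ η := by
    rw [hε, ← mul_assoc, mul_div_assoc', div_le_iff₀ (by positivity)]
    nlinarith
  obtain ⟨D, hD, hfar⟩ := exists_duh_far hE hr hα0 hT hδ
  set d : ℝ := δ⁻¹ + 1 with hd
  have hd0 : 0 ≤ d := by positivity
  set C1 : ℝ := (1 + d) + m * H * (n + 3 + d) + m' * (ε + H + d * HA) with hC1
  set C2 : ℝ := 2 * (1 + m * H + m' * HA) with hC2
  have hC10 : 0 ≤ C1 := by positivity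
  have hC20 : 0 ≤ C2 := by positivity
  refine ⟨c * C1 + D * C2 + 8 / δ, by positivity, ?_⟩
  intro 𝒜 γ Nf W M U f x₀ t₀ ht₀ h𝒜 hγ hsmall h I t ht htt x y hx
  have hW := h.W_nonneg
  have hM := h.M_nonneg
  have hNf := h.f_wt.nonneg hT
  -- the right-hand side for the frozen operator
  have hAI : ∀ I, Ht T α 0 HA H (fun x t => 𝒜 r I x t - A I) := fun I =>
    ((h𝒜 r le_rfl I).sub (ht_const (A I))).mono
      (by
        rw [hHA]
        gcongr
        exact Finset.single_le_sum (f := fun I => ‖A I‖) (fun _ _ => norm_nonneg _)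
          (Finset.mem_univ I)) (by simp)
  have hlow : Ht T α γ (m * (H * W)) (m * (H * ((n + 2) * W) + H * W)) (Lop r 𝒜 U) :=
    ht_lop hT (fun k hk I => h𝒜 k hk.le I) fun k hk I => h.sol.ht_of_lt hα0 hα1 hW h.sup hk I
  set top : Vec n → ℝ → Vec l := fun x t => ∑ I, (𝒜 r I x t - A I) (U r I x t) with htop
  have htopHt : Ht T α γ (m' * (HA * W)) (m' * (HA * M + H * W)) top := by
    have := Ht.sum Finset.univ fun I _ => (hAI I).clm hT (h.ht_top I)
    simpa only [Finset.sum_const, nsmul_eq_mul, Finset.card_univ] using this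
  set g : Vec n → ℝ → Vec l := fun x t => f x t + Lop r 𝒜 U x t + top x t with hg
  have hgHt := (h.f_wt.ht.add hlow).add htopHt
  have hgsol : IsSol r T A U g := h.sol.congr fun x t _ => by
    simp only [hg, htop, lop_succ, Pi.zero_apply, zero_apply, Finset.sum_const_zero, zero_add,
      sub_apply, Finset.sum_sub_distrib]
    abel
  -- localization
  have hcut := ht_cut (x₀ := x₀) (t₀ := t₀) hT hα0 hα1 hδ
  set χ := cut T δ x₀ t₀ with hχ
  set g1 : Vec n → ℝ → Vec l := fun x t => χ x t • f x t + χ x t • Lop r 𝒜 U x t +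
    ∑ I, (χ x t • (𝒜 r I x t - A I)) (U r I x t) with hg1
  set g2 : Vec n → ℝ → Vec l := fun x t => (1 - χ x t) • g x t with hg2
  have hg12 : g = fun x t => g1 x t + g2 x t := by
    funext x t
    simp only [hg, hg1, hg2, htop, smul_apply, ← Finset.smul_sum]
    module
  have hg1Wt : Wt T α γ (m' * ε * M + C1 * (Nf + W)) g1 := by
    have h1 := Ht.sum Finset.univ fun I _ =>
      ((hAI I).cut_smul hT hα0 hα1 hδ hε0.le (hsmall I)).clm hT (h.ht_top I)
    simp only [Finset.sum_const, nsmul_eq_mul, Finset.card_univ] at h1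
    have h2 := ((hcut.smul hT h.f_wt.ht).add (hcut.smul hT hlow)).add h1
    have e1 : 0 ≤ m' * ε * M := by positivity
    refine h2.wt ?_ ?_
    · rw [← sub_nonneg]
      have : m' * ε * M + C1 * (Nf + W) - (1 * Nf + 1 * (m * (H * W)) + m' * (ε * W)) =
        m' * ε * M + (d + m * H * (n + 3 + d) + m' * (ε + H + d * HA)) * Nf +
          (1 + d + m * H * (n + 2 + d) + m' * (H + d * HA)) * W := by rw [hC1]; ring
      rw [this]
      positivity
    · rw [← sub_nonneg]
      have : m' * ε * M + C1 * (Nf + W) - (1 * Nf + d * Nf + (1 * (m * (H * ((n + 2) * W) + H * W))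
          + d * (m * (H * W))) + m' * (ε * M + (H + d * HA) * W)) =
        (m * H * (n + 3 + d) + m' * (ε + H + d * HA)) * Nf +
          (1 + d + m' * ε) * W := by rw [hC1]; ring
      rw [this]
      positivity
  have h1χ : Ht T α 0 (‖(1 : ℝ)‖ + 1) (0 + d) (fun x t => 1 - χ x t) := (ht_const 1).sub hcut
  have hg2Ht := h1χ.smul hT hgHt
  have hg2Wt := hg2Ht.wt (le_max_left _ _) (le_max_right _ _)
  have hg2sup : ∀ s ∈ Icc 0 T, ∀ x, ‖g2 x s‖ ≤ C2 * (Nf + W) * Real.exp (γ * s) := by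
    intro s hs x
    refine (hg2Ht.sup s hs x).trans (mul_le_mul_of_nonneg_right ?_ (Real.exp_pos _).le)
    rw [norm_one, hC2]
    have : 0 ≤ (m * H + m' * HA) * Nf + W := by positivity
    nlinarith
  have hrep : ∀ z, U r I z t = duh r K I g1 z t + duh r K I g2 z t := fun z => by
    have hgW := hgHt.wt (le_max_left _ _) (le_max_right _ _)
    have e1 : U r I z t = vfam r T K g r I z t :=
      hgsol.unique hr hT hK (isSol_vfam hK hE hr hα0 hα1 hT hγ hgW) le_rfl I z t
    have e2 := vfam_add hE hr hα0 hT hγ hg1Wt hg2Wt le_rfl I z t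
    rw [← hg12] at e2
    rw [e1, e2, vfam, vfam, clamp_eq ht]
  have hq := norm_nonneg (x - y)
  have hqα := Real.rpow_nonneg hq α
  rcases lt_or_ge ‖x - y‖ (δ / 4) with hxy | hxy
  · have hy : ‖y - x₀‖ < δ / 2 := by
      have := norm_add_le (y - x) (x - x₀)
      rw [sub_add_sub_cancel, norm_sub_rev y x] at this
      linarith
    have e1 := norm_duh_sub_le hE hr hα0 hα1 hγ hg1Wt le_rfl I ht x y
    have e2 := hfar γ _ (C2 * (Nf + W)) g2 x₀ t₀ hγ hg2Wt hg2sup (fun s z hz hs => by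
      rw [hg2]
      dsimp only
      rw [hχ, cut_eq_one hδ hz.le, sub_self, zero_smul]
      rw [← clamp_eq ht₀]
      exact (abs_clamp_sub_le T s t₀).trans hs.le) I t ht htt x y (by linarith) hy
    have e3 : ‖x - y‖ ≤ ‖x - y‖ ^ α := by
      simpa using Real.rpow_le_rpow_of_exponent_ge' hq (by linarith) hα0.le hα1.le
    rw [hrep x, hrep y, add_sub_add_comm]
    calc _ ≤ c * (m' * ε * M + C1 * (Nf + W)) * Real.exp (γ * t) * ‖x - y‖ ^ α +
          D * (C2 * (Nf + W)) * Real.exp (γ * t) * ‖x - y‖ ^ α := by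
          refine (norm_add_le _ _).trans (add_le_add e1 (e2.trans ?_))
          gcongr
      _ = (c * (m' * ε) * M + (c * C1 + D * C2) * (Nf + W)) * Real.exp (γ * t) *
          ‖x - y‖ ^ α := by ring
      _ ≤ _ := by
          refine mul_le_mul_of_nonneg_right (mul_le_mul_of_nonneg_right ?_ (Real.exp_pos _).le) hqα
          refine add_le_add (mul_le_mul_of_nonneg_right hcε hM)
            (mul_le_mul_of_nonneg_right ?_ (by positivity))
          exact le_add_of_nonneg_right (by positivity)
  · have e1 : δ / 4 ≤ ‖x - y‖ ^ α := calc
      δ / 4 ≤ (δ / 4) ^ α := by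
        simpa using Real.rpow_le_rpow_of_exponent_ge' (by positivity) (by linarith) hα0.le hα1.le
      _ ≤ _ := by gcongr
    have e2 := h.sup r le_rfl I t ht x
    have e3 := h.sup r le_rfl I t ht y
    calc _ ≤ 2 * W * Real.exp (γ * t) := by
          refine (norm_sub_le _ _).trans ?_
          linarith
      _ = (8 / δ) * W * Real.exp (γ * t) * (δ / 4) := by field_simp; ring
      _ ≤ (8 / δ) * W * Real.exp (γ * t) * ‖x - y‖ ^ α := by gcongr
      _ ≤ _ := by
          refine mul_le_mul_of_nonneg_right (mul_le_mul_of_nonneg_right ?_ (Real.exp_pos _).le) hqα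
          have : 0 ≤ η * M + (c * C1 + D * C2) * (Nf + W) + 8 / δ * Nf := by positivity
          nlinarith

end LocalEst

section Compactness
variable {n l r : ℕ} {α T γ H : ℝ}

/-- Every point is equivalent to a point of a fixed ball modulo integer translations. -/
theorem exists_int_translate (x : Vec n) : ∃ m : Fin n → ℤ,
    x + (EuclideanSpace.equiv (Fin n) ℝ).symm (fun i => (m i : ℝ)) ∈
      Metric.closedBall (0 : Vec n) n := by
  refine ⟨fun i => -⌊x i⌋, ?_⟩
  rw [mem_closedBall_zero_iff]
  set z : Vec n := x + (EuclideanSpace.equiv (Fin n) ℝ).symm fun i => ((-⌊x i⌋ : ℤ) : ℝ) with hz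
  have hzi : ∀ i, ‖z i • (ee i : Vec n)‖ ≤ 1 := fun i => by
    have e : z i = Int.fract (x i) := by
      rw [hz, Int.fract]
      simp [sub_eq_add_neg]
    rw [norm_smul, e, Real.norm_of_nonneg (Int.fract_nonneg _)]
    simp only [ee, PiLp.norm_single, norm_one, mul_one]
    exact (Int.fract_lt_one _).le
  have : z = ∑ i, z i • (ee i : Vec n) := by
    simpa [ee] using ((EuclideanSpace.basisFun (Fin n) ℝ).sum_repr z).symm
  rw [this]
  exact (norm_sum_le_of_le _ fun i _ => hzi i).trans (by simp)

/-- Periodic, uniformly elliptic coefficient families with Hölder bound `H`. -/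
structure Data (r : ℕ) (T α H : ℝ) (𝒜 : (k : ℕ) → (Fin k → Fin n) → Vec n → ℝ → Mat l) :
    Prop where
  coef : Coef r T α H 𝒜
  per : ∀ k, k ≤ r → ∀ I, PerZ (𝒜 k I)
  ell : ∃ c > 0, ∀ x, ∀ t ∈ Icc 0 T, ∀ (ξ : Vec n) (v : Vec l), c * ‖ξ‖ ^ r * ‖v‖ ^ 2 ≤
    (-1 : ℝ) ^ (r / 2 - 1) * ∑ I : Fin r → Fin n, (∏ j, ξ (I j)) * inner ℝ (𝒜 r I x t v) v

/-- The segment joining the operator to its principal part frozen at the origin. -/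
def mix (r : ℕ) (s : ℝ) (𝒜 : (k : ℕ) → (Fin k → Fin n) → Vec n → ℝ → Mat l) (k : ℕ)
    (I : Fin k → Fin n) (x : Vec n) (t : ℝ) : Mat l :=
  (1 - s) • (if k = r then 𝒜 k I 0 0 else 0) + s • 𝒜 k I x t

variable {𝒜 : (k : ℕ) → (Fin k → Fin n) → Vec n → ℝ → Mat l}

theorem mix_top (s : ℝ) (I : Fin r → Fin n) (x : Vec n) (t : ℝ) :
    mix r s 𝒜 r I x t = (1 - s) • 𝒜 r I 0 0 + s • 𝒜 r I x t := by
  rw [mix, if_pos rfl]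

theorem Data.coef_mix (hT : 0 ≤ T) (h : Data r T α H 𝒜) {s : ℝ} (hs : s ∈ Icc (0 : ℝ) 1) :
    Coef r T α H (mix r s 𝒜) := fun k hk I => by
  have hH := (h.coef k hk I).sup_nonneg hT
  have h1 : Ht T α 0 H 0 (fun (_ : Vec n) (_ : ℝ) => if k = r then 𝒜 k I 0 0 else 0) := by
    refine (ht_const _).mono ?_ le_rfl
    split_ifs
    · simpa using (h.coef k hk I).sup 0 ⟨le_rfl, hT⟩ 0
    · simpa using hH
  refine ((h1.const_smul (1 - s)).add ((h.coef k hk I).const_smul s)).mono ?_ ?_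
  · rw [abs_of_nonneg (sub_nonneg.2 hs.2), abs_of_nonneg hs.1]
    exact le_of_eq (by ring)
  · rw [abs_of_nonneg hs.1]
    nlinarith [hs.2]

theorem Data.ell_mix (hT : 0 ≤ T) (h : Data r T α H 𝒜) {s t : ℝ} (hs : s ∈ Icc (0 : ℝ) 1)
    (ht : t ∈ Icc 0 T) (x : Vec n) : EllC r fun I => mix r s 𝒜 r I x t := by
  obtain ⟨c, hc, hell⟩ := h.ell
  refine ⟨c, hc, fun ξ v => ?_⟩
  have h1 := mul_le_mul_of_nonneg_left (hell 0 0 ⟨le_rfl, hT⟩ ξ v) (sub_nonneg.2 hs.2)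
  have h2 := mul_le_mul_of_nonneg_left (hell x t ht ξ v) hs.1
  have e : ∑ I : Fin r → Fin n, (∏ j, ξ (I j)) * inner ℝ (mix r s 𝒜 r I x t v) v =
      (1 - s) * ∑ I : Fin r → Fin n, (∏ j, ξ (I j)) * inner ℝ (𝒜 r I 0 0 v) v +
        s * ∑ I : Fin r → Fin n, (∏ j, ξ (I j)) * inner ℝ (𝒜 r I x t v) v := by
    rw [Finset.mul_sum, Finset.mul_sum, ← Finset.sum_add_distrib]
    refine Finset.sum_congr rfl fun I _ => ?_
    rw [mix_top, add_apply, smul_apply, smul_apply, inner_add_left, real_inner_smul_left,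
      real_inner_smul_left]
    ring
  rw [e]
  linarith

theorem Data.continuous_mix (h : Data r T α H 𝒜) :
    Continuous fun p : ℝ × Vec n × ℝ => fun I : Fin r → Fin n => mix r p.1 𝒜 r I p.2.1 p.2.2 := by
  refine continuous_pi fun I => ?_
  simp only [mix_top]
  exact ((by fun_prop : Continuous fun p : ℝ × Vec n × ℝ => 1 - p.1).smul continuous_const).add
    (continuous_fst.smul ((h.coef r le_rfl I).cont.comp continuous_snd))

/-- Interior estimates are uniform in the homotopy parameter and the base point. -/
theorem Data.exists_global (h : Data r T α H 𝒜) (hr : 2 ≤ r) (hrev : Even r) (hα0 : 0 < α)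
    (hα1 : α < 1) (hT : 0 ≤ T) (hH : 0 ≤ H) {η : ℝ} (hη : 0 < η) :
    ∃ Cs, 0 ≤ Cs ∧ ∀ s ∈ Icc (0 : ℝ) 1, ∀ (γ Nf W M : ℝ)
      (U : (k : ℕ) → (Fin k → Fin n) → Vec n → ℝ → Vec l) (f : Vec n → ℝ → Vec l), 0 ≤ γ →
      Sol r T α (mix r s 𝒜) γ Nf W M U f → (∀ I : Fin r → Fin n, PerZ (U r I)) →
      ∀ (I : Fin r → Fin n), ∀ t ∈ Icc 0 T, ∀ x y,
        ‖U r I x t - U r I y t‖ ≤ (η * M + Cs * (Nf + W)) * Real.exp (γ * t) * ‖x - y‖ ^ α := by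
  let P : Set (ℝ × Vec n × ℝ) → Prop := fun S => ∃ Cs, 0 ≤ Cs ∧ ∀ p ∈ S, p.1 ∈ Icc (0 : ℝ) 1 →
    p.2.2 ∈ Icc 0 T → ∀ (γ Nf W M : ℝ)
      (U : (k : ℕ) → (Fin k → Fin n) → Vec n → ℝ → Vec l) (f : Vec n → ℝ → Vec l), 0 ≤ γ →
      Sol r T α (mix r p.1 𝒜) γ Nf W M U f → ∀ (I : Fin r → Fin n) y,
        ‖U r I p.2.1 p.2.2 - U r I y p.2.2‖ ≤
          (η * M + Cs * (Nf + W)) * Real.exp (γ * p.2.2) * ‖p.2.1 - y‖ ^ α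
  have hmono : ∀ {S : Set (ℝ × Vec n × ℝ)} {Cs Cs' : ℝ}, Cs ≤ Cs' →
      (∀ p ∈ S, p.1 ∈ Icc (0 : ℝ) 1 →
    p.2.2 ∈ Icc 0 T → ∀ (γ Nf W M : ℝ)
      (U : (k : ℕ) → (Fin k → Fin n) → Vec n → ℝ → Vec l) (f : Vec n → ℝ → Vec l), 0 ≤ γ →
      Sol r T α (mix r p.1 𝒜) γ Nf W M U f → ∀ (I : Fin r → Fin n) y,
        ‖U r I p.2.1 p.2.2 - U r I y p.2.2‖ ≤
          (η * M + Cs * (Nf + W)) * Real.exp (γ * p.2.2) * ‖p.2.1 - y‖ ^ α) →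
      ∀ p ∈ S, p.1 ∈ Icc (0 : ℝ) 1 →
    p.2.2 ∈ Icc 0 T → ∀ (γ Nf W M : ℝ)
      (U : (k : ℕ) → (Fin k → Fin n) → Vec n → ℝ → Vec l) (f : Vec n → ℝ → Vec l), 0 ≤ γ →
      Sol r T α (mix r p.1 𝒜) γ Nf W M U f → ∀ (I : Fin r → Fin n) y,
        ‖U r I p.2.1 p.2.2 - U r I y p.2.2‖ ≤
          (η * M + Cs' * (Nf + W)) * Real.exp (γ * p.2.2) * ‖p.2.1 - y‖ ^ α := by
    intro S Cs Cs' hC hS p hp hp1 hp2 γ Nf W M U f hγ hU I y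
    refine (hS p hp hp1 hp2 γ Nf W M U f hγ hU I y).trans ?_
    have := hU.W_nonneg
    have := hU.f_wt.nonneg hT
    gcongr
  have hcpt : IsCompact (Icc (0 : ℝ) 1 ×ˢ (Metric.closedBall (0 : Vec n) n ×ˢ Icc 0 T)) :=
    isCompact_Icc.prod ((isCompact_closedBall _ _).prod isCompact_Icc)
  have hP : P (Icc (0 : ℝ) 1 ×ˢ (Metric.closedBall (0 : Vec n) n ×ˢ Icc 0 T)) := by
    refine hcpt.induction_on (p := P) ⟨0, le_rfl, fun p hp => hp.elim⟩ ?_ ?_ ?_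
    · rintro S S' hS ⟨Cs, h0, hC⟩
      exact ⟨Cs, h0, fun p hp => hC p (hS hp)⟩
    · rintro S S' ⟨Cs, h0, hC⟩ ⟨Cs', h0', hC'⟩
      refine ⟨max Cs Cs', le_max_of_le_left h0, fun p hp => ?_⟩
      rcases hp with hp | hp
      · exact hmono (le_max_left _ _) hC p hp
      · exact hmono (le_max_right _ _) hC' p hp
    · rintro ⟨s₀, x₀, t₀⟩ ⟨hs₀, hx₀, ht₀⟩
      obtain ⟨K, hK⟩ := exists_isKer hr hrev _ (h.ell_mix hT hs₀ ht₀ x₀)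
      obtain ⟨C, hE⟩ := exists_heatEst (α := α) hα0 hα1 hr hT K
      obtain ⟨ε, hε, hloc⟩ := Sol.exists_local hK hE hr hα0 hα1 hT hH hη
      obtain ⟨δ', hδ', hcont⟩ := Metric.continuous_iff.1 h.continuous_mix (s₀, x₀, t₀) ε hε
      obtain ⟨Cs, hCs, hCs'⟩ := hloc (min 1 (δ' / 2)) (by positivity) (min_le_left _ _)
      set δ := min 1 (δ' / 2) with hδ
      have hδ0 : 0 < δ := by positivity
      have hδδ' : 2 * δ ≤ δ' := by
        have := min_le_right 1 (δ' / 2)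
        rw [← hδ] at this
        linarith
      refine ⟨Metric.ball s₀ δ' ×ˢ (Metric.ball x₀ (δ / 4) ×ˢ Metric.ball t₀ (δ / 2)),
        mem_nhdsWithin_of_mem_nhds (prod_mem_nhds (Metric.ball_mem_nhds _ hδ')
          (prod_mem_nhds (Metric.ball_mem_nhds _ (by positivity))
            (Metric.ball_mem_nhds _ (by positivity)))), Cs, hCs, ?_⟩
      rintro ⟨s, x, t⟩ ⟨hs, hx, ht⟩ hs1 htT γ Nf W M U f hγ hU I y
      simp only [Metric.mem_ball] at hs hx ht
      refine hCs' (mix r s 𝒜) γ Nf W M U f x₀ t₀ ht₀ (h.coef_mix hT hs1) hγ ?_ hU I t htT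
        (by rwa [← Real.dist_eq]) x y (by rwa [← dist_eq_norm])
      intro I' x' t' _ hx' htt'
      have := hcont (s, x', t') (by
        rw [Prod.dist_eq, Prod.dist_eq]
        refine max_lt hs (max_lt ?_ ?_)
        · rw [dist_eq_norm]; exact hx'.trans_le hδδ'
        · rw [Real.dist_eq]; exact htt'.trans_le hδδ')
      rw [← dist_eq_norm]
      exact (dist_le_pi_dist _ _ I').trans this.le
  obtain ⟨Cs, hCs, hCs'⟩ := hP
  refine ⟨Cs, hCs, fun s hs γ Nf W M U f hγ hU hper I t ht x y => ?_⟩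
  obtain ⟨m, hm⟩ := exists_int_translate x
  have := hCs' (s, _, t) ⟨hs, hm, ht⟩ hs ht γ Nf W M U f hγ hU I
    (y + (EuclideanSpace.equiv (Fin n) ℝ).symm (fun i => (m i : ℝ)))
  simpa only [hper I x m, hper I y m, add_sub_add_right_eq_sub] using this

end Compactness

section APriori
variable {n l r : ℕ} {α T γ H C : ℝ}
  {𝒜 : (k : ℕ) → (Fin k → Fin n) → Vec n → ℝ → Mat l} {K : 𝓢(Vec n, Mat l)}

/-- The difference of the operator and its frozen principal part, applied to the Duhamel
solution. -/
def Bop (r : ℕ) (T : ℝ) (𝒜 : (k : ℕ) → (Fin k → Fin n) → Vec n → ℝ → Mat l)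
    (K : 𝓢(Vec n, Mat l)) (g : Vec n → ℝ → Vec l) (x : Vec n) (t : ℝ) : Vec l :=
  Lop r 𝒜 (vfam r T K g) x t + ∑ I, (𝒜 r I x t - 𝒜 r I 0 0) (vfam r T K g r I x t)

theorem lop_mix (s : ℝ) (U : (k : ℕ) → (Fin k → Fin n) → Vec n → ℝ → Vec l) (x : Vec n) (t : ℝ) :
    Lop (r + 1) (mix r s 𝒜) U x t = s • Lop r 𝒜 U x t +
      s • ∑ I, (𝒜 r I x t - 𝒜 r I 0 0) (U r I x t) + ∑ I, 𝒜 r I 0 0 (U r I x t) := by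
  rw [lop_succ]
  have e : Lop r (mix r s 𝒜) U x t = s • Lop r 𝒜 U x t := by
    rw [Lop, Lop, Finset.smul_sum]
    refine Finset.sum_congr rfl fun k hk => ?_
    rw [Finset.smul_sum]
    refine Finset.sum_congr rfl fun I _ => ?_
    rw [mix, if_neg (Finset.mem_range.1 hk).ne, smul_zero, zero_add, smul_apply]
  rw [e, add_assoc, Finset.smul_sum, ← Finset.sum_add_distrib]
  congr 1
  refine Finset.sum_congr rfl fun I _ => ?_
  rw [mix_top, add_apply, smul_apply, smul_apply, sub_apply]
  module

theorem ht_bop_aux (h : Data r T α H 𝒜) (hT : 0 ≤ T) {S S' H' : ℝ}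
    {U : (k : ℕ) → (Fin k → Fin n) → Vec n → ℝ → Vec l}
    (hU : ∀ k < r, ∀ I, Ht T α γ S S' (U k I)) (hU' : ∀ I, Ht T α γ S H' (U r I)) :
    Ht T α γ (cnt n r * (H * S) + Fintype.card (Fin r → Fin n) * (2 * H * S))
      (cnt n r * (H * S' + H * S) + Fintype.card (Fin r → Fin n) * (2 * H * H' + H * S))
      (fun x t => Lop r 𝒜 U x t + ∑ I, (𝒜 r I x t - 𝒜 r I 0 0) (U r I x t)) := by
  have h1 := ht_lop hT (fun k hk I => h.coef k (le_of_lt hk) I) hU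
  have h2 := Ht.sum Finset.univ fun I _ => Ht.clm hT (S := 2 * H) (H := H)
    (((h.coef r le_rfl I).sub (ht_const (𝒜 r I 0 0))).mono (by
      have := (h.coef r le_rfl I).sup 0 ⟨le_rfl, hT⟩ 0
      simp only [zero_mul, Real.exp_zero, mul_one] at this
      linarith) (by simp)) (hU' I)
  simp only [Finset.sum_const, nsmul_eq_mul, Finset.card_univ] at h2
  exact h1.add h2

/-- A priori estimate, uniform along the homotopy. -/
theorem Data.exists_apriori (h : Data r T α H 𝒜) (hr : 2 ≤ r) (hrev : Even r) (hα0 : 0 < α)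
    (hα1 : α < 1) (hT : 0 ≤ T) (hH : 0 ≤ H) (hK : IsKer r (fun I => 𝒜 r I 0 0) K)
    (hE : HeatEst r α T C K) :
    ∃ Ca γ, 0 ≤ Ca ∧ 0 < γ ∧ ∀ s ∈ Icc (0 : ℝ) 1, ∀ (g : Vec n → ℝ → Vec l) (N Nf : ℝ),
      Wt T α γ N g → PerZ g → Wt T α γ Nf (fun x t => g x t - s • Bop r T 𝒜 K g x t) →
      Wt T α γ (Ca * Nf) g := by
  have hr0 : (0 : ℝ) < r := by positivity
  have hC := hE.nonneg
  set c : ℝ := (r / α + r / (1 - α)) * (2 * C) with hc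
  have hc0 : 0 ≤ c := by
    have : 0 < 1 - α := by linarith
    positivity
  set m' : ℝ := (Fintype.card (Fin r → Fin n) : ℝ) with hm'
  have hm'0 : 0 ≤ m' := Nat.cast_nonneg _
  set m := cnt n r with hm
  have hm0 : 0 ≤ m := cnt_nonneg _ _
  have hG : 0 < Real.Gamma (α / r) := Real.Gamma_pos_of_pos (by positivity)
  set η : ℝ := 1 / (4 * (2 * m' * H * c + 1)) with hη
  have hη0 : 0 < η := by positivity
  have hη1 : 2 * m' * H * c * η ≤ 1 / 4 := by
    rw [hη, mul_one_div, div_le_div_iff₀ (by positivity) (by norm_num)]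
    nlinarith
  obtain ⟨Cs, hCs, hglob⟩ := h.exists_global hr hrev hα0 hα1 hT hH hη0
  set C3 : ℝ := m * H * (n + 3) + 3 * m' * H + 2 * m' * H * Cs with hC3
  have hC30 : 0 ≤ C3 := by positivity
  obtain ⟨γ, hγ0, hγ⟩ : ∃ γ : ℝ, 0 < γ ∧
      C3 * (Real.Gamma (α / r) * C) * γ ^ (-(α / r)) ≤ 1 / 4 := by
    have h1 := (tendsto_rpow_neg_atTop (y := α / r) (by positivity)).const_mul
      (C3 * (Real.Gamma (α / r) * C))
    rw [mul_zero] at h1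
    obtain ⟨γ, h2, h3⟩ := ((h1.eventually (gt_mem_nhds (by norm_num : (0 : ℝ) < 1 / 4))).and
      (eventually_gt_atTop 0)).exists
    exact ⟨γ, h3, h2.le⟩
  set C4 : ℝ := 1 + 2 * m' * H * Cs with hC4
  have hC40 : 0 ≤ C4 := by positivity
  refine ⟨2 * C4, γ, by positivity, hγ0, fun s hs g N Nf hg hper hf => ?_⟩
  have hNf := hf.nonneg hT
  have hperU : ∀ k (I : Fin k → Fin n), PerZ (vfam r T K g k I) := fun k I x mm => by
    funext t
    exact vfam_shift (fun x t => congrFun (hper x mm) t) I x t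
  have hsol0 := isSol_vfam hK hE hr hα0 hα1 hT hγ0.le hg
  have step : ∀ N, Wt T α γ N g → Wt T α γ (N / 2 + C4 * Nf) g := by
    intro N hg
    have hN := hg.nonneg hT
    set W : ℝ := Real.Gamma (α / r) * C * N * γ ^ (-(α / r)) with hW
    have hW0 : 0 ≤ W := by positivity
    have hU : Sol r T α (mix r s 𝒜) γ Nf W (c * N) (vfam r T K g)
        (fun x t => g x t - s • Bop r T 𝒜 K g x t) :=
      { sol := hsol0.congr fun x t _ => by
          simp only [lop_mix, Bop, Pi.zero_apply, zero_apply, Finset.sum_const_zero, smul_add]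
          abel
        f_wt := hf
        W_nonneg := hW0
        M_nonneg := by positivity
        sup := fun k hk I t ht x => by
          rw [vfam, clamp_eq ht]
          exact norm_duh_le hE hr hα0 hγ0 hg hk I ht x
        hol := fun I t ht x y => by
          rw [vfam, vfam, clamp_eq ht]
          exact norm_duh_sub_le hE hr hα0 hα1 hγ0.le hg le_rfl I ht x y }
    have h1 := fun I => hglob s hs γ Nf W (c * N) _ _ hγ0.le hU (fun I => hperU r I) I
    have h2 := ht_bop_aux h hT (γ := γ) (S := W) (S' := (n + 2) * W)
      (H' := η * (c * N) + Cs * (Nf + W)) (U := vfam r T K g)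
      (fun k hk I => hU.sol.ht_of_lt hα0 hα1 hW0 hU.sup hk I)
      (fun I => ⟨hU.sol.cont r le_rfl I, hU.sol.clamped r le_rfl I, hU.sup r le_rfl I, h1 I⟩)
    have h3 := hf.ht.add (h2.const_smul s)
    have e : g = fun x t => (g x t - s • Bop r T 𝒜 K g x t) + s • (Lop r 𝒜 (vfam r T K g) x t +
        ∑ I, (𝒜 r I x t - 𝒜 r I 0 0) (vfam r T K g r I x t)) := by
      funext x t
      exact (sub_add_cancel _ _).symm
    rw [e]
    have hC3W : C3 * W ≤ N / 4 := by
      have := mul_le_mul_of_nonneg_right hγ hN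
      rw [hW]
      linarith
    have hηN := mul_le_mul_of_nonneg_right hη1 hN
    have hs0 : |s| ≤ 1 := by rw [abs_of_nonneg hs.1]; exact hs.2
    refine h3.wt ?_ ?_
    · have e1 : 0 ≤ m * (H * W) + m' * (2 * H * W) := by positivity
      have e2 : 0 ≤ m * H * (n + 2) * W + m' * H * W + 2 * m' * H * Cs * W := by positivity
      have e3 : 0 ≤ 2 * m' * H * Cs * Nf := by positivity
      have e4 := mul_le_mul_of_nonneg_right hs0 e1
      rw [hC3] at hC3W
      rw [hC4]
      linarith
    · have e1 : 0 ≤ m * (H * ((n + 2) * W) + H * W) +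
          m' * (2 * H * (η * (c * N) + Cs * (Nf + W)) + H * W) := by positivity
      have e2 : 0 ≤ 2 * m' * H * W := by positivity
      have e4 := mul_le_mul_of_nonneg_right hs0 e1
      rw [hC3] at hC3W
      rw [hC4]
      linarith
  have iter : ∀ k : ℕ, Wt T α γ (N / 2 ^ k + 2 * C4 * Nf) g := by
    intro k
    induction k with
    | zero => exact hg.mono (by simp only [pow_zero, div_one]; exact le_add_of_nonneg_right (by positivity))
    | succ k ih =>
      refine (step _ ih).mono (le_of_eq ?_)
      rw [pow_succ]
      field_simp
      ring
  have hlim : Tendsto (fun k : ℕ => N / 2 ^ k + 2 * C4 * Nf) atTop (𝓝 (2 * C4 * Nf)) := by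
    have : Tendsto (fun k : ℕ => N * (1 / 2 : ℝ) ^ k + 2 * C4 * Nf) atTop
        (𝓝 (N * 0 + 2 * C4 * Nf)) :=
      ((tendsto_pow_atTop_nhds_zero_of_lt_one (by norm_num) (by norm_num)).const_mul N).add_const _
    simpa [div_eq_mul_inv] using this
  refine ⟨hg.cont, hg.clamped, fun t ht x => ?_, fun t ht x y => ?_⟩
  · exact ge_of_tendsto' (hlim.mul_const _) fun k => (iter k).sup t ht x
  · exact ge_of_tendsto' ((hlim.mul_const _).mul_const _) fun k => (iter k).hol t ht x y

end APriori

section Continuity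
variable {n l r : ℕ} {α T γ H C : ℝ}
  {𝒜 : (k : ℕ) → (Fin k → Fin n) → Vec n → ℝ → Mat l} {K : 𝓢(Vec n, Mat l)}

theorem Wt.sub {N N' : ℝ} {g g' : Vec n → ℝ → Vec l} (h : Wt T α γ N g) (h' : Wt T α γ N' g') :
    Wt T α γ (N + N') (fun x t => g x t - g' x t) :=
  (h.ht.sub h'.ht).wt le_rfl le_rfl

/-- Completeness of the weighted Hölder space. -/
theorem Wt.exists_limit (hT : 0 ≤ T) (hγ : 0 ≤ γ) {c : ℝ} (hc : 0 ≤ c)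
    {F : ℕ → Vec n → ℝ → Vec l}
    (hF : ∀ m, Wt T α γ (c * (1 / 2) ^ m) (fun x t => F (m + 1) x t - F m x t)) :
    ∃ G : Vec n → ℝ → Vec l, (∀ x t, Tendsto (fun m => F m x t) atTop (𝓝 (G x t))) ∧
      ∀ m, Wt T α γ (2 * c * (1 / 2) ^ m) (fun x t => G x t - F m x t) := by
  have hcs : ∀ x t, CauchySeq fun m => F m x t := fun x t => by
    refine cauchySeq_of_le_geometric (1 / 2) (c * Real.exp (γ * T)) (by norm_num) fun m => ?_
    rw [dist_comm, dist_eq_norm]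
    refine ((hF m).bdd hT hγ x t).trans (le_of_eq (by ring))
  choose G hG using fun x t => cauchySeq_tendsto_of_complete (hcs x t)
  have hpart : ∀ m k, Wt T α γ (2 * c * (1 / 2) ^ m) (fun x t => F (m + k) x t - F m x t) := by
    intro m k
    suffices h : Wt T α γ (2 * c * (1 / 2) ^ m - 2 * c * (1 / 2) ^ (m + k))
        (fun x t => F (m + k) x t - F m x t) from
      h.mono (sub_le_self _ (by positivity))
    induction k with
    | zero =>
      have := (ht_zero (n := n) (E := Vec l) (T := T) (α := α) (γ := γ)).wt le_rfl le_rfl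
      simpa using this
    | succ k ih =>
      have := ih.add (hF (m + k))
      simp only [← add_assoc]
      refine Wt.mono (N := 2 * c * (1 / 2) ^ m - 2 * c * (1 / 2) ^ (m + k) +
        c * (1 / 2) ^ (m + k)) ?_ (le_of_eq ?_)
      · simpa only [sub_add_sub_cancel, sub_add_sub_cancel'] using this
      · rw [pow_succ]; ring
  have hlim : ∀ m x t, Tendsto (fun k => F (m + k) x t - F m x t) atTop
      (𝓝 (G x t - F m x t)) := fun m x t =>
    ((hG x t).comp (tendsto_add_atTop_nat m |>.congr fun k => add_comm k m)).sub_const _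
  refine ⟨G, hG, fun m => ⟨?_, ?_, fun s hs x => ?_, fun s hs x y => ?_⟩⟩
  · refine TendstoUniformly.continuous (F := fun k (p : Vec n × ℝ) => F (m + k) p.1 p.2 - F m p.1 p.2)
      (p := atTop) ?_ (Frequently.of_forall fun k => (hpart m k).cont)
    rw [Metric.tendstoUniformly_iff]
    intro ε hε
    have h0 : Tendsto (fun k : ℕ => 2 * c * Real.exp (γ * T) * (1 / 2 : ℝ) ^ (m + k)) atTop
        (𝓝 0) := by
      have := ((tendsto_pow_atTop_nhds_zero_of_lt_one (r := (1 / 2 : ℝ)) (by norm_num)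
        (by norm_num)).comp (tendsto_add_atTop_nat m |>.congr fun k => add_comm k m)).const_mul
          (2 * c * Real.exp (γ * T))
      simpa using this
    filter_upwards [h0.eventually (gt_mem_nhds hε)] with k hk p
    refine lt_of_le_of_lt ?_ hk
    rw [dist_eq_norm, sub_sub_sub_cancel_right]
    refine le_of_tendsto' (hlim (m + k) p.1 p.2).norm fun j => ?_
    exact ((hpart (m + k) j).bdd hT hγ p.1 p.2).trans (le_of_eq (by ring))
  · intro x s
    refine tendsto_nhds_unique (hlim m x (clamp T s)) ?_
    simpa only [(hpart m _).clamped x s] using hlim m x s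
  · exact le_of_tendsto' (hlim m x s).norm fun k => (hpart m k).sup s hs x
  · exact le_of_tendsto' ((hlim m x s).sub (hlim m y s)).norm fun k => (hpart m k).hol s hs x y

theorem lop_add (m : ℕ) (U V : (k : ℕ) → (Fin k → Fin n) → Vec n → ℝ → Vec l) (x : Vec n)
    (t : ℝ) : Lop m 𝒜 (fun k I x t => U k I x t + V k I x t) x t =
      Lop m 𝒜 U x t + Lop m 𝒜 V x t := by
  simp only [Lop, map_add, Finset.sum_add_distrib]

theorem lop_congr {m : ℕ} {U V : (k : ℕ) → (Fin k → Fin n) → Vec n → ℝ → Vec l} {x : Vec n}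
    {t : ℝ} (h : ∀ k < m, ∀ I, U k I x t = V k I x t) : Lop m 𝒜 U x t = Lop m 𝒜 V x t :=
  Finset.sum_congr rfl fun k hk => Finset.sum_congr rfl fun I _ => by
    rw [h k (Finset.mem_range.1 hk)]

theorem bop_add (hE : HeatEst r α T C K) (hr : 2 ≤ r) (hα0 : 0 < α) (hT : 0 ≤ T) (hγ : 0 ≤ γ)
    {N N' : ℝ} {g g' : Vec n → ℝ → Vec l} (h : Wt T α γ N g) (h' : Wt T α γ N' g') (x : Vec n)
    (t : ℝ) : Bop r T 𝒜 K (fun x t => g x t + g' x t) x t =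
      Bop r T 𝒜 K g x t + Bop r T 𝒜 K g' x t := by
  have e : ∀ k ≤ r, ∀ I : Fin k → Fin n, vfam r T K (fun x t => g x t + g' x t) k I x t =
      vfam r T K g k I x t + vfam r T K g' k I x t := fun k hk I =>
    vfam_add hE hr hα0 hT hγ h h' hk I x t
  rw [Bop, Bop, Bop, lop_congr (V := fun k I x t => vfam r T K g k I x t +
    vfam r T K g' k I x t) fun k hk I => e k (le_of_lt hk) I, lop_add]
  simp only [e r le_rfl, map_add, Finset.sum_add_distrib]
  abel

theorem bop_neg (g : Vec n → ℝ → Vec l) (x : Vec n) (t : ℝ) :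
    Bop r T 𝒜 K (fun x t => (-1 : ℝ) • g x t) x t = -Bop r T 𝒜 K g x t := by
  simp only [Bop, Lop, vfam_smul, map_smul, ← Finset.smul_sum]
  module

theorem bop_sub (hE : HeatEst r α T C K) (hr : 2 ≤ r) (hα0 : 0 < α) (hT : 0 ≤ T) (hγ : 0 ≤ γ)
    {N N' : ℝ} {g g' : Vec n → ℝ → Vec l} (h : Wt T α γ N g) (h' : Wt T α γ N' g') (x : Vec n)
    (t : ℝ) : Bop r T 𝒜 K (fun x t => g x t - g' x t) x t =
      Bop r T 𝒜 K g x t - Bop r T 𝒜 K g' x t := by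
  have := bop_add (𝒜 := 𝒜) hE hr hα0 hT hγ h (h'.const_smul (-1)) x t
  rw [bop_neg, ← sub_eq_add_neg] at this
  simpa only [neg_smul, one_smul, ← sub_eq_add_neg] using this

theorem Data.exists_bop_le (h : Data r T α H 𝒜) (hr : 2 ≤ r) (hα0 : 0 < α) (hα1 : α < 1)
    (hT : 0 ≤ T) (hH : 0 ≤ H) (hK : IsKer r (fun I => 𝒜 r I 0 0) K) (hE : HeatEst r α T C K)
    (hγ : 0 < γ) : ∃ b, 0 ≤ b ∧ ∀ N (g : Vec n → ℝ → Vec l), Wt T α γ N g →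
      Wt T α γ (b * N) (Bop r T 𝒜 K g) := by
  have hr0 : (0 : ℝ) < r := by positivity
  have hC := hE.nonneg
  have hG : 0 < Real.Gamma (α / r) := Real.Gamma_pos_of_pos (by positivity)
  set w : ℝ := Real.Gamma (α / r) * C * γ ^ (-(α / r)) with hw
  have hw0 : 0 ≤ w := by positivity
  set c : ℝ := (r / α + r / (1 - α)) * (2 * C) with hc
  have hc0 : 0 ≤ c := by
    have : 0 < 1 - α := by linarith
    positivity
  set m' : ℝ := (Fintype.card (Fin r → Fin n) : ℝ) with hm'
  have hm'0 : 0 ≤ m' := Nat.cast_nonneg _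
  set m := cnt n r with hm
  have hm0 : 0 ≤ m := cnt_nonneg _ _
  refine ⟨(m * (H * w) + m' * (2 * H * w)) +
    (m * (H * ((n + 2) * w) + H * w) + m' * (2 * H * c + H * w)), by positivity, fun N g hg => ?_⟩
  have hN := hg.nonneg hT
  have hsol := isSol_vfam hK hE hr hα0 hα1 hT hγ.le hg
  have hsup : ∀ k, k ≤ r → ∀ I : Fin k → Fin n, ∀ s ∈ Icc 0 T, ∀ x,
      ‖vfam r T K g k I x s‖ ≤ w * N * Real.exp (γ * s) := fun k hk I s hs x => by
    rw [vfam, clamp_eq hs]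
    exact (norm_duh_le hE hr hα0 hγ hg hk I hs x).trans (le_of_eq (by rw [hw]; ring))
  have h1 := ht_bop_aux h hT (γ := γ) (S := w * N) (S' := (n + 2) * (w * N)) (H' := c * N)
    (U := vfam r T K g) (fun k hk I => hsol.ht_of_lt hα0 hα1 (by positivity) hsup hk I)
    (fun I => ⟨hsol.cont r le_rfl I, hsol.clamped r le_rfl I, hsup r le_rfl I,
      fun s hs x y => by
        rw [vfam, vfam, clamp_eq hs]
        exact norm_duh_sub_le hE hr hα0 hα1 hγ.le hg le_rfl I hs x y⟩)
  have e1 : 0 ≤ (m * (H * w) + m' * (2 * H * w)) * N := by positivity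
  have e2 : 0 ≤ (m * (H * ((n + 2) * w) + H * w) + m' * (2 * H * c + H * w)) * N := by positivity
  exact h1.wt (by linarith) (by linarith)

theorem Data.perZ_bop (h : Data r T α H 𝒜) {g : Vec n → ℝ → Vec l} (hg : PerZ g) :
    PerZ (Bop r T 𝒜 K g) := fun x m => by
  funext t
  have e : ∀ k (I : Fin k → Fin n), vfam r T K g k I (x + (EuclideanSpace.equiv (Fin n) ℝ).symm
      fun i => (m i : ℝ)) t = vfam r T K g k I x t := fun k I =>
    vfam_shift (fun x t => congrFun (hg x m) t) I x t
  simp only [Bop, Lop, e, h.per r le_rfl _ x m]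
  congr 1
  refine Finset.sum_congr rfl fun k hk => Finset.sum_congr rfl fun I _ => ?_
  rw [h.per k (Finset.mem_range.1 hk).le I x m]

/-- Solvability propagates along the homotopy by steps of uniform size. -/
theorem Data.solvable_step (h : Data r T α H 𝒜) (hr : 2 ≤ r) (hα0 : 0 < α) (hT : 0 ≤ T)
    (hE : HeatEst r α T C K) (hγ : 0 < γ) {b Ca s s' : ℝ}
    (hB : ∀ N (g : Vec n → ℝ → Vec l), Wt T α γ N g → Wt T α γ (b * N) (Bop r T 𝒜 K g))
    (hap : ∀ (g : Vec n → ℝ → Vec l) (N Nf : ℝ), Wt T α γ N g → PerZ g →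
      Wt T α γ Nf (fun x t => g x t - s • Bop r T 𝒜 K g x t) → Wt T α γ (Ca * Nf) g)
    (hsolv : ∀ (f : Vec n → ℝ → Vec l) (N : ℝ), Wt T α γ N f → PerZ f →
      ∃ g N', Wt T α γ N' g ∧ PerZ g ∧ ∀ x t, g x t - s • Bop r T 𝒜 K g x t = f x t)
    (hss : Ca * b * |s' - s| ≤ 1 / 2) (f : Vec n → ℝ → Vec l) (N : ℝ) (hf : Wt T α γ N f)
    (hfp : PerZ f) :
    ∃ g N', Wt T α γ N' g ∧ PerZ g ∧ ∀ x t, g x t - s' • Bop r T 𝒜 K g x t = f x t := by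
  let X := {g : Vec n → ℝ → Vec l // (∃ N, Wt T α γ N g) ∧ PerZ g}
  have hstep : ∀ g : X, ∃ g' : X, ∀ x t, g'.1 x t - s • Bop r T 𝒜 K g'.1 x t =
      f x t + (s' - s) • Bop r T 𝒜 K g.1 x t := by
    rintro ⟨g, ⟨N', hg⟩, hgp⟩
    obtain ⟨g', N'', h1, h2, h3⟩ := hsolv (fun x t => f x t + (s' - s) • Bop r T 𝒜 K g x t) _
      (hf.add ((hB _ _ hg).const_smul (s' - s))) fun x m => by
        funext t
        dsimp only
        rw [hfp x m, h.perZ_bop hgp x m]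
    exact ⟨⟨g', ⟨N'', h1⟩, h2⟩, h3⟩
  choose S hS using hstep
  let F : ℕ → X := fun m => S^[m] ⟨f, ⟨N, hf⟩, hfp⟩
  have hFs : ∀ m, F (m + 1) = S (F m) := fun m => Function.iterate_succ_apply' S m _
  obtain ⟨N0, hN0⟩ := (F 0).2.1
  obtain ⟨N1, hN1⟩ := (F 1).2.1
  have hN00 := hN0.nonneg hT
  have hN10 := hN1.nonneg hT
  have hF : ∀ m, Wt T α γ ((N1 + N0) * (1 / 2) ^ m)
      (fun x t => (F (m + 1)).1 x t - (F m).1 x t) := by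
    intro m
    induction m with
    | zero => simpa using hN1.sub hN0
    | succ m ih =>
      obtain ⟨A2, h2⟩ := (F (m + 2)).2.1
      obtain ⟨A1, h1⟩ := (F (m + 1)).2.1
      obtain ⟨A0, h0⟩ := (F m).2.1
      have hc0 : 0 ≤ (N1 + N0) * (1 / 2) ^ m := by positivity
      refine (hap _ _ (|s' - s| * (b * ((N1 + N0) * (1 / 2) ^ m))) (h2.sub h1)
        (fun x mm => ?_) ?_).mono ?_
      · funext t
        rw [(F (m + 2)).2.2 x mm, (F (m + 1)).2.2 x mm]
      · have e := (hB _ _ ih).const_smul (s' - s)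
        convert e using 3 with x t
        rw [bop_sub hE hr hα0 hT hγ.le h2 h1, bop_sub hE hr hα0 hT hγ.le h1 h0]
        have e2 := hS (F (m + 1)) x t
        have e1 := hS (F m) x t
        rw [← hFs] at e1 e2
        rw [smul_sub, sub_sub_sub_comm, e2, e1, smul_sub]
        abel
      · rw [pow_succ]
        nlinarith
  obtain ⟨G, hG, hGF⟩ := Wt.exists_limit hT hγ.le (by positivity : 0 ≤ N1 + N0)
    (F := fun m => (F m).1) hF
  obtain ⟨NG, hNG⟩ : ∃ NG, Wt T α γ NG G := ⟨_, by
    have := (hGF 0).add hN0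
    simpa only [sub_add_cancel] using this⟩
  refine ⟨G, NG, hNG, fun x m => ?_, fun x t => ?_⟩
  · funext t
    refine tendsto_nhds_unique (hG _ t) ?_
    simpa only [(F _).2.2 x m] using hG x t
  · have hBG : Tendsto (fun m => Bop r T 𝒜 K (F m).1 x t) atTop (𝓝 (Bop r T 𝒜 K G x t)) := by
      rw [tendsto_iff_norm_sub_tendsto_zero]
      have h0 : Tendsto (fun m : ℕ => b * (2 * (N1 + N0)) * Real.exp (γ * T) * (1 / 2 : ℝ) ^ m)
          atTop (𝓝 0) := by
        simpa using (tendsto_pow_atTop_nhds_zero_of_lt_one (r := (1 / 2 : ℝ)) (by norm_num)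
          (by norm_num)).const_mul (b * (2 * (N1 + N0)) * Real.exp (γ * T))
      refine squeeze_zero (fun _ => norm_nonneg _) (fun m => ?_) h0
      obtain ⟨A0, h0⟩ := (F m).2.1
      rw [norm_sub_rev, ← bop_sub hE hr hα0 hT hγ.le hNG h0]
      exact ((hB _ _ (hGF m)).bdd hT hγ.le x t).trans (le_of_eq (by ring))
    have h1 : Tendsto (fun m => (F (m + 1)).1 x t - s • Bop r T 𝒜 K (F (m + 1)).1 x t) atTop
        (𝓝 (G x t - s • Bop r T 𝒜 K G x t)) :=
      ((hG x t).comp (tendsto_add_atTop_nat 1)).sub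
        ((hBG.comp (tendsto_add_atTop_nat 1)).const_smul s)
    have h2 : Tendsto (fun m => f x t + (s' - s) • Bop r T 𝒜 K (F m).1 x t) atTop
        (𝓝 (f x t + (s' - s) • Bop r T 𝒜 K G x t)) := (hBG.const_smul _).const_add _
    have h3 := tendsto_nhds_unique h1 (h2.congr fun m => by rw [hFs, hS])
    have h4 := sub_eq_iff_eq_add.1 h3
    rw [h4]
    module

/-- The model problem is uniquely solvable. -/
theorem Data.exists_solution (h : Data r T α H 𝒜) (hr : 2 ≤ r) (hrev : Even r) (hα0 : 0 < α)
    (hα1 : α < 1) (hT : 0 ≤ T) (hH : 0 ≤ H) (hK : IsKer r (fun I => 𝒜 r I 0 0) K)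
    (hE : HeatEst r α T C K) :
    ∃ γ, 0 < γ ∧ (∀ (g : Vec n → ℝ → Vec l) (N : ℝ), Wt T α γ N g → PerZ g →
        (∀ x t, g x t - Bop r T 𝒜 K g x t = 0) → ∀ x, ∀ t ∈ Icc 0 T, g x t = 0) ∧
      ∀ (f : Vec n → ℝ → Vec l) (N : ℝ), Wt T α γ N f → PerZ f →
        ∃ g N', Wt T α γ N' g ∧ PerZ g ∧ ∀ x t, g x t - Bop r T 𝒜 K g x t = f x t := by
  obtain ⟨Ca, γ, hCa, hγ, hap⟩ := h.exists_apriori hr hrev hα0 hα1 hT hH hK hE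
  obtain ⟨b, hb, hB⟩ := h.exists_bop_le hr hα0 hα1 hT hH hK hE hγ
  refine ⟨γ, hγ, fun g N hg hgp h0 x t ht => ?_, ?_⟩
  · have h1 := hap 1 ⟨zero_le_one, le_rfl⟩ g N 0 hg hgp (by
      simp only [one_smul, h0]
      exact ht_zero.wt le_rfl le_rfl)
    have := h1.sup t ht x
    rw [mul_zero, zero_mul] at this
    exact norm_le_zero_iff.1 this
  obtain ⟨M, hM⟩ := exists_nat_ge (2 * (Ca * b) + 1)
  have hM0 : (0 : ℝ) < M := by have : 0 ≤ Ca * b := by positivity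
                               linarith
  have key : ∀ j : ℕ, j ≤ M → ∀ (f : Vec n → ℝ → Vec l) (N : ℝ), Wt T α γ N f → PerZ f →
      ∃ g N', Wt T α γ N' g ∧ PerZ g ∧
        ∀ x t, g x t - ((j : ℝ) / M) • Bop r T 𝒜 K g x t = f x t := by
    intro j
    induction j with
    | zero => exact fun _ f N hf hfp => ⟨f, N, hf, hfp, fun x t => by simp⟩
    | succ j ih =>
      intro hj
      refine h.solvable_step hr hα0 hT hE hγ hB
        (hap (j / M) ⟨by positivity, ?_⟩) (ih (by omega)) ?_
      · rw [div_le_one hM0]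
        exact_mod_cast (by omega : j ≤ M)
      · rw [← sub_div, Nat.cast_succ, add_sub_cancel_left, abs_of_pos (by positivity),
          mul_one_div, div_le_iff₀ hM0]
        linarith
  have := key M le_rfl
  simpa only [div_self hM0.ne', one_smul] using this

end Continuity

section ParabolicHolder
variable {n l r : ℕ} {E F : Type*} [NormedAddCommGroup E] [NormedSpace ℝ E]
  [NormedAddCommGroup F] [NormedSpace ℝ F] {α T c c' : ℝ}

/-- Bounded functions on `ℝ^n × [0, T]`, extended to all times by truncation, satisfying a
parabolic Hölder bound. -/
structure PHol (r : ℕ) (α T c : ℝ) (g : Vec n → ℝ → E) : Prop where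
  cont : Continuous fun p : Vec n × ℝ => g p.1 p.2
  clamped : ∀ x s, g x (clamp T s) = g x s
  sup : ∀ x s, ‖g x s‖ ≤ c
  hol : ∀ x y s t, ‖g x s - g y t‖ ≤ c * (‖x - y‖ ^ α + |s - t| ^ (α / r))

variable {g g' : Vec n → ℝ → E}

theorem PHol.nonneg (h : PHol r α T c g) : 0 ≤ c := (norm_nonneg _).trans (h.sup 0 0)

theorem PHol.add (h : PHol r α T c g) (h' : PHol r α T c' g') :
    PHol r α T (c + c') (fun x t => g x t + g' x t) where
  cont := h.cont.add h'.cont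
  clamped x s := by rw [h.clamped, h'.clamped]
  sup x s := (norm_add_le _ _).trans (add_le_add (h.sup x s) (h'.sup x s))
  hol x y s t := by
    rw [add_sub_add_comm, add_mul]
    exact (norm_add_le _ _).trans (add_le_add (h.hol x y s t) (h'.hol x y s t))

theorem phol_zero : PHol r α T 0 (fun (_ : Vec n) (_ : ℝ) => (0 : E)) where
  cont := continuous_const
  clamped _ _ := rfl
  sup _ _ := by simp
  hol _ _ _ _ := by simp

theorem exists_phol_sum {ι : Type*} (u : Finset ι) {g : ι → Vec n → ℝ → E}
    (h : ∀ i ∈ u, ∃ c, PHol r α T c (g i)) :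
    ∃ c, PHol r α T c (fun x t => ∑ i ∈ u, g i x t) := by
  classical
  induction u using Finset.induction_on with
  | empty => exact ⟨0, by simpa using phol_zero⟩
  | insert i u hi ih =>
    obtain ⟨c, hc⟩ := h i (Finset.mem_insert_self i u)
    obtain ⟨c', hc'⟩ := ih fun j hj => h j (Finset.mem_insert_of_mem hj)
    exact ⟨c + c', by simpa only [Finset.sum_insert hi] using hc.add hc'⟩

theorem PHol.map (L : E →L[ℝ] F) (h : PHol r α T c g) :
    PHol r α T (‖L‖ * c) (fun x t => L (g x t)) where
  cont := L.continuous.comp h.cont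
  clamped x s := by rw [h.clamped]
  sup x s := (L.le_opNorm _).trans (by have := h.sup x s; gcongr)
  hol x y s t := by
    rw [← map_sub, mul_assoc]
    exact (L.le_opNorm _).trans (by have := h.hol x y s t; gcongr)

theorem PHol.clm {a : Vec n → ℝ → E →L[ℝ] F} (h : PHol r α T c a) (h' : PHol r α T c' g) :
    PHol r α T (2 * (c * c')) (fun x t => a x t (g x t)) where
  cont := h.cont.clm_apply h'.cont
  clamped x s := by rw [h.clamped, h'.clamped]
  sup x s := by
    have h0 := h.nonneg
    have h0' := h'.nonneg
    refine ((a x s).le_opNorm _).trans ?_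
    have h1 : ‖a x s‖ * ‖g x s‖ ≤ c * c' :=
      mul_le_mul (h.sup x s) (h'.sup x s) (norm_nonneg _) h0
    nlinarith [mul_nonneg h0 h0']
  hol x y s t := by
    have h0 := h.nonneg
    have h0' := h'.nonneg
    set d := ‖x - y‖ ^ α + |s - t| ^ (α / r) with hd
    have hd0 : 0 ≤ d := by positivity
    have e : a x s (g x s) - a y t (g y t) = (a x s - a y t) (g x s) + a y t (g x s - g y t) := by
      rw [sub_apply, map_sub]; abel
    rw [e]
    refine (norm_add_le _ _).trans ?_
    have h1 : ‖(a x s - a y t) (g x s)‖ ≤ c * d * c' := (ContinuousLinearMap.le_opNorm _ _).trans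
      (mul_le_mul (h.hol x y s t) (h'.sup x s) (norm_nonneg _) (by positivity))
    have h2 : ‖a y t (g x s - g y t)‖ ≤ c * (c' * d) := (ContinuousLinearMap.le_opNorm _ _).trans
      (mul_le_mul (h.sup y t) (h'.hol x y s t) (norm_nonneg _) h0)
    linarith

theorem PHol.ht (hr : 0 < r) (hα0 : 0 < α) (h : PHol r α T c g) : Ht T α 0 c c g where
  cont := h.cont
  clamped := h.clamped
  sup s _ x := by simpa using h.sup x s
  hol s _ x y := by
    have := h.hol x y s s
    rw [sub_self, abs_zero, Real.zero_rpow (by positivity), add_zero] at this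
    simpa using this

/-- Unweighted bounds are weighted bounds. -/
theorem Ht.weight {γ S H : ℝ} (hT : 0 ≤ T) (hγ : 0 ≤ γ) (hH : 0 ≤ H) (h : Ht T α 0 S H g) :
    Ht T α γ S H g where
  cont := h.cont
  clamped := h.clamped
  sup s hs x := by
    have hS := h.sup_nonneg hT
    refine (h.sup s hs x).trans ?_
    gcongr 2
    exact mul_le_mul_of_nonneg_right hγ hs.1
  hol s hs x y := by
    refine (h.hol s hs x y).trans ?_
    gcongr 2
    gcongr 1
    exact mul_le_mul_of_nonneg_right hγ hs.1

theorem exists_phol_lop {m : ℕ} {𝒜 : (k : ℕ) → (Fin k → Fin n) → Vec n → ℝ → Mat l}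
    {U : (k : ℕ) → (Fin k → Fin n) → Vec n → ℝ → Vec l}
    (h𝒜 : ∀ k < m, ∀ I, ∃ c, PHol r α T c (𝒜 k I)) (hU : ∀ k < m, ∀ I, ∃ c, PHol r α T c (U k I)) :
    ∃ c, PHol r α T c (Lop m 𝒜 U) :=
  exists_phol_sum _ fun k hk => exists_phol_sum _ fun I _ => by
    obtain ⟨c, hc⟩ := h𝒜 k (Finset.mem_range.1 hk) I
    obtain ⟨c', hc'⟩ := hU k (Finset.mem_range.1 hk) I
    exact ⟨_, hc.clm hc'⟩

/-- Periodic continuous functions are bounded. -/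
theorem exists_bound_of_perZ (hT : 0 ≤ T) (hg : Continuous fun p : Vec n × ℝ => g p.1 p.2)
    (hcl : ∀ x s, g x (clamp T s) = g x s) (hp : PerZ g) : ∃ B, ∀ x s, ‖g x s‖ ≤ B := by
  obtain ⟨B, hB⟩ := ((isCompact_closedBall (0 : Vec n) n).prod
    (isCompact_Icc (a := (0 : ℝ)) (b := T))).exists_bound_of_continuousOn hg.continuousOn
  refine ⟨B, fun x s => ?_⟩
  obtain ⟨m, hm⟩ := exists_int_translate x
  rw [← hcl, ← hp x m]
  exact hB (_, _) ⟨hm, clamp_mem hT s⟩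

theorem perZ_comp_clamp {w : Vec n → ℝ → E} (hp : PerZ w) : PerZ fun x t => w x (clamp T t) :=
  fun x m => funext fun t => congrFun (hp x m) (clamp T t)

theorem continuous_comp_clamp (hT : 0 ≤ T) {w : Vec n → ℝ → E}
    (hw : ContinuousOn (fun p : Vec n × ℝ => w p.1 p.2) (univ ×ˢ Icc 0 T)) :
    Continuous fun p : Vec n × ℝ => w p.1 (clamp T p.2) :=
  hw.comp_continuous (f := fun p : Vec n × ℝ => (p.1, clamp T p.2))
    (continuous_fst.prodMk ((continuous_clamp T).comp continuous_snd))
    fun p => ⟨mem_univ _, clamp_mem hT p.2⟩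

theorem exists_phol_of_memLow (hr : 0 < r) (hα0 : 0 < α) (hT : 0 ≤ T) {w : Vec n → ℝ → Vec l}
    (h : MemLow r α (univ ×ˢ Icc 0 T) w) (hp : PerZ w) :
    ∃ c, PHol r α T c (fun x t => w x (clamp T t)) := by
  have hc := continuous_comp_clamp hT h.1
  obtain ⟨B, hB⟩ := exists_bound_of_perZ (g := fun x t => w x (clamp T t)) hT hc
    (fun x s => by rw [clamp_clamp hT]) (perZ_comp_clamp hp)
  obtain ⟨M, hM⟩ := h.2
  refine ⟨max B M, hc, fun x s => by rw [clamp_clamp hT], fun x s => (hB x s).trans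
    (le_max_left _ _), fun x y s t => ?_⟩
  have hB0 : 0 ≤ max B M := ((norm_nonneg _).trans (hB 0 0)).trans (le_max_left _ _)
  have hmono : |clamp T s - clamp T t| ^ (α / r) ≤ |s - t| ^ (α / r) :=
    Real.rpow_le_rpow (abs_nonneg _) (abs_clamp_sub_le T s t) (by positivity)
  by_cases hne : ((x, clamp T s) : Vec n × ℝ) = (y, clamp T t)
  · have h1 := congrArg Prod.fst hne
    have h2 := congrArg Prod.snd hne
    dsimp only at h1 h2 ⊢
    rw [h1, h2, sub_self, norm_zero]
    positivity
  · have hpos : 0 < ‖x - y‖ ^ α + |clamp T s - clamp T t| ^ (α / r) := by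
      by_cases hx : x = y
      · have : clamp T s ≠ clamp T t := fun h => hne (by rw [hx, h])
        exact add_pos_of_nonneg_of_pos (by positivity)
          (Real.rpow_pos_of_pos (abs_pos.2 (sub_ne_zero.2 this)) _)
      · exact add_pos_of_pos_of_nonneg
          (Real.rpow_pos_of_pos (norm_pos_iff.2 (sub_ne_zero.2 hx)) _) (by positivity)
    have := hM ⟨(x, clamp T s), ⟨mem_univ _, clamp_mem hT s⟩, (y, clamp T t),
      ⟨mem_univ _, clamp_mem hT t⟩, hne, rfl⟩
    rw [div_le_iff₀ hpos] at this
    refine this.trans ?_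
    have := le_max_right B M
    gcongr

theorem PHol.bddAbove_holQuot {w w' : Vec n → ℝ → Vec l} (h : PHol r α T c w)
    (hw : ∀ x, ∀ t ∈ Icc 0 T, w' x t = w x t) : BddAbove (holQuot r α (univ ×ˢ Icc 0 T) w') := by
  refine ⟨c, ?_⟩
  rintro _ ⟨p, hp, q, hq, -, rfl⟩
  rw [hw _ _ hp.2, hw _ _ hq.2]
  exact div_le_of_le_mul₀ (by positivity) h.nonneg (h.hol _ _ _ _)

end ParabolicHolder

section Derivatives
variable {n l r : ℕ} {w : Vec n → Vec l}

theorem pderivW_univ {k : ℕ} (I : Fin k → Fin n) :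
    pderivW univ k I w = fun x => iteratedFDeriv ℝ k w x fun j => ee (I j) := by
  funext x
  rw [pderivW, iteratedFDerivWithin_univ]

theorem hasFDerivAt_pderivW {k : ℕ} (hw : ContDiff ℝ r w) (hk : k < r) (I : Fin k → Fin n)
    (x : Vec n) : HasFDerivAt (pderivW univ k I w)
      (grad fun i => pderivW univ (k + 1) (Fin.cons i I : Fin (k + 1) → Fin n) w x) x := by
  have h1 := (hw.differentiable_iteratedFDeriv (m := k) (by exact_mod_cast hk) x).hasFDerivAt
  have h2 := h1.continuousMultilinear_apply_const fun j => (ee (I j) : Vec n)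
  rw [pderivW_univ]
  refine h2.congr_fderiv ?_
  rw [eq_grad ((ContinuousLinearMap.flipMultilinear _) _)]
  congr 1
  funext i
  rw [pderivW, iteratedFDerivWithin_univ, iteratedFDeriv_succ_apply_left]
  rfl

theorem continuous_pderivW {k : ℕ} (hw : ContDiff ℝ r w) (hk : k ≤ r) (I : Fin k → Fin n) :
    Continuous (pderivW univ k I w) := by
  rw [pderivW_univ]
  exact (ContinuousMultilinearMap.apply ℝ (fun _ : Fin k => Vec n) (Vec l) _).continuous.comp
    (hw.continuous_iteratedFDeriv (m := k) (by exact_mod_cast hk))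

theorem perZ_pderivW (hw : PerZ w) {k : ℕ} (I : Fin k → Fin n) : PerZ (pderivW univ k I w) := by
  intro x m
  simp only [pderivW, iteratedFDerivWithin_univ]
  rw [← iteratedFDeriv_comp_add_right k, funext fun z => hw z m]

variable {U : (k : ℕ) → (Fin k → Fin n) → Vec n → Vec l}

theorem contDiff_of_family (hc : ∀ k, k ≤ r → ∀ I, Continuous (U k I))
    (hd : ∀ k, k < r → ∀ (I : Fin k → Fin n) x, HasFDerivAt (U k I)
      (grad fun i => U (k + 1) (Fin.cons i I : Fin (k + 1) → Fin n) x) x) (j : ℕ) :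
    ∀ k, k + j ≤ r → ∀ I, ContDiff ℝ j (U k I) := by
  induction j with
  | zero => exact fun k hk I => contDiff_zero.2 (hc k hk I)
  | succ j ih =>
    intro k hk I
    have h1 := fun x => hd k (by omega) I x
    rw [Nat.cast_succ, contDiff_succ_iff_fderiv]
    refine ⟨fun x => (h1 x).differentiableAt, fun h => absurd h (by simp), ?_⟩
    rw [funext fun x => (h1 x).fderiv]
    unfold grad
    exact ContDiff.sum fun i _ => contDiff_const.smulRight (ih (k + 1) (by omega) _)

theorem pderivW_eq_of_family (hw : ContDiff ℝ r w) (h0 : ∀ I₀, U 0 I₀ = w)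
    (hd : ∀ k, k < r → ∀ (I : Fin k → Fin n) x, HasFDerivAt (U k I)
      (grad fun i => U (k + 1) (Fin.cons i I : Fin (k + 1) → Fin n) x) x) :
    ∀ k, k ≤ r → ∀ I, pderivW univ k I w = U k I := by
  intro k
  induction k with
  | zero =>
    intro _ I
    rw [h0]
    funext x
    rw [pderivW, iteratedFDerivWithin_univ, iteratedFDeriv_zero_apply]
  | succ k ih =>
    intro hk I
    funext x
    have h1 := hasFDerivAt_pderivW hw hk (Fin.tail I) x
    rw [ih (by omega)] at h1
    have h2 := DFunLike.congr_fun (h1.unique (hd k hk (Fin.tail I) x)) (ee (I 0))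
    rwa [grad_ee, grad_ee, Fin.cons_self_tail] at h2

end Derivatives

section Problem
variable {n l r : ℕ} {α T γ H C : ℝ}
  {𝒜 : (k : ℕ) → (Fin k → Fin n) → Vec n → ℝ → Mat l} {K : 𝓢(Vec n, Mat l)}
  {f : Vec n → ℝ → Vec l} {u₀ : Vec n → Vec l}

theorem Ht.exists_wt {S S' : ℝ} {g : Vec n → ℝ → Vec l} (hT : 0 ≤ T) (hγ : 0 ≤ γ)
    (h : Ht T α 0 S S' g) : ∃ N, Wt T α γ N g :=
  ⟨_, ((h.mono (le_max_left S S') (le_max_right S S')).weight hT hγ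
    ((h.sup_nonneg hT).trans (le_max_left _ _))).wt le_rfl le_rfl⟩

theorem pderivW_zero (I : Fin 0 → Fin n) (w : Vec n → Vec l) : pderivW univ 0 I w = w := by
  funext x
  rw [pderivW, iteratedFDerivWithin_univ, iteratedFDeriv_zero_apply]

/-- The derivatives of the initial value, viewed as constant in time. -/
def initFam (u₀ : Vec n → Vec l) (k : ℕ) (I : Fin k → Fin n) (x : Vec n) (_ : ℝ) : Vec l :=
  pderivW univ k I u₀ x

theorem exists_phol_initFam (hr : 2 ≤ r) (hα0 : 0 < α) (hα1 : α < 1) (hT : 0 ≤ T)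
    (hu : MemSp r α univ u₀) (hp : PerZ u₀) {k : ℕ} (hk : k ≤ r) (I : Fin k → Fin n) :
    ∃ c, PHol r α T c (initFam u₀ k I) := by
  have hcd : ContDiff ℝ r u₀ := contDiffOn_univ.1 hu.1
  have hcont : ∀ k, k ≤ r → ∀ I : Fin k → Fin n,
      Continuous fun p : Vec n × ℝ => initFam u₀ k I p.1 p.2 := fun k hk I =>
    (continuous_pderivW hcd hk I).comp continuous_fst
  obtain ⟨B, hB0, hB⟩ := exists_uniform (n := n) r
    (P := fun k I C => ∀ x, ‖pderivW univ k I u₀ x‖ ≤ C)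
    (fun k I C C' h _ hC x => (hC x).trans h) fun k hk I => by
      obtain ⟨B, hB⟩ := exists_bound_of_perZ hT (hcont k hk I) (fun _ _ => rfl)
        fun x m => funext fun _ => perZ_pderivW hp I x m
      exact ⟨B, (norm_nonneg _).trans (hB 0 0), fun x => hB x 0⟩
  suffices h : ∃ c, 0 ≤ c ∧ ∀ x y, ‖pderivW univ k I u₀ x - pderivW univ k I u₀ y‖ ≤
      c * ‖x - y‖ ^ α by
    obtain ⟨c, hc0, hc⟩ := h
    refine ⟨max B c, hcont k hk I, fun _ _ => rfl, fun x _ => (hB k hk I x).trans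
      (le_max_left _ _), fun x y s t => (hc x y).trans ?_⟩
    have h1 : 0 ≤ |s - t| ^ (α / r) := by positivity
    have h2 := le_max_right B c
    have h3 : 0 ≤ ‖x - y‖ ^ α := by positivity
    have h4 : 0 ≤ max B c := hc0.trans h2
    exact mul_le_mul h2 (by linarith) h3 h4
  rcases hk.lt_or_eq with hk' | rfl
  · exact ⟨(n + 2) * B, by positivity, norm_sub_le_of_grad hα0 hα1 hB0
      (hasFDerivAt_pderivW hcd hk' I) (hB k hk I) fun i => hB (k + 1) hk' _⟩
  · obtain ⟨M, hM⟩ := hu.2 I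
    refine ⟨max 0 M, le_max_left _ _, fun x y => ?_⟩
    by_cases hxy : x = y
    · rw [hxy, sub_self, norm_zero]
      positivity
    · have h1 := hM ⟨x, mem_univ _, y, mem_univ _, hxy, rfl⟩
      have hpos : 0 < ‖x - y‖ ^ α := Real.rpow_pos_of_pos (norm_pos_iff.2 (sub_ne_zero.2 hxy)) _
      rw [div_le_iff₀ hpos] at h1
      exact h1.trans (mul_le_mul_of_nonneg_right (le_max_right _ _) hpos.le)

theorem exists_phol_vfam {N : ℝ} {g : Vec n → ℝ → Vec l} {A : (Fin r → Fin n) → Mat l}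
    (hK : IsKer r A K) (hE : HeatEst r α T C K)
    (hr : 2 ≤ r) (hα0 : 0 < α) (hα1 : α < 1) (hT : 0 ≤ T) (hγ : 0 ≤ γ) (h : Wt T α γ N g) {k : ℕ}
    (hk : k ≤ r) (I : Fin k → Fin n) : ∃ c, PHol r α T c (vfam r T K g k I) := by
  have hsol := isSol_vfam hK hE hr hα0 hα1 hT hγ h
  obtain ⟨B, hB⟩ := hsol.bdd
  have h0 := h.unweight hT hγ
  set N' := N * Real.exp (γ * T)
  set c₁ := (r / α + r / (1 - α)) * (2 * C) * N'
  set c₂ := (r / α + (r / α + 1 / (1 - α / r)) * 2) * C * N'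
  have hc0 : 0 ≤ max B (max c₁ c₂) :=
    ((norm_nonneg _).trans (hB k hk I 0 0)).trans (le_max_left _ _)
  have hc1 : c₁ ≤ max B (max c₁ c₂) := (le_max_left _ _).trans (le_max_right _ _)
  have hc2 : c₂ ≤ max B (max c₁ c₂) := (le_max_right _ _).trans (le_max_right _ _)
  refine ⟨max B (max c₁ c₂), hsol.cont k hk I, hsol.clamped k hk I,
    fun x s => (hB k hk I x s).trans (le_max_left _ _), fun x y s t => ?_⟩
  have h1 := norm_duh_sub_le hE hr hα0 hα1 le_rfl h0 hk I (clamp_mem hT s) x y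
  have h2 := norm_duh_time_sub_le hE hr hα0 hα1 h0 hk I (clamp_mem hT s) (clamp_mem hT t) y
  rw [zero_mul, Real.exp_zero, mul_one] at h1
  have h3 : |clamp T s - clamp T t| ^ (α / r) ≤ |s - t| ^ (α / r) :=
    Real.rpow_le_rpow (abs_nonneg _) (abs_clamp_sub_le T s t) (by positivity)
  rw [vfam, vfam, ← sub_add_sub_cancel _ (duh r K I g y (clamp T s)), mul_add]
  refine (norm_add_le _ _).trans (add_le_add (h1.trans ?_) (h2.trans ?_))
  · exact mul_le_mul_of_nonneg_right hc1 (by positivity)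
  · exact mul_le_mul hc2 h3 (by positivity) hc0

theorem grad_add (v w : Fin n → Vec l) : grad (fun i => v i + w i) = grad v + grad w := by
  ext1 x
  rw [add_apply, grad_apply, grad_apply, grad_apply, ← Finset.sum_add_distrib]
  simp only [smul_add]

theorem grad_sub (v w : Fin n → Vec l) : grad (fun i => v i - w i) = grad v - grad w := by
  ext1 x
  rw [sub_apply, grad_apply, grad_apply, grad_apply, ← Finset.sum_sub_distrib]
  simp only [smul_sub]

theorem perZ_lop {m : ℕ} {U : (k : ℕ) → (Fin k → Fin n) → Vec n → ℝ → Vec l}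
    (h𝒜 : ∀ k, k < m → ∀ I, PerZ (𝒜 k I)) (hU : ∀ k I, PerZ (U k I)) : PerZ (Lop m 𝒜 U) :=
  fun x z => funext fun t => Finset.sum_congr rfl fun k hk => Finset.sum_congr rfl fun I _ => by
    rw [h𝒜 k (Finset.mem_range.1 hk) I x z, hU k I x z]

theorem lop_eq_frozen (U : (k : ℕ) → (Fin k → Fin n) → Vec n → ℝ → Vec l) (x : Vec n) (t : ℝ) :
    Lop (r + 1) 𝒜 U x t = ∑ I, 𝒜 r I 0 0 (U r I x t) +
      (Lop r 𝒜 U x t + ∑ I, (𝒜 r I x t - 𝒜 r I 0 0) (U r I x t)) := by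
  simp only [lop_succ, sub_apply, Finset.sum_sub_distrib]
  abel

/-- A solution of the integral equation yields a classical solution of the initial value
problem. -/
theorem memPar_of_fixed {N : ℝ} {g : Vec n → ℝ → Vec l} (hK : IsKer r (fun I => 𝒜 r I 0 0) K)
    (hE : HeatEst r α T C K)
    (hr : 2 ≤ r) (hα0 : 0 < α) (hα1 : α < 1) (hT : 0 < T) (hγ : 0 ≤ γ)
    (h𝒜 : ∀ k, k ≤ r → ∀ I, ∃ c, PHol r α T c (𝒜 k I)) (hf : ∃ c, PHol r α T c f)
    (hu : MemSp r α univ u₀) (hp : PerZ u₀) (hg : Wt T α γ N g)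
    (hfix : ∀ x t, g x t - Bop r T 𝒜 K g x t = f x t + Lop (r + 1) 𝒜 (initFam u₀) x t)
    {u : Vec n → ℝ → Vec l} (hu' : ∀ I₀ x t, u x t = u₀ x + vfam r T K g 0 I₀ x t) :
    MemPar r α univ (Icc 0 T) u ∧
      (∀ x, ∀ t ∈ Icc 0 T, tDerivW (Icc 0 T) u x t =
        Lop (r + 1) 𝒜 (fun k I => spDerivW univ k I u) x t + f x t) ∧ ∀ x, u x 0 = u₀ x := by
  have hsol := isSol_vfam hK hE hr hα0 hα1 hT.le hγ hg
  have hcd : ContDiff ℝ r u₀ := contDiffOn_univ.1 hu.1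
  let U : (k : ℕ) → (Fin k → Fin n) → Vec n → ℝ → Vec l := fun k I x t =>
    initFam u₀ k I x t + vfam r T K g k I x t
  have hU : ∀ k, k ≤ r → ∀ I, ∃ c, PHol r α T c (U k I) := fun k hk I => by
    obtain ⟨c, hc⟩ := exists_phol_initFam hr hα0 hα1 hT.le hu hp hk I
    obtain ⟨c', hc'⟩ := exists_phol_vfam hK hE hr hα0 hα1 hT.le hγ hg hk I
    exact ⟨_, hc.add hc'⟩
  have hU0 : ∀ I₀ t, (fun x => U 0 I₀ x t) = fun x => u x t := fun I₀ t => by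
    funext x
    rw [hu' I₀]
    simp only [U, initFam, pderivW_zero]
  have hUd : ∀ t, ∀ k, k < r → ∀ (I : Fin k → Fin n) x, HasFDerivAt (fun x => U k I x t)
      (grad fun i => U (k + 1) (Fin.cons i I : Fin (k + 1) → Fin n) x t) x := fun t k hk I x => by
    rw [grad_add]
    exact (hasFDerivAt_pderivW hcd hk I x).fun_add (hsol.fderiv k hk I x t)
  have hUc : ∀ t, ∀ k, k ≤ r → ∀ I, Continuous fun x => U k I x t := fun t k hk I => by
    obtain ⟨c, hc⟩ := hU k hk I
    exact hc.cont.comp (by fun_prop : Continuous fun x : Vec n => (x, t))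
  have hucd : ∀ t, ContDiff ℝ r fun x => u x t := fun t => by
    have := contDiff_of_family (hUc t) (hUd t) r 0 (by simp) Fin.elim0
    rwa [hU0] at this
  have hsp : ∀ k, k ≤ r → ∀ I x t, spDerivW univ k I u x t = U k I x t := fun k hk I x t =>
    congrFun (pderivW_eq_of_family (U := fun k I x => U k I x t) (hucd t) (fun I₀ => hU0 I₀ t)
      (hUd t) k hk I) x
  let D : Vec n → ℝ → Vec l := fun x t => Lop (r + 1) 𝒜 U x t + f x t
  obtain ⟨cD, hD⟩ : ∃ c, PHol r α T c D := by
    obtain ⟨c, hc⟩ := exists_phol_lop (m := r + 1) (fun k hk => h𝒜 k (by omega))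
      fun k hk => hU k (by omega)
    obtain ⟨c', hc'⟩ := hf
    exact ⟨_, hc.add hc'⟩
  have htime : ∀ x, ∀ t ∈ Icc 0 T, HasDerivWithinAt (fun s => u x s) (D x t) (Icc 0 T) t := by
    intro x t ht
    have h1 := (hsol.time Fin.elim0 x t ht).const_add (u₀ x)
    simp only [← hu' Fin.elim0 x] at h1
    refine h1.congr_deriv ?_
    have h2 : D x t = f x t + (Lop (r + 1) 𝒜 (initFam u₀) x t +
        Lop (r + 1) 𝒜 (vfam r T K g) x t) := by
      rw [← lop_add, add_comm]
    rw [h2, lop_eq_frozen (vfam r T K g), ← add_assoc, ← hfix x t, Bop]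
    abel
  have htd : ∀ x, ∀ t ∈ Icc 0 T, tDerivW (Icc 0 T) u x t = D x t := fun x t ht =>
    (htime x t ht).derivWithin (uniqueDiffOn_Icc hT t ht)
  refine ⟨⟨?_, fun t _ => (hucd t).contDiffOn, fun x _ t ht =>
    (htime x t ht).differentiableWithinAt, fun k hk I => ?_, ?_, fun I => ?_,
    hD.bddAbove_holQuot htd⟩, fun x t ht => ?_, fun x => ?_⟩
  · obtain ⟨c, hc⟩ := hU 0 (Nat.zero_le _) Fin.elim0
    exact hc.cont.continuousOn.congr fun p _ => (congrFun (hU0 Fin.elim0 p.2) p.1).symm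
  · obtain ⟨c, hc⟩ := hU k hk I
    exact hc.cont.continuousOn.congr fun p _ => hsp k hk I p.1 p.2
  · exact hD.cont.continuousOn.congr fun p hp => htd p.1 p.2 hp.2
  · obtain ⟨c, hc⟩ := hU r le_rfl I
    exact hc.bddAbove_holQuot fun x t _ => hsp r le_rfl I x t
  · rw [htd x t ht, lop_congr (V := U) fun k hk I => hsp k (by omega) I x t]
  · rw [hu' Fin.elim0, hsol.init, add_zero]

/-- Every classical solution arises from a solution of the integral equation. -/
theorem exists_fixed_of_memPar (hdata : Data r T α H 𝒜)
    (hK : IsKer r (fun I => 𝒜 r I 0 0) K) (hE : HeatEst r α T C K)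
    (hr : 2 ≤ r) (hα0 : 0 < α) (hα1 : α < 1) (hT : 0 < T) (hγ : 0 ≤ γ)
    (h𝒜 : ∀ k, k ≤ r → ∀ I, ∃ c, PHol r α T c (𝒜 k I)) (hf : ∃ c, PHol r α T c f)
    (hfp : PerZ f) (hu : MemSp r α univ u₀) (hp : PerZ u₀)
    {u : Vec n → ℝ → Vec l} (hmem : MemPar r α univ (Icc 0 T) u) (hup : PerZ u)
    (heq : ∀ x, ∀ t ∈ Icc 0 T, tDerivW (Icc 0 T) u x t =
        Lop (r + 1) 𝒜 (fun k I => spDerivW univ k I u) x t + f x t) (hinit : ∀ x, u x 0 = u₀ x) :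
    ∃ g N, Wt T α γ N g ∧ PerZ g ∧
      (∀ x t, g x t - Bop r T 𝒜 K g x t = f x t + Lop (r + 1) 𝒜 (initFam u₀) x t) ∧
      ∀ I₀ x, ∀ t ∈ Icc 0 T, u x t = u₀ x + vfam r T K g 0 I₀ x t := by
  obtain ⟨-, hucd, hud, husp, -, husph, -⟩ := hmem
  have hcd : ContDiff ℝ r u₀ := contDiffOn_univ.1 hu.1
  let W : (k : ℕ) → (Fin k → Fin n) → Vec n → ℝ → Vec l := fun k I x t =>
    spDerivW univ k I u x (clamp T t) - initFam u₀ k I x t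
  have hspp : ∀ k (I : Fin k → Fin n), PerZ (spDerivW univ k I u) := fun k I x m =>
    funext fun t => perZ_pderivW (fun z m => congrFun (hup z m) t) I x m
  have hW0 : ∀ I₀ x, ∀ t ∈ Icc 0 T, W 0 I₀ x t = u x t - u₀ x := fun I₀ x t ht => by
    simp only [W, initFam, spDerivW, pderivW_zero, clamp_eq ht]
  have hWp : ∀ k (I : Fin k → Fin n), PerZ (W k I) := fun k I x m => funext fun t => by
    simp only [W, initFam, hspp k I x m, perZ_pderivW hp I x m]
  have hWc : ∀ k, k ≤ r → ∀ I, Continuous fun p : Vec n × ℝ => W k I p.1 p.2 := fun k hk I =>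
    (continuous_comp_clamp hT.le (husp k hk I)).sub
      ((continuous_pderivW hcd hk I).comp continuous_fst)
  have hWcl : ∀ k (I : Fin k → Fin n) x s, W k I x (clamp T s) = W k I x s := fun k I x s => by
    simp only [W, clamp_clamp hT.le]
    rfl
  obtain ⟨B, hB0, hB⟩ := exists_uniform (n := n) r (P := fun k I C => ∀ x s, ‖W k I x s‖ ≤ C)
    (fun k I C C' h _ hC x s => (hC x s).trans h) fun k hk I => by
      obtain ⟨B, hB⟩ := exists_bound_of_perZ hT.le (hWc k hk I) (hWcl k I) (hWp k I)
      exact ⟨B, (norm_nonneg _).trans (hB 0 0), hB⟩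
  let b : Vec n → ℝ → Vec l := fun x t =>
    Lop r 𝒜 W x t + ∑ I, (𝒜 r I x t - 𝒜 r I 0 0) (W r I x t)
  let g : Vec n → ℝ → Vec l := fun x t => f x t + Lop (r + 1) 𝒜 (initFam u₀) x t + b x t
  have hsol : IsSol r T (fun I => 𝒜 r I 0 0) W g := by
    refine ⟨hWc, fun k _ => hWcl k, ⟨B, hB⟩, fun k hk I x s => ?_, fun I₀ x t ht => ?_,
      fun I₀ x => ?_⟩
    · rw [grad_sub]
      exact (hasFDerivAt_pderivW (contDiffOn_univ.1 (hucd _ (clamp_mem hT.le s))) hk I x).fun_sub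
        (hasFDerivAt_pderivW hcd hk I x)
    · have h1 := ((hud x (mem_univ _) t ht).hasDerivWithinAt).sub_const (u₀ x)
      refine (h1.congr (fun s hs => hW0 I₀ x s hs) (hW0 I₀ x t ht)).congr_deriv ?_
      have h2 := heq x t ht
      rw [tDerivW] at h2
      rw [h2, lop_congr (V := fun k I x t => initFam u₀ k I x t + W k I x t) fun k _ I => by
        simp only [W, clamp_eq ht, add_sub_cancel], lop_add, lop_eq_frozen W]
      simp only [g, b]
      abel
    · rw [hW0 I₀ x 0 ⟨le_rfl, hT.le⟩, hinit, sub_self]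
  have hWt : ∃ N, Wt T α γ N g := by
    have hr0 : 0 < r := by omega
    obtain ⟨c₁, h₁⟩ := hf
    obtain ⟨c₂, h₂⟩ := exists_phol_lop (r := r) (T := T) (α := α) (U := initFam u₀) (m := r + 1)
      (fun k hk => h𝒜 k (by omega))
      fun k hk => exists_phol_initFam hr hα0 hα1 hT.le hu hp (by omega)
    obtain ⟨M, hM⟩ : ∃ M, ∀ I, Ht T α 0 B M (W r I) := by
      have : ∀ I, ∃ M, 0 ≤ M ∧ Ht T α 0 B M (W r I) := fun I => by
        obtain ⟨c, hc⟩ := exists_phol_of_memLow hr0 hα0 hT.le ⟨husp r le_rfl I, husph I⟩ (hspp r I)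
        obtain ⟨c', hc'⟩ := exists_phol_initFam hr hα0 hα1 hT.le hu hp le_rfl I
        have h := (hc.ht hr0 hα0).sub (hc'.ht hr0 hα0)
        exact ⟨c + c', add_nonneg hc.nonneg hc'.nonneg, h.cont, h.clamped,
          fun s _ x => by simpa using hB r le_rfl I x s, h.hol⟩
      choose M hM0 hM using this
      exact ⟨∑ I, M I, fun I => (hM I).mono le_rfl
        (Finset.single_le_sum (fun I _ => hM0 I) (Finset.mem_univ I))⟩
    have h₃ := ht_bop_aux (γ := 0) hdata hT.le (fun k hk I => hsol.ht_of_lt hα0 hα1 hB0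
      (fun k hk I s _ x => by simpa using hB k hk I x s) hk I) hM
    exact (((h₁.ht hr0 hα0).add (h₂.ht hr0 hα0)).add h₃).exists_wt hT.le hγ
  obtain ⟨N, hN⟩ := hWt
  have hWv : ∀ k, k ≤ r → ∀ I x t, W k I x t = vfam r T K g k I x t := fun k hk I x t =>
    hsol.unique hr hT.le hK (isSol_vfam hK hE hr hα0 hα1 hT.le hγ hN) hk I x t
  refine ⟨g, N, hN, fun x m => funext fun t => ?_, fun x t => ?_, fun I₀ x t ht => ?_⟩
  · have e : ∀ k, k ≤ r → ∀ (I : Fin k → Fin n), 𝒜 k I (x + (EuclideanSpace.equiv (Fin n) ℝ).symm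
      fun i => (m i : ℝ)) = 𝒜 k I x := fun k hk I => hdata.per k hk I x m
    simp only [g, b, hfp x m]
    rw [perZ_lop (fun k hk => hdata.per k (by omega))
        (fun k I x m => funext fun _ => perZ_pderivW hp I x m) x m,
      perZ_lop (fun k hk => hdata.per k (by omega)) hWp x m]
    simp only [e r le_rfl, hWp r _ x m]
  · have : b x t = Bop r T 𝒜 K g x t := by
      simp only [b, Bop]
      rw [lop_congr fun k hk I => hWv k (le_of_lt hk) I x t]
      simp only [hWv r le_rfl]
    rw [← this]
    simp only [g, add_sub_cancel_right]
  · rw [← hWv 0 (Nat.zero_le _), hW0 I₀ x t ht, add_sub_cancel]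

end Problem

section Coefficients
variable {n l r : ℕ} {α T : ℝ} {A : (k : ℕ) → (Fin k → Fin n) → Fin l → Fin l → Vec n → ℝ → ℝ}

/-- Matrix units. -/
def unit (a b : Fin l) : Mat l := (EuclideanSpace.proj b : Vec l →L[ℝ] ℝ).smulRight (ee a)

/-- The coefficients as matrix valued functions, truncated in time. -/
def coefMat (T : ℝ) (A : (k : ℕ) → (Fin k → Fin n) → Fin l → Fin l → Vec n → ℝ → ℝ) (k : ℕ)
    (I : Fin k → Fin n) (x : Vec n) (t : ℝ) : Mat l :=
  ∑ a, ∑ b, A k I a b x (clamp T t) • unit a b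

theorem coefMat_apply {k : ℕ} (I : Fin k → Fin n) (x : Vec n) (t : ℝ) (v : Vec l) (a : Fin l) :
    coefMat T A k I x t v a = ∑ b, A k I a b x (clamp T t) * v b := by
  simp [coefMat, unit, ee, sum_apply, smul_apply, Finset.sum_apply, Pi.single_apply]

theorem inner_coefMat {k : ℕ} (I : Fin k → Fin n) (x : Vec n) (t : ℝ) (v : Vec l) :
    inner ℝ (coefMat T A k I x t v) v = ∑ a, ∑ b, A k I a b x (clamp T t) * v a * v b := by
  rw [PiLp.inner_apply]
  refine Finset.sum_congr rfl fun a _ => ?_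
  rw [coefMat_apply, show ∀ p q : ℝ, inner ℝ p q = p * q from fun p q => by simp [mul_comm],
    Finset.sum_mul]
  exact Finset.sum_congr rfl fun b _ => by ring

theorem exists_phol_coefMat (hr : 0 < r) (hα0 : 0 < α) (hT : 0 ≤ T)
    (hA : ∀ k, k ≤ r → ∀ I : Fin k → Fin n, ∀ a b : Fin l,
      MemLow r α (univ ×ˢ Icc 0 T) (toV1 (A k I a b)) ∧ PerZ (A k I a b)) {k : ℕ} (hk : k ≤ r)
    (I : Fin k → Fin n) : ∃ c, PHol r α T c (coefMat T A k I) :=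
  exists_phol_sum _ fun a _ => exists_phol_sum _ fun b _ => by
    obtain ⟨h1, h2⟩ := hA k hk I a b
    obtain ⟨c, hc⟩ := exists_phol_of_memLow hr hα0 hT h1 fun x m => funext fun t => by
      simp only [toV1, h2 x m]
    exact ⟨_, hc.map ((EuclideanSpace.proj 0 : Vec 1 →L[ℝ] ℝ).smulRight (unit a b : Mat l))⟩

theorem exists_data (hr : 0 < r) (hα0 : 0 < α) (hT : 0 ≤ T) {lam : ℝ} (hlam : 0 < lam)
    (hA : ∀ k, k ≤ r → ∀ I : Fin k → Fin n, ∀ a b : Fin l,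
      MemLow r α (univ ×ˢ Icc 0 T) (toV1 (A k I a b)) ∧ PerZ (A k I a b))
    (hell : StrongEllip r A (univ ×ˢ Icc 0 T) lam) : ∃ H, 0 ≤ H ∧ Data r T α H (coefMat T A) := by
  obtain ⟨H, hH0, hH⟩ := exists_uniform (n := n) r (P := fun k I C => Ht T α 0 C C (coefMat T A k I))
    (fun k I C C' h _ hC => hC.mono h h) fun k hk I => by
      obtain ⟨c, hc⟩ := exists_phol_coefMat hr hα0 hT hA hk I
      exact ⟨c, hc.nonneg, hc.ht hr hα0⟩
  refine ⟨H, hH0, hH, fun k hk I x m => funext fun t => ?_, lam, hlam, fun x t ht ξ v => ?_⟩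
  · simp only [coefMat, (hA k hk I _ _).2 x m]
  · refine (hell (x, t) ⟨mem_univ _, ht⟩ ξ v).trans (le_of_eq ?_)
    congr 1
    refine Finset.sum_congr rfl fun I _ => ?_
    rw [inner_coefMat, clamp_eq ht, Finset.mul_sum]
    refine Finset.sum_congr rfl fun a _ => ?_
    rw [Finset.mul_sum]
    exact Finset.sum_congr rfl fun b _ => by ring

theorem applyL_eq_lop (u : Vec n → ℝ → Vec l) (x : Vec n) {t : ℝ} (ht : t ∈ Icc 0 T) :
    applyL r univ A u x t =
      Lop (r + 1) (coefMat T A) (fun k I => spDerivW univ k I u) x t := by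
  ext a
  simp [applyL, Lop, coefMat_apply, clamp_eq ht]

end Coefficients

theorem Data.ell_frozen {n l r : ℕ} {α T H : ℝ}
    {𝒜 : (k : ℕ) → (Fin k → Fin n) → Vec n → ℝ → Mat l} (hT : 0 ≤ T) (h : Data r T α H 𝒜) :
    EllC r fun I => 𝒜 r I 0 0 := by
  obtain ⟨c, hc, hell⟩ := h.ell
  exact ⟨c, hc, fun ξ v => hell 0 0 ⟨le_rfl, hT⟩ ξ v⟩

/-- The initial value problem, with coefficients and right-hand side truncated in time. -/
theorem existsUnique_of_phol {n l r : ℕ} {α T H : ℝ}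
    {𝒜 : (k : ℕ) → (Fin k → Fin n) → Vec n → ℝ → Mat l} {f : Vec n → ℝ → Vec l}
    {u₀ : Vec n → Vec l} (hdata : Data r T α H 𝒜) (hH : 0 ≤ H) (hr : 2 ≤ r) (hrev : Even r)
    (hα0 : 0 < α) (hα1 : α < 1) (hT : 0 < T)
    (h𝒜 : ∀ k, k ≤ r → ∀ I, ∃ c, PHol r α T c (𝒜 k I)) (hf : ∃ c, PHol r α T c f)
    (hfp : PerZ f) (hu : MemSp r α univ u₀) (hp : PerZ u₀) :
    ∃ u : Vec n → ℝ → Vec l,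
      (MemPar r α univ (Icc 0 T) u ∧ PerZ u ∧
        (∀ x, ∀ t ∈ Icc (0 : ℝ) T, tDerivW (Icc 0 T) u x t =
          Lop (r + 1) 𝒜 (fun k I => spDerivW univ k I u) x t + f x t) ∧ ∀ x, u x 0 = u₀ x) ∧
      ∀ u' : Vec n → ℝ → Vec l,
        (MemPar r α univ (Icc 0 T) u' ∧ PerZ u' ∧
          (∀ x, ∀ t ∈ Icc (0 : ℝ) T, tDerivW (Icc 0 T) u' x t =
            Lop (r + 1) 𝒜 (fun k I => spDerivW univ k I u') x t + f x t) ∧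
          ∀ x, u' x 0 = u₀ x) →
        ∀ x, ∀ t ∈ Icc (0 : ℝ) T, u' x t = u x t := by
  obtain ⟨K, hK⟩ := exists_isKer hr hrev (fun I => 𝒜 r I 0 0) (hdata.ell_frozen hT.le)
  obtain ⟨C, hE⟩ := exists_heatEst hα0 hα1 hr hT.le K
  obtain ⟨γ, hγ, huniq, hex⟩ := hdata.exists_solution hr hrev hα0 hα1 hT.le hH hK hE
  obtain ⟨N, hF⟩ : ∃ N, Wt T α γ N fun x t => f x t + Lop (r + 1) 𝒜 (initFam u₀) x t := by
    obtain ⟨c₁, h₁⟩ := hf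
    obtain ⟨c₂, h₂⟩ := exists_phol_lop (r := r) (T := T) (α := α) (U := initFam u₀) (m := r + 1)
      (fun k hk => h𝒜 k (by omega))
      fun k hk => exists_phol_initFam hr hα0 hα1 hT.le hu hp (by omega)
    exact ((h₁.add h₂).ht (by omega) hα0).exists_wt hT.le hγ.le
  obtain ⟨g, N', hg, hgp, hfix⟩ := hex _ N hF fun x m => funext fun t => by
    rw [hfp x m, perZ_lop (fun k hk => hdata.per k (by omega))
      (fun k I x m => funext fun _ => perZ_pderivW hp I x m) x m]
  obtain ⟨h1, h2, h3⟩ := memPar_of_fixed hK hE hr hα0 hα1 hT hγ.le h𝒜 hf hu hp hg hfix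
    (u := fun x t => u₀ x + vfam r T K g 0 Fin.elim0 x t)
    fun I₀ x t => by rw [Subsingleton.elim I₀ Fin.elim0]
  refine ⟨_, ⟨h1, fun x m => funext fun t => ?_, h2, h3⟩, ?_⟩
  · dsimp only
    rw [hp x m, vfam_shift fun x t => congrFun (hgp x m) t]
  · rintro u' ⟨hm, hup, heq, hinit⟩ x t ht
    obtain ⟨g', N'', hg', hgp', hfix', hu'⟩ := exists_fixed_of_memPar hdata hK hE hr hα0 hα1 hT
      hγ.le h𝒜 hf hfp hu hp hm hup heq hinit
    have h0 := huniq _ _ (hg'.sub hg)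
      (fun x m => funext fun t => by rw [hgp x m, hgp' x m]) fun x t => by
        rw [bop_sub hE hr hα0 hT.le hγ.le hg' hg, sub_sub_sub_comm, hfix', hfix, sub_self]
    have hgg : g' = g := funext fun x => funext fun t => by
      rw [← hg'.clamped, ← hg.clamped]
      exact sub_eq_zero.1 (h0 x _ (clamp_mem hT.le t))
    rw [hu' Fin.elim0 x t ht, hgg]

/-- Existence and uniqueness for the linear parabolic system. -/
theorem existsUnique_parabolic {n l r : ℕ} (hr : 2 ≤ r) (hrev : Even r) {α : ℝ} (hα0 : 0 < α)
    (hα1 : α < 1) {T : ℝ} (hT : 0 < T) {lam : ℝ} (hlam : 0 < lam)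
    {A : (k : ℕ) → (Fin k → Fin n) → Fin l → Fin l → Vec n → ℝ → ℝ}
    (hA : ∀ k, k ≤ r → ∀ I : Fin k → Fin n, ∀ a b : Fin l,
      MemLow r α (univ ×ˢ Icc 0 T) (toV1 (A k I a b)) ∧ PerZ (A k I a b))
    (hell : StrongEllip r A (univ ×ˢ Icc 0 T) lam) {f : Vec n → ℝ → Vec l}
    (hf : MemLow r α (univ ×ˢ Icc 0 T) f) (hfper : PerZ f) {u₀ : Vec n → Vec l}
    (hu₀ : MemSp r α univ u₀) (hu₀per : PerZ u₀) :
    ∃ u : Vec n → ℝ → Vec l,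
      (MemPar r α univ (Icc 0 T) u ∧ PerZ u ∧
        (∀ x, ∀ t ∈ Icc (0 : ℝ) T,
          tDerivW (Icc 0 T) u x t = applyL r univ A u x t + f x t) ∧ ∀ x, u x 0 = u₀ x) ∧
      ∀ u' : Vec n → ℝ → Vec l,
        (MemPar r α univ (Icc 0 T) u' ∧ PerZ u' ∧
          (∀ x, ∀ t ∈ Icc (0 : ℝ) T,
            tDerivW (Icc 0 T) u' x t = applyL r univ A u' x t + f x t) ∧ ∀ x, u' x 0 = u₀ x) →
        ∀ x, ∀ t ∈ Icc (0 : ℝ) T, u' x t = u x t := by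
  have hr0 : 0 < r := by omega
  obtain ⟨H, hH, hdata⟩ := exists_data hr0 hα0 hT.le hlam hA hell
  have e : ∀ u : Vec n → ℝ → Vec l, (∀ x, ∀ t ∈ Icc (0 : ℝ) T, tDerivW (Icc 0 T) u x t =
        applyL r univ A u x t + f x t) ↔ ∀ x, ∀ t ∈ Icc (0 : ℝ) T, tDerivW (Icc 0 T) u x t =
        Lop (r + 1) (coefMat T A) (fun k I => spDerivW univ k I u) x t + f x (clamp T t) :=
    fun u => forall_congr' fun x => forall₂_congr fun t ht => by
      rw [applyL_eq_lop u x ht, clamp_eq ht]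
  simp only [e]
  exact existsUnique_of_phol hdata hH hr hrev hα0 hα1 hT
    (fun k hk I => exists_phol_coefMat hr0 hα0 hT.le hA hk I)
    (exists_phol_of_memLow hr0 hα0 hT.le hf hfper) (perZ_comp_clamp hfper) hu₀ hu₀per

end ParaTorus

/-- **Existence and uniqueness for linear strongly parabolic systems on the torus**
(Theorem 2.4 for `M = 𝕋^n` with the trivial bundle): for `ℤ^n`-periodic `C^{α,α/r}`
coefficients satisfying the Legendre–Hadamard condition, periodic `f ∈ C^{α,α/r}` and
periodic `u₀ ∈ C^{r+α}`, there is exactly one periodic solution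
`u ∈ C^{r+α,1+α/r}` of `∂u/∂t = L_t u + f`, `u(⋅,0) = u₀`. -/
theorem linear_parabolic_existence_uniqueness_torus
    (n l r : ℕ) (hn : 1 ≤ n) (hl : 1 ≤ l) (hr : 2 ≤ r) (hrev : Even r)
    (α : ℝ) (hα0 : 0 < α) (hα1 : α < 1)
    (T : ℝ) (hT : 0 < T) (lam : ℝ) (hlam : 0 < lam)
    (A : (k : ℕ) → (Fin k → Fin n) → Fin l → Fin l → Vec n → ℝ → ℝ)
    (hA : ∀ k, k ≤ r → ∀ I : Fin k → Fin n, ∀ a b : Fin l,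
      MemLow r α (Set.univ ×ˢ Set.Icc 0 T) (toV1 (A k I a b)) ∧ PerZ (A k I a b))
    (hell : StrongEllip r A (Set.univ ×ˢ Set.Icc 0 T) lam)
    (f : Vec n → ℝ → Vec l)
    (hf : MemLow r α (Set.univ ×ˢ Set.Icc 0 T) f) (hfper : PerZ f)
    (u₀ : Vec n → Vec l)
    (hu₀ : MemSp r α Set.univ u₀) (hu₀per : PerZ u₀) :
    ∃ u : Vec n → ℝ → Vec l,
      (MemPar r α Set.univ (Set.Icc 0 T) u ∧ PerZ u ∧
        (∀ x : Vec n, ∀ t ∈ Set.Icc (0 : ℝ) T,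
          tDerivW (Set.Icc 0 T) u x t = applyL r Set.univ A u x t + f x t) ∧
        (∀ x : Vec n, u x 0 = u₀ x)) ∧
      ∀ u' : Vec n → ℝ → Vec l,
        (MemPar r α Set.univ (Set.Icc 0 T) u' ∧ PerZ u' ∧
          (∀ x : Vec n, ∀ t ∈ Set.Icc (0 : ℝ) T,
            tDerivW (Set.Icc 0 T) u' x t = applyL r Set.univ A u' x t + f x t) ∧
          (∀ x : Vec n, u' x 0 = u₀ x)) →
        ∀ x : Vec n, ∀ t ∈ Set.Icc (0 : ℝ) T, u' x t = u x t := by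
  exact ParaTorus.existsUnique_parabolic hr hrev hα0 hα1 hT hlam hA hell hf hfper hu₀ hu₀per
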